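/- Let k ≥ 3 be an integer and let f : ℝ → ℝ be a k-times continuously differentiable function with f(x + 1) = f(x) + 1 and f'(x) > 0 for all x ∈ ℝ (so f is the lift of a C^k circle diffeomorphism). Let α be the translation number of f, i.e. α = lim_{n→∞} (fⁿ(x) − x)/n, and suppose α is (C, τ)-Diophantine for some C > 0 and 1 < τ < k − 1. Then there exists a strictly increasing function h : ℝ → ℝ with h(x + 1) = h(x) + 1 for all x, satisfying h(f(x)) = h(x) + α for all x ∈ ℝ, such that h is m-times continuously differentiable for every integer m with 0 ≤ m < k − τ. -/

import Mathlib

open Finset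

theorem exists_mem_uIcc_deriv_eq {g g' : ℝ → ℝ} (hg : ∀ x, HasDerivAt g (g' x) x) (x y : ℝ) :
    ∃ ξ ∈ Set.uIcc x y, g y - g x = g' ξ * (y - x) := by
  rcases lt_trichotomy x y with h | h | h
  · obtain ⟨c, hc, hc'⟩ := exists_hasDerivAt_eq_slope g g' h
      (fun z _ => (hg z).continuousAt.continuousWithinAt) (fun z _ => hg z)
    refine ⟨c, Set.Icc_subset_uIcc (Set.Ioo_subset_Icc_self hc), ?_⟩
    rw [hc', div_mul_cancel₀ _ (sub_ne_zero.2 h.ne')]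
  · exact ⟨x, by simp, by simp [h]⟩
  · obtain ⟨c, hc, hc'⟩ := exists_hasDerivAt_eq_slope g g' h
      (fun z _ => (hg z).continuousAt.continuousWithinAt) (fun z _ => hg z)
    refine ⟨c, Set.Icc_subset_uIcc' (Set.Ioo_subset_Icc_self hc), ?_⟩
    rw [hc', ← neg_sub x y, mul_neg, div_mul_cancel₀ _ (sub_ne_zero.2 h.ne'), neg_sub]

theorem hasDerivAt_iteratedDeriv {g : ℝ → ℝ} {n r : ℕ} (hg : ContDiff ℝ n g) (h : r < n) (x : ℝ) :
    HasDerivAt (iteratedDeriv r g) (iteratedDeriv (r + 1) g x) x := by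
  rw [iteratedDeriv_succ]
  exact ((hg.differentiable_iteratedDeriv r (by exact_mod_cast h)) x).hasDerivAt

theorem abs_sub_le_of_abs_deriv_le {g g' : ℝ → ℝ} (hg : ∀ x, HasDerivAt g (g' x) x) {M : ℝ}
    (x y : ℝ) (h : ∀ z ∈ Set.uIcc x y, |g' z| ≤ M) : |g y - g x| ≤ M * |y - x| := by
  obtain ⟨ξ, hξ, e⟩ := exists_mem_uIcc_deriv_eq hg x y
  rw [e, abs_mul]
  exact mul_le_mul_of_nonneg_right (h ξ hξ) (abs_nonneg _)

/-- If every bound `M` on `f` improves to `a + ρ M` with `ρ < 1`, then `f ≤ a / (1 - ρ)`. -/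
theorem le_div_of_bootstrap {ι : Type*} [Nonempty ι] {f : ι → ℝ} (hf : BddAbove (Set.range f))
    {a ρ : ℝ} (hρ : ρ < 1) (h : ∀ M, (∀ i, f i ≤ M) → ∀ i, f i ≤ a + ρ * M) (i : ι) :
    f i ≤ a / (1 - ρ) := by
  have h1 : ∀ i, f i ≤ ⨆ j, f j := fun i => le_ciSup hf i
  have h2 : (⨆ j, f j) ≤ a + ρ * ⨆ j, f j := ciSup_le (h _ h1)
  refine (h1 i).trans ?_
  rw [le_div_iff₀ (by linarith)]
  linarith

theorem exists_bound_iteratedDeriv_exp (n : ℕ) : ∃ C : ℝ, 1 ≤ C ∧ ∀ i : ℕ, 1 ≤ i → i ≤ n →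
    ∀ (u : ℝ → ℝ), ContDiff ℝ i u → ∀ (x ε l : ℝ), 0 ≤ ε → ε ≤ 1 → 0 ≤ l →
    (∀ j : ℕ, 1 ≤ j → j ≤ i → |iteratedDeriv j u x| ≤ ε * l ^ j) →
    |iteratedDeriv i (fun y => Real.exp (u y)) x| ≤ C * ε * l ^ i * Real.exp (u x) := by
  induction n with
  | zero => exact ⟨1, le_rfl, fun i h1 h2 => by omega⟩
  | succ n ih =>
    obtain ⟨C, hC, h⟩ := ih
    have hC' : C ≤ 2 ^ n * C := by
      have : (1:ℝ) ≤ 2 ^ n := one_le_pow₀ (by norm_num)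
      nlinarith
    refine ⟨2 ^ n * C, hC.trans hC', fun i h1 h2 u hu x ε l hε hε1 hl hb => ?_⟩
    rcases Nat.lt_or_ge n i with hi | hi
    swap
    · refine (h i h1 hi u hu x ε l hε hε1 hl hb).trans ?_
      gcongr
    obtain rfl : i = n + 1 := by omega
    have hd : deriv (fun y => Real.exp (u y)) = fun y => deriv u y * Real.exp (u y) := by
      ext y
      have := ((hu.differentiable (by simp)) y).hasDerivAt.exp.deriv
      rw [this, mul_comm]
    have hu' : ContDiff ℝ n (deriv u) := by
      have := (contDiff_succ_iff_deriv (n := (n:WithTop ℕ∞))).1 (by exact_mod_cast hu)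
      exact this.2.2
    have hun : ContDiff ℝ n u := hu.of_le (by exact_mod_cast Nat.le_succ n)
    rw [iteratedDeriv_succ', hd, iteratedDeriv_fun_mul hu'.contDiffAt hun.exp.contDiffAt]
    refine (abs_sum_le_sum_abs _ _).trans ?_
    have key : ∀ j ∈ range (n + 1), |(n.choose j : ℝ) * iteratedDeriv j (deriv u) x *
        iteratedDeriv (n - j) (fun y => Real.exp (u y)) x| ≤
        (n.choose j : ℝ) * (C * ε * l ^ (n + 1) * Real.exp (u x)) := by
      intro j hj
      have hj : j ≤ n := by simpa [Nat.lt_succ_iff] using hj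
      rw [abs_mul, abs_mul, mul_assoc, Nat.abs_cast]
      refine mul_le_mul_of_nonneg_left ?_ (Nat.cast_nonneg _)
      rw [← iteratedDeriv_succ']
      have b1 := hb (j + 1) (by omega) (by omega)
      have b2 : |iteratedDeriv (n - j) (fun y => Real.exp (u y)) x| ≤
          C * l ^ (n - j) * Real.exp (u x) := by
        rcases Nat.eq_zero_or_pos (n - j) with h0 | h0
        · rw [h0]
          simp only [iteratedDeriv_zero, pow_zero, mul_one, Real.abs_exp]
          nlinarith [Real.exp_pos (u x)]
        · refine (h (n - j) h0 (by omega) u (hun.of_le (by exact_mod_cast Nat.sub_le n j)) x ε l hε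
            hε1 hl (fun j' h1 h2 => hb j' h1 (by omega))).trans ?_
          gcongr
          nlinarith
      calc _ ≤ (ε * l ^ (j + 1)) * (C * l ^ (n - j) * Real.exp (u x)) :=
            mul_le_mul b1 b2 (abs_nonneg _) (by positivity)
        _ = C * ε * (l ^ (j + 1) * l ^ (n - j)) * Real.exp (u x) := by ring
        _ = _ := by rw [← pow_add]; congr 3; omega
    refine (sum_le_sum key).trans ?_
    rw [← sum_mul, ← Nat.cast_sum, Nat.sum_range_choose]
    push_cast
    apply le_of_eq
    ring

/-- Quantitative Faà di Bruno estimate with the leading term singled out. -/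
theorem exists_bound_iteratedDeriv_comp (n : ℕ) : ∃ C : ℝ, 1 ≤ C ∧ ∀ r : ℕ, 1 ≤ r → r ≤ n →
    ∀ (ψ g u : ℝ → ℝ), ContDiff ℝ r ψ → ContDiff ℝ (r - 1 : ℕ) u →
    (∀ y, HasDerivAt g (Real.exp (u y)) y) → ∀ (x ε l K : ℝ), 0 ≤ ε → ε ≤ 1 → 0 ≤ l → 0 ≤ K →
    (∀ j : ℕ, 1 ≤ j → j < r → |iteratedDeriv j ψ (g x)| * Real.exp (u x) ^ j ≤ K * l ^ j) →
    (∀ j : ℕ, 1 ≤ j → j < r → |iteratedDeriv j u x| ≤ ε * l ^ j) →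
    |iteratedDeriv r (fun y => ψ (g y)) x - iteratedDeriv r ψ (g x) * Real.exp (u x) ^ r| ≤
      C * ε * K * l ^ r := by
  obtain ⟨B, hB, hexp⟩ := exists_bound_iteratedDeriv_exp n
  have main : ∀ N : ℕ, ∃ C : ℝ, 1 ≤ C ∧ ∀ r : ℕ, 1 ≤ r → r ≤ N → r ≤ n →
    ∀ (ψ g u : ℝ → ℝ), ContDiff ℝ r ψ → ContDiff ℝ (r - 1 : ℕ) u →
    (∀ y, HasDerivAt g (Real.exp (u y)) y) → ∀ (x ε l K : ℝ), 0 ≤ ε → ε ≤ 1 → 0 ≤ l → 0 ≤ K →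
    (∀ j : ℕ, 1 ≤ j → j < r → |iteratedDeriv j ψ (g x)| * Real.exp (u x) ^ j ≤ K * l ^ j) →
    (∀ j : ℕ, 1 ≤ j → j < r → |iteratedDeriv j u x| ≤ ε * l ^ j) →
    |iteratedDeriv r (fun y => ψ (g y)) x - iteratedDeriv r ψ (g x) * Real.exp (u x) ^ r| ≤
      C * ε * K * l ^ r := by
    intro N
    induction N with
    | zero => exact ⟨1, le_rfl, fun i h1 h2 => by omega⟩
    | succ N ih =>
    obtain ⟨C, hC, h⟩ := ih
    have hC' : C ≤ 2 ^ N * ((1 + C) * B) := by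
      have : (1:ℝ) ≤ 2 ^ N := one_le_pow₀ (by norm_num)
      have h2 : C ≤ (1 + C) * B := by nlinarith
      nlinarith
    refine ⟨2 ^ N * ((1 + C) * B), hC.trans hC', fun r h1 h2 h3 ψ g u hψ hu hg x ε l K hε hε1 hl hK
      hb hub => ?_⟩
    rcases Nat.lt_or_ge N r with hi | hi
    swap
    · refine (h r h1 hi h3 ψ g u hψ hu hg x ε l K hε hε1 hl hK hb hub).trans ?_
      gcongr
    obtain rfl : r = N + 1 := by omega
    have hu : ContDiff ℝ N u := hu
    have hgd : deriv g = fun y => Real.exp (u y) := funext fun y => (hg y).deriv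
    have hgN : ContDiff ℝ N g := by
      cases N with
      | zero =>
        exact contDiff_zero.2 (continuous_iff_continuousAt.2 fun y => (hg y).continuousAt)
      | succ N =>
        have : ContDiff ℝ ((N : WithTop ℕ∞) + 1) g := by
          rw [contDiff_succ_iff_deriv]
          refine ⟨fun y => (hg y).differentiableAt, by simp, ?_⟩
          rw [hgd]
          exact (hu.of_le (by exact_mod_cast Nat.le_succ N)).exp
        exact_mod_cast this
    have hψ' : ContDiff ℝ N (deriv ψ) := by
      have := (contDiff_succ_iff_deriv (n := (N:WithTop ℕ∞))).1 (by exact_mod_cast hψ)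
      exact this.2.2
    have hd : deriv (fun y => ψ (g y)) = fun y => deriv ψ (g y) * Real.exp (u y) := by
      ext y
      exact (((hψ.differentiable (by simp)) (g y)).hasDerivAt.comp y (hg y)).deriv
    set p := Real.exp (u x) with hp
    have hp0 : 0 < p := Real.exp_pos _
    have hc : ContDiff ℝ N (fun y => deriv ψ (g y)) := hψ'.comp hgN
    rw [iteratedDeriv_succ', hd, iteratedDeriv_fun_mul hc.contDiffAt hu.exp.contDiffAt]
    have hK' : 0 ≤ K * l / p := by positivity
    have hb' : ∀ j : ℕ, j < N → |iteratedDeriv j (deriv ψ) (g x)| * p ^ j ≤ K * l / p * l ^ j := by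
      intro j hj
      have := hb (j + 1) (by omega) (by omega)
      rw [← iteratedDeriv_succ', div_mul_eq_mul_div, le_div_iff₀ hp0]
      calc _ = |iteratedDeriv (j + 1) ψ (g x)| * p ^ (j + 1) := by ring
        _ ≤ _ := this
        _ = _ := by ring
    have herr : ∀ i : ℕ, 1 ≤ i → i ≤ N → |iteratedDeriv i (fun y => deriv ψ (g y)) x -
        iteratedDeriv i (deriv ψ) (g x) * p ^ i| ≤ C * ε * (K * l / p) * l ^ i := by
      intro i h1 h2
      exact h i h1 h2 (by omega) (deriv ψ) g u (hψ'.of_le (by exact_mod_cast h2))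
        (hu.of_le (by exact_mod_cast (by omega))) hg x ε l _ hε hε1 hl hK'
        (fun j _ hj2 => hb' j (by omega)) (fun j hj1 hj2 => hub j hj1 (by omega))
    rw [sum_range_succ]
    have key : ∀ j ∈ range N, |(N.choose j : ℝ) * iteratedDeriv j (fun y => deriv ψ (g y)) x *
        iteratedDeriv (N - j) (fun y => Real.exp (u y)) x| ≤
        (N.choose j : ℝ) * ((1 + C) * B * ε * K * l ^ (N + 1)) := by
      intro j hj
      have hj : j < N := by simpa using hj
      rw [abs_mul, abs_mul, mul_assoc, Nat.abs_cast]
      refine mul_le_mul_of_nonneg_left ?_ (Nat.cast_nonneg _)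
      have b1 : |iteratedDeriv j (fun y => deriv ψ (g y)) x| ≤ (1 + C) * (K * l / p) * l ^ j := by
        rcases Nat.eq_zero_or_pos j with h0 | h0
        · have := hb' 0 (by omega)
          subst h0
          simp only [iteratedDeriv_zero, pow_zero, mul_one] at this ⊢
          nlinarith
        · have e1 := herr j h0 hj.le
          have e2 := hb' j hj
          have e3 : |iteratedDeriv j (deriv ψ) (g x) * p ^ j| ≤ K * l / p * l ^ j := by
            rw [abs_mul, abs_of_pos (pow_pos hp0 j)]; exact e2
          have e4 := abs_sub_abs_le_abs_sub (iteratedDeriv j (fun y => deriv ψ (g y)) x)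
            (iteratedDeriv j (deriv ψ) (g x) * p ^ j)
          have e5 : C * ε * (K * l / p) * l ^ j ≤ C * (K * l / p) * l ^ j := by
            gcongr; nlinarith
          nlinarith
      have b2 := hexp (N - j) (by omega) (by omega) u
        (hu.of_le (by exact_mod_cast Nat.sub_le N j)) x ε l hε
            hε1 hl (fun j' h1 h2 => hub j' h1 (by omega))
      calc _ ≤ ((1 + C) * (K * l / p) * l ^ j) * (B * ε * l ^ (N - j) * p) :=
            mul_le_mul b1 b2 (abs_nonneg _) (by positivity)
        _ = (1 + C) * B * ε * K * (l * (l ^ j * l ^ (N - j))) := by field_simp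
        _ = _ := by rw [← pow_add, ← pow_succ']; congr 3; omega
    have last : |(N.choose N : ℝ) * iteratedDeriv N (fun y => deriv ψ (g y)) x *
        iteratedDeriv (N - N) (fun y => Real.exp (u y)) x -
        iteratedDeriv (N + 1) ψ (g x) * p ^ (N + 1)| ≤
        (N.choose N : ℝ) * ((1 + C) * B * ε * K * l ^ (N + 1)) := by
      simp only [Nat.choose_self, Nat.cast_one, one_mul, Nat.sub_self, iteratedDeriv_zero]
      have e0 : iteratedDeriv N (fun y => deriv ψ (g y)) x * p -
        iteratedDeriv (N + 1) ψ (g x) * p ^ (N + 1) =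
        (iteratedDeriv N (fun y => deriv ψ (g y)) x -
          iteratedDeriv N (deriv ψ) (g x) * p ^ N) * p := by
        rw [iteratedDeriv_succ']; ring
      rw [e0, abs_mul, abs_of_pos hp0]
      rcases Nat.eq_zero_or_pos N with h0 | h0
      · subst h0
        simp only [iteratedDeriv_zero, pow_zero, mul_one, sub_self, abs_zero, zero_mul]
        positivity
      · have e1 := herr N h0 le_rfl
        calc _ ≤ C * ε * (K * l / p) * l ^ N * p := mul_le_mul_of_nonneg_right e1 hp0.le
          _ = C * (ε * K * l ^ (N + 1)) := by field_simp; ring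
          _ ≤ ((1 + C) * B) * (ε * K * l ^ (N + 1)) := by
            gcongr; nlinarith
          _ = _ := by ring
    calc _ = |∑ j ∈ range N, (N.choose j : ℝ) * iteratedDeriv j (fun y => deriv ψ (g y)) x *
        iteratedDeriv (N - j) (fun y => Real.exp (u y)) x +
          ((N.choose N : ℝ) * iteratedDeriv N (fun y => deriv ψ (g y)) x *
        iteratedDeriv (N - N) (fun y => Real.exp (u y)) x -
        iteratedDeriv (N + 1) ψ (g x) * p ^ (N + 1))| := by rw [add_sub_assoc]
      _ ≤ ∑ j ∈ range N, (N.choose j : ℝ) * ((1 + C) * B * ε * K * l ^ (N + 1)) +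
        (N.choose N : ℝ) * ((1 + C) * B * ε * K * l ^ (N + 1)) :=
          (abs_add_le _ _).trans (add_le_add ((abs_sum_le_sum_abs _ _).trans (sum_le_sum key)) last)
      _ = _ := by
        rw [← sum_range_succ (fun j => (N.choose j : ℝ) * ((1 + C) * B * ε * K * l ^ (N + 1))),
          ← sum_mul, ← Nat.cast_sum, Nat.sum_range_choose]
        push_cast
        ring
  obtain ⟨C, hC, h⟩ := main n
  exact ⟨C, hC, fun r h1 h2 => h r h1 h2 h2⟩

/-- Denominators `q`, numerators `p` and error terms `d` of the convergents of `α`, in the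
normalization `q 0 = 0`, `q 1 = 1`. -/
structure Convergents (α : ℝ) where
  q : ℕ → ℕ
  p : ℕ → ℤ
  d : ℕ → ℝ
  a : ℕ → ℕ
  q_zero : q 0 = 0
  q_one : q 1 = 1
  p_zero : p 0 = 1
  q_add_two : ∀ n, q (n + 2) = q n + a n * q (n + 1)
  p_add_two : ∀ n, p (n + 2) = p n + a n * p (n + 1)
  a_pos : ∀ n, 1 ≤ a n
  d_eq : ∀ n, (q n : ℝ) * α - p n = (-1) ^ (n + 1) * d n
  d_pos : ∀ n, 0 < d n
  d_succ_lt : ∀ n, d (n + 1) < d n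

noncomputable def convergentStep (s : (ℕ × ℕ) × (ℤ × ℤ) × (ℝ × ℝ)) :
    (ℕ × ℕ) × (ℤ × ℤ) × (ℝ × ℝ) :=
  let a := ⌊s.2.2.1 / s.2.2.2⌋₊
  ((s.1.2, s.1.1 + a * s.1.2), (s.2.1.2, s.2.1.1 + a * s.2.1.2), (s.2.2.2, s.2.2.1 - a * s.2.2.2))

theorem Irrational.nonempty_convergents {α : ℝ} (hα : Irrational α) : Nonempty (Convergents α) := by
  let s : ℕ → (ℕ × ℕ) × (ℤ × ℤ) × (ℝ × ℝ) := fun n =>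
    convergentStep^[n] ((0, 1), (1, ⌊α⌋), (1, Int.fract α))
  have hs : ∀ n, s (n + 1) = convergentStep (s n) := fun n => by
    simp only [s, Function.iterate_succ_apply']
  have inv : ∀ n, 1 ≤ (s n).1.2 ∧ 0 < (s n).2.2.2 ∧ (s n).2.2.2 < (s n).2.2.1 ∧
      ((s n).1.1 : ℝ) * α - (s n).2.1.1 = (-1) ^ (n + 1) * (s n).2.2.1 ∧
      ((s n).1.2 : ℝ) * α - (s n).2.1.2 = (-1) ^ n * (s n).2.2.2 := by
    intro n
    induction n with
    | zero =>
      refine ⟨le_rfl, ?_, Int.fract_lt_one _, ?_, ?_⟩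
      · refine lt_of_le_of_ne (Int.fract_nonneg _) fun h => ?_
        exact hα ⟨⌊α⌋, by have := Int.self_sub_floor α; push_cast; linarith [show Int.fract α = 0 from h.symm]⟩
      · simp [s]
      · simp [s, Int.self_sub_floor]
    | succ n ih =>
      obtain ⟨h1, h2, h3, h4, h5⟩ := ih
      rw [hs]
      simp only [convergentStep]
      set x := s n
      set a := ⌊x.2.2.1 / x.2.2.2⌋₊ with ha
      have hq : 1 ≤ x.1.1 + a * x.1.2 := by
        have : 1 ≤ a := by
          rw [ha, Nat.one_le_floor_iff, le_div_iff₀ h2]; linarith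
        nlinarith
      have e : ((x.1.1 + a * x.1.2 : ℕ) : ℝ) * α - ((x.2.1.1 + a * x.2.1.2 : ℤ) : ℝ) =
          (-1) ^ (n + 1) * (x.2.2.1 - a * x.2.2.2) := by
        push_cast
        rw [pow_succ] at h4 ⊢
        linear_combination h4 + a * h5
      refine ⟨hq, ?_, ?_, h5.trans (by ring), e⟩
      · have h0 : (a : ℝ) * x.2.2.2 ≤ x.2.2.1 := by
          rw [← le_div_iff₀ h2]; exact Nat.floor_le (by have := h2.trans h3; positivity)
        refine lt_of_le_of_ne (by linarith) fun h => ?_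
        rw [← h, mul_zero] at e
        refine hα ⟨((x.2.1.1 + a * x.2.1.2 : ℤ) : ℚ) / ((x.1.1 + a * x.1.2 : ℕ) : ℚ), ?_⟩
        have h6 : ((x.1.1 + a * x.1.2 : ℕ) : ℝ) ≠ 0 := by
          exact_mod_cast (by omega : x.1.1 + a * x.1.2 ≠ 0)
        rw [Rat.cast_div, Rat.cast_intCast, Rat.cast_natCast, div_eq_iff h6]
        linarith
      · have := Nat.lt_floor_add_one (x.2.2.1 / x.2.2.2)
        rw [← ha, div_lt_iff₀ h2] at this
        linarith
  refine ⟨⟨fun n => (s n).1.1, fun n => (s n).2.1.1, fun n => (s n).2.2.1,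
    fun n => ⌊(s n).2.2.1 / (s n).2.2.2⌋₊, rfl, rfl, rfl, fun n => ?_, fun n => ?_, fun n => ?_,
    fun n => (inv n).2.2.2.1, fun n => (inv n).2.1.trans (inv n).2.2.1, fun n => ?_⟩⟩
  · rw [hs (n + 1), hs n]; rfl
  · rw [hs (n + 1), hs n]; rfl
  · rw [Nat.one_le_floor_iff, le_div_iff₀ (inv n).2.1]; linarith [(inv n).2.2.1]
  · rw [hs n]; exact (inv n).2.2.1

namespace Convergents

variable {α : ℝ} (c : Convergents α)

theorem d_add_two (n : ℕ) : c.d (n + 2) = c.d n - c.a n * c.d (n + 1) := by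
  have h0 := c.d_eq n
  have h1 := c.d_eq (n + 1)
  have h2 := c.d_eq (n + 2)
  rw [c.q_add_two, c.p_add_two] at h2
  push_cast at h2
  have e : ((-1 : ℝ)) ^ (n + 1) * (c.d (n + 2) - (c.d n - c.a n * c.d (n + 1))) = 0 := by
    have e1 : ((-1:ℝ)) ^ (n + 1 + 1) = - (-1) ^ (n + 1) := by ring
    have e2 : ((-1:ℝ)) ^ (n + 2 + 1) = (-1) ^ (n + 1) := by ring
    rw [e1] at h1
    rw [e2] at h2
    linear_combination h0 + c.a n * h1 - h2
  rcases mul_eq_zero.1 e with h | h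
  · exact absurd h (by positivity)
  · linarith

theorem det (n : ℕ) : (c.q (n + 1) : ℤ) * c.p n - c.q n * c.p (n + 1) = (-1) ^ n := by
  induction n with
  | zero => simp [c.q_zero, c.q_one, c.p_zero]
  | succ n ih =>
    rw [c.q_add_two, c.p_add_two, pow_succ, ← ih]
    push_cast
    ring

theorem q_mul_d (n : ℕ) : (c.q (n + 1) : ℝ) * c.d n + c.q n * c.d (n + 1) = 1 := by
  have h0 := c.d_eq n
  have h1 := c.d_eq (n + 1)
  have hd : ((c.q (n + 1) : ℝ) * c.p n - c.q n * c.p (n + 1)) = (-1) ^ n := by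
    exact_mod_cast c.det n
  have e1 : ((-1:ℝ)) ^ (n + 1 + 1) = (-1) ^ n := by ring
  have e2 : ((-1:ℝ)) ^ (n + 1) = - (-1) ^ n := by ring
  rw [e1] at h1
  rw [e2] at h0
  have : ((-1 : ℝ)) ^ n * ((c.q (n + 1) : ℝ) * c.d n + c.q n * c.d (n + 1) - 1) = 0 := by
    linear_combination c.q (n + 1) * h0 - c.q n * h1 + hd
  rcases mul_eq_zero.1 this with h | h
  · exact absurd h (by positivity)
  · linarith

theorem q_succ_pos (n : ℕ) : 1 ≤ c.q (n + 1) := by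
  induction n with
  | zero => rw [c.q_one]
  | succ n ih =>
    rw [c.q_add_two]
    have := c.a_pos n
    nlinarith

theorem q_le_succ (n : ℕ) : c.q n ≤ c.q (n + 1) := by
  cases n with
  | zero => rw [c.q_zero]; omega
  | succ n =>
    rw [c.q_add_two]
    have := c.a_pos n
    nlinarith

theorem q_add_le (n : ℕ) : c.q n + c.q (n + 1) ≤ c.q (n + 2) := by
  rw [c.q_add_two]
  have := c.a_pos n
  nlinarith

theorem d_add_two_le_half (n : ℕ) : c.d (n + 2) ≤ c.d n / 2 := by
  have h := c.d_add_two n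
  have h1 := c.d_succ_lt (n + 1)
  have h2 : (1 : ℝ) ≤ c.a n := by exact_mod_cast c.a_pos n
  have := c.d_pos (n + 1)
  nlinarith

theorem q_succ_mul_d_le (n : ℕ) : (c.q (n + 1) : ℝ) * c.d n ≤ 1 := by
  have := c.q_mul_d n
  have h : 0 ≤ (c.q n : ℝ) * c.d (n + 1) := mul_nonneg (Nat.cast_nonneg _) (c.d_pos _).le
  linarith

theorem half_le_q_succ_mul_d (n : ℕ) : 1 ≤ 2 * ((c.q (n + 1) : ℝ) * c.d n) := by
  have := c.q_mul_d n
  have h1 : (c.q n : ℝ) ≤ c.q (n + 1) := by exact_mod_cast c.q_le_succ n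
  have h : (c.q n : ℝ) * c.d (n + 1) ≤ c.q (n + 1) * c.d n :=
    mul_le_mul h1 (c.d_succ_lt n).le (c.d_pos _).le (Nat.cast_nonneg _)
  linarith

theorem d_anti : Antitone c.d := antitone_nat_of_succ_le fun n => (c.d_succ_lt n).le

theorem d_le_one (n : ℕ) : c.d n ≤ 1 := by
  have h := c.d_anti (Nat.zero_le n)
  have h0 := c.d_eq 0
  simp [c.q_zero, c.p_zero] at h0
  linarith

theorem le_q (n : ℕ) : n ≤ 2 * c.q n := by
  induction n using Nat.strong_induction_on with
  | _ n ih =>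
    match n with
    | 0 => omega
    | 1 => rw [c.q_one]; omega
    | n + 2 =>
      have h1 := ih n (by omega)
      have h2 := c.q_add_le n
      have h3 := c.q_succ_pos n
      omega

theorem diophantine {C τ : ℝ} (hC : 0 < C) (hτ : 0 < τ)
    (hdio : ∀ q : ℤ, q ≠ 0 → ∀ p : ℤ, |(q : ℝ) * α - p| > C * (|(q : ℝ)|) ^ (-τ)) (n : ℕ) :
    C * c.d n ^ τ ≤ c.d (n + 1) := by
  have h0 := hdio (c.q (n + 1)) (by have := c.q_succ_pos n; omega) (c.p (n + 1))
  have hq : (0 : ℝ) < c.q (n + 1) := by exact_mod_cast c.q_succ_pos n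
  rw [Int.cast_natCast, c.d_eq, abs_mul, abs_pow, abs_neg, abs_one, one_pow, one_mul,
    abs_of_pos (c.d_pos _), abs_of_pos hq] at h0
  refine le_trans ?_ h0.le
  refine mul_le_mul_of_nonneg_left ?_ hC.le
  rw [Real.rpow_neg hq.le, ← Real.inv_rpow hq.le]
  refine Real.rpow_le_rpow (c.d_pos n).le ?_ hτ.le
  rw [inv_eq_one_div, le_div_iff₀ hq, mul_comm]
  exact c.q_succ_mul_d_le n

end Convergents

theorem irrational_of_diophantine {α C τ : ℝ} (hC : 0 < C)
    (hdio : ∀ q : ℤ, q ≠ 0 → ∀ p : ℤ, |(q : ℝ) * α - p| > C * (|(q : ℝ)|) ^ (-τ)) :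
    Irrational α := by
  rintro ⟨r, rfl⟩
  have h := hdio r.den (by exact_mod_cast r.den_ne_zero) r.num
  have e : (((r.den : ℤ) : ℝ)) * (r : ℝ) - (r.num : ℝ) = 0 := by
    have := Rat.den_mul_eq_num r
    have h2 : ((r.den : ℝ)) * (r : ℝ) = (r.num : ℝ) := by exact_mod_cast this
    push_cast
    rw [h2, sub_self]
  rw [e, abs_zero] at h
  have : 0 < C * |(((r.den : ℤ) : ℝ))| ^ (-τ) := by
    have : (0 : ℝ) < |(((r.den : ℤ) : ℝ))| := abs_pos.2 (by exact_mod_cast r.den_ne_zero)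
    positivity
  linarith

/-- A lift of a `C^k` circle diffeomorphism with translation number `α`, together with the
convergents of `α`. -/
structure SmoothLift (k : ℕ) (α : ℝ) where
  f : ℝ → ℝ
  two_le : 2 ≤ k
  contDiff : ContDiff ℝ k f
  map_add_one : ∀ x, f (x + 1) = f x + 1
  deriv_pos : ∀ x, 0 < deriv f x
  tendsto : ∀ x, Filter.Tendsto (fun n : ℕ => (f^[n] x - x) / n) Filter.atTop (nhds α)
  irr : Irrational α
  c : Convergents α

namespace SmoothLift

variable {k : ℕ} {α : ℝ} (S : SmoothLift k α)

theorem differentiable : Differentiable ℝ S.f :=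
  S.contDiff.differentiable (by have := S.two_le; simp; omega)

theorem strictMono : StrictMono S.f := strictMono_of_deriv_pos S.deriv_pos

theorem continuous : Continuous S.f := S.contDiff.continuous

theorem strictMono_iterate (l : ℕ) : StrictMono S.f^[l] := S.strictMono.iterate l

theorem continuous_iterate (l : ℕ) : Continuous S.f^[l] := S.continuous.iterate l

/-- The associated element of the monoid of degree one maps. -/
noncomputable def toLift : CircleDeg1Lift := ⟨⟨S.f, S.strictMono.monotone⟩, S.map_add_one⟩

theorem coe_toLift : ⇑S.toLift = S.f := rfl

theorem coe_toLift_pow (l : ℕ) : ⇑(S.toLift ^ l) = S.f^[l] := by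
  rw [CircleDeg1Lift.coe_pow, coe_toLift]

theorem iterate_add_int (l : ℕ) (x : ℝ) (p : ℤ) : S.f^[l] (x + p) = S.f^[l] x + p := by
  rw [← coe_toLift_pow]; exact CircleDeg1Lift.map_add_int _ _ _

theorem translationNumber_pow (l : ℕ) :
    CircleDeg1Lift.translationNumber (S.toLift ^ l) = l * α := by
  rw [CircleDeg1Lift.translationNumber_pow]
  congr 1
  refine tendsto_nhds_unique (S.toLift.tendsto_translationNumber 0) ?_
  simpa [coe_toLift_pow] using S.tendsto 0

theorem add_lt_iterate {l : ℕ} {P : ℤ} (h : (P : ℝ) < l * α) (x : ℝ) : x + P < S.f^[l] x := by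
  by_contra! hx
  rw [← coe_toLift_pow] at hx
  have := CircleDeg1Lift.translationNumber_le_of_le_add_int _ hx
  rw [translationNumber_pow] at this
  linarith

theorem iterate_lt_add {l : ℕ} {P : ℤ} (h : l * α < (P : ℝ)) (x : ℝ) : S.f^[l] x < x + P := by
  by_contra! hx
  rw [← coe_toLift_pow] at hx
  have := CircleDeg1Lift.le_translationNumber_of_add_int_le _ hx
  rw [translationNumber_pow] at this
  linarith

/-- The order of the orbit points is that of the orbit of the rotation. -/
theorem orbit_lt_orbit {l l' : ℕ} {p p' : ℤ} (h : (l : ℝ) * α + p < l' * α + p') (x : ℝ) :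
    S.f^[l] x + p < S.f^[l'] x + p' := by
  rcases le_total l l' with hl | hl
  · obtain ⟨j, rfl⟩ := Nat.exists_eq_add_of_le hl
    have := S.add_lt_iterate (l := j) (P := p - p') (by push_cast at h ⊢; linarith) (S.f^[l] x)
    rw [← Function.iterate_add_apply, add_comm j l] at this
    push_cast at this
    linarith
  · obtain ⟨j, rfl⟩ := Nat.exists_eq_add_of_le hl
    have := S.iterate_lt_add (l := j) (P := p' - p) (by push_cast at h ⊢; linarith) (S.f^[l'] x)
    rw [← Function.iterate_add_apply, add_comm j l'] at this
    push_cast at this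
    linarith

theorem orbit_le_orbit {l l' : ℕ} {p p' : ℤ} (h : (l : ℝ) * α + p ≤ l' * α + p') (x : ℝ) :
    S.f^[l] x + p ≤ S.f^[l'] x + p' := by
  rcases h.lt_or_eq with h | h
  · exact (S.orbit_lt_orbit h x).le
  · have hl : l = l' := by
      by_contra hl
      refine S.irr ⟨((p' - p : ℤ) : ℚ) / ((l - l' : ℤ) : ℚ), ?_⟩
      have : (((l - l' : ℤ) : ℚ) : ℝ) ≠ 0 := by
        exact_mod_cast sub_ne_zero.2 (by exact_mod_cast hl : (l : ℤ) ≠ l')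
      rw [Rat.cast_div, div_eq_iff this]
      push_cast
      linarith
    subst hl
    linarith

/-- The logarithm of the derivative of `f`. -/
noncomputable def φ (x : ℝ) : ℝ := Real.log (deriv S.f x)

/-- The logarithm of the derivative of the `l`-th iterate. -/
noncomputable def u (l : ℕ) (x : ℝ) : ℝ := ∑ i ∈ range l, S.φ (S.f^[i] x)

/-- The sum of the derivatives of the first `l` iterates. -/
noncomputable def L (l : ℕ) (x : ℝ) : ℝ := ∑ i ∈ range l, Real.exp (S.u i x)

/-- The closest return maps. -/
noncomputable def F (n : ℕ) (x : ℝ) : ℝ := S.f^[S.c.q n] x - S.c.p n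

/-- The displacement of the closest return maps. -/
noncomputable def m (n : ℕ) (x : ℝ) : ℝ := |S.F n x - x|

/-- The logarithm of the derivative of the closest return maps. -/
noncomputable def ψ (n : ℕ) : ℝ → ℝ := S.u (S.c.q n)

theorem exp_φ (x : ℝ) : Real.exp (S.φ x) = deriv S.f x := Real.exp_log (S.deriv_pos x)

theorem contDiff_deriv : ContDiff ℝ (k - 1 : ℕ) (deriv S.f) := by
  have h : ((k - 1 : ℕ) : WithTop ℕ∞) + 1 = k := by
    have := S.two_le
    exact_mod_cast (by omega : k - 1 + 1 = k)
  have := S.contDiff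
  rw [← h, contDiff_succ_iff_deriv] at this
  exact this.2.2

theorem contDiff_φ : ContDiff ℝ (k - 1 : ℕ) S.φ :=
  S.contDiff_deriv.log fun x => (S.deriv_pos x).ne'

theorem deriv_add_int (x : ℝ) (p : ℤ) : deriv S.f (x + p) = deriv S.f x := by
  have h : (fun y => S.f (y + p)) = fun y => S.f y + p :=
    funext fun y => S.iterate_add_int 1 y p
  rw [← deriv_comp_add_const, h, deriv_add_const]

theorem φ_add_int (x : ℝ) (p : ℤ) : S.φ (x + p) = S.φ x := by
  rw [φ, φ, deriv_add_int]

theorem u_add_int (l : ℕ) (x : ℝ) (p : ℤ) : S.u l (x + p) = S.u l x := by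
  simp only [u, iterate_add_int, φ_add_int]

theorem u_zero (x : ℝ) : S.u 0 x = 0 := by simp [u]

theorem u_zero' : S.u 0 = fun _ => 0 := funext S.u_zero

theorem u_succ (l : ℕ) (x : ℝ) : S.u (l + 1) x = S.u l x + S.φ (S.f^[l] x) := sum_range_succ _ _

theorem u_add (l j : ℕ) (x : ℝ) : S.u (l + j) x = S.u l x + S.u j (S.f^[l] x) := by
  simp only [u, sum_range_add, ← Function.iterate_add_apply, add_comm]

theorem L_add (l j : ℕ) (x : ℝ) :
    S.L (l + j) x = S.L l x + Real.exp (S.u l x) * S.L j (S.f^[l] x) := by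
  simp only [L, sum_range_add, mul_sum, ← Real.exp_add, ← u_add]

theorem L_nonneg (l : ℕ) (x : ℝ) : 0 ≤ S.L l x := sum_nonneg fun _ _ => (Real.exp_pos _).le

theorem contDiff_iterate (l : ℕ) : ContDiff ℝ k S.f^[l] := by
  induction l with
  | zero => exact contDiff_id
  | succ l ih => rw [Function.iterate_succ']; exact S.contDiff.comp ih

theorem contDiff_u (l : ℕ) : ContDiff ℝ (k - 1 : ℕ) (S.u l) := by
  unfold u
  refine ContDiff.sum fun i _ => S.contDiff_φ.comp ((S.contDiff_iterate i).of_le ?_)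
  exact_mod_cast Nat.sub_le k 1

theorem contDiff_ψ (n : ℕ) : ContDiff ℝ (k - 1 : ℕ) (S.ψ n) := S.contDiff_u _

theorem hasDerivAt_iterate (l : ℕ) (x : ℝ) : HasDerivAt S.f^[l] (Real.exp (S.u l x)) x := by
  induction l with
  | zero => simpa [u_zero] using hasDerivAt_id x
  | succ l ih =>
    rw [Function.iterate_succ', u_succ, Real.exp_add, mul_comm, exp_φ]
    exact (S.differentiable _).hasDerivAt.comp x ih

theorem hasDerivAt_F (n : ℕ) (x : ℝ) : HasDerivAt (S.F n) (Real.exp (S.ψ n x)) x :=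
  (S.hasDerivAt_iterate _ x).sub_const _

theorem continuous_F (n : ℕ) : Continuous (S.F n) := (S.continuous_iterate _).sub continuous_const

theorem continuous_m (n : ℕ) : Continuous (S.m n) := ((S.continuous_F n).sub continuous_id).abs

theorem strictMono_F (n : ℕ) : StrictMono (S.F n) := fun _ _ h =>
  sub_lt_sub_right (S.strictMono_iterate _ h) _

theorem F_add_int (n : ℕ) (x : ℝ) (p : ℤ) : S.F n (x + p) = S.F n x + p := by
  rw [F, F, iterate_add_int]; ring

theorem m_add_int (n : ℕ) (x : ℝ) (p : ℤ) : S.m n (x + p) = S.m n x := by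
  rw [m, m, F_add_int]; congr 1; ring

theorem iterate_F (l n : ℕ) (x : ℝ) : S.f^[l] (S.F n x) = S.F n (S.f^[l] x) := by
  have := S.iterate_add_int l (S.f^[S.c.q n] x) (- S.c.p n)
  push_cast at this
  rw [F, F, sub_eq_add_neg, this, ← Function.iterate_add_apply, ← Function.iterate_add_apply,
    add_comm l, sub_eq_add_neg]

theorem F_F (l n : ℕ) (x : ℝ) :
    S.F l (S.F n x) = S.f^[S.c.q l + S.c.q n] x + ((- (S.c.p l + S.c.p n) : ℤ) : ℝ) := by
  have := S.iterate_add_int (S.c.q l) (S.f^[S.c.q n] x) (- S.c.p n)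
  push_cast at this ⊢
  rw [F, F, sub_eq_add_neg (S.f^[S.c.q n] x), this, ← Function.iterate_add_apply]
  ring

theorem F_comm (l n : ℕ) (x : ℝ) : S.F l (S.F n x) = S.F n (S.F l x) := by
  rw [F_F, F_F, add_comm (S.c.q l), add_comm (S.c.p l)]

/-- The sign of the displacement of `F n`. -/
def sgn (n : ℕ) : ℝ := (-1) ^ (n + 1)

theorem sgn_succ (n : ℕ) : sgn (n + 1) = - sgn n := by unfold sgn; ring

theorem sgn_mul_self (n : ℕ) : sgn n * sgn n = 1 := by
  unfold sgn; rw [← mul_pow]; simp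

theorem sgn_eq (n : ℕ) : sgn n = 1 ∨ sgn n = -1 := neg_one_pow_eq_or ℝ (n + 1)

theorem abs_sgn (n : ℕ) : |sgn n| = 1 := by
  rcases sgn_eq n with h | h <;> simp [h]

theorem sgn_mul_orbit_pos {n l l' : ℕ} {p p' : ℤ}
    (h : 0 < sgn n * ((l' * α + p') - (l * α + p))) (x : ℝ) :
    0 < sgn n * ((S.f^[l'] x + p') - (S.f^[l] x + p)) := by
  rcases sgn_eq n with hs | hs <;> rw [hs] at h ⊢
  · have := S.orbit_lt_orbit (l := l) (l' := l') (p := p) (p' := p') (by linarith) x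
    linarith
  · have := S.orbit_lt_orbit (l := l') (l' := l) (p := p') (p' := p) (by linarith) x
    linarith

theorem sgn_mul_orbit_nonneg {n l l' : ℕ} {p p' : ℤ}
    (h : 0 ≤ sgn n * ((l' * α + p') - (l * α + p))) (x : ℝ) :
    0 ≤ sgn n * ((S.f^[l'] x + p') - (S.f^[l] x + p)) := by
  rcases sgn_eq n with hs | hs <;> rw [hs] at h ⊢
  · have := S.orbit_le_orbit (l := l) (l' := l') (p := p) (p' := p') (by linarith) x
    linarith
  · have := S.orbit_le_orbit (l := l') (l' := l) (p := p') (p' := p) (by linarith) x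
    linarith

theorem sgn_mul_d (n : ℕ) : sgn n * ((S.c.q n : ℝ) * α - S.c.p n) = S.c.d n := by
  rw [S.c.d_eq, ← sgn, ← mul_assoc, sgn_mul_self, one_mul]

theorem sgn_mul_F_sub_pos (n : ℕ) (x : ℝ) : 0 < sgn n * (S.F n x - x) := by
  have := S.sgn_mul_orbit_pos (n := n) (l := 0) (l' := S.c.q n) (p := 0) (p' := - S.c.p n) (by
    have := S.sgn_mul_d n
    have h := S.c.d_pos n
    push_cast
    linarith) x
  simpa [F, sub_eq_add_neg] using this

theorem m_eq (n : ℕ) (x : ℝ) : S.m n x = sgn n * (S.F n x - x) := by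
  rw [m, ← abs_of_pos (S.sgn_mul_F_sub_pos n x), abs_mul, abs_sgn, one_mul]

theorem F_sub (n : ℕ) (x : ℝ) : S.F n x - x = sgn n * S.m n x := by
  rw [m_eq, ← mul_assoc, sgn_mul_self, one_mul]

theorem m_pos (n : ℕ) (x : ℝ) : 0 < S.m n x := by
  rw [m_eq]; exact S.sgn_mul_F_sub_pos n x

theorem sgn_mul_F_F_sub_pos (n : ℕ) (x : ℝ) : 0 < sgn n * (S.F n (S.F (n + 1) x) - x) := by
  have := S.sgn_mul_orbit_pos (n := n) (l := 0) (l' := S.c.q n + S.c.q (n + 1)) (p := 0)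
    (p' := - (S.c.p n + S.c.p (n + 1))) (by
    have h1 := S.sgn_mul_d n
    have h2 := S.sgn_mul_d (n + 1)
    have h := S.c.d_succ_lt n
    rw [sgn_succ] at h2
    push_cast
    linarith) x
  rw [F_F]
  simpa using this

theorem sum_range_shift_sub (a : ℕ → ℝ) (q T : ℕ) :
    ∑ t ∈ range T, (a (t + q) - a t) = ∑ i ∈ range q, (a (i + T) - a i) := by
  induction T with
  | zero => simp
  | succ T ih =>
    have h := sum_range_sub (fun i => a (i + T)) q
    have h2 : ∑ i ∈ range q, (a (i + (T + 1)) - a i) = ∑ i ∈ range q, (a (i + T) - a i) +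
      ∑ i ∈ range q, (a (i + 1 + T) - a (i + T)) := by
      rw [← sum_add_distrib]
      refine sum_congr rfl fun i _ => ?_
      rw [show i + (T + 1) = i + 1 + T by ring]
      ring
    rw [sum_range_succ, ih, h2, h, zero_add, add_comm T q]

theorem sum_F_sub (n T : ℕ) (x : ℝ) : ∑ t ∈ range T, (S.F n (S.f^[t] x) - S.f^[t] x) =
    ∑ i ∈ range (S.c.q n), (S.f^[T] (S.f^[i] x) - S.f^[i] x) - T * S.c.p n := by
  have h := sum_range_shift_sub (fun i => S.f^[i] x) (S.c.q n) T
  simp only [← Function.iterate_add_apply, F, add_comm (S.c.q n), add_comm T] at h ⊢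
  rw [← h]
  simp only [sum_sub_distrib]
  simp
  ring

theorem sum_m_eq (n T : ℕ) (x : ℝ) : ∑ t ∈ range T, S.m n (S.f^[t] x) =
    sgn n * (∑ i ∈ range (S.c.q n), (S.f^[T] (S.f^[i] x) - S.f^[i] x) - T * S.c.p n) := by
  rw [← sum_F_sub, mul_sum]
  exact sum_congr rfl fun t _ => S.m_eq n _

theorem sum_m_add_sum_m (n : ℕ) (x : ℝ) : ∑ l ∈ range (S.c.q (n + 1)), S.m n (S.f^[l] x) +
    ∑ j ∈ range (S.c.q n), S.m (n + 1) (S.f^[j] x) = 1 := by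
  have h2 : ∑ j ∈ range (S.c.q n), S.m (n + 1) (S.f^[j] x) =
      sgn (n + 1) * (∑ j ∈ range (S.c.q n), (S.f^[S.c.q (n + 1)] (S.f^[j] x) - S.f^[j] x)
        - S.c.q n * S.c.p (n + 1)) := by
    simp only [m_eq, F, ← mul_sum, sum_sub_distrib]
    simp
    left
    ring
  have hd : ((S.c.q (n + 1) : ℝ) * S.c.p n - S.c.q n * S.c.p (n + 1)) = (-1) ^ n := by
    exact_mod_cast S.c.det n
  have hs : sgn n = - (-1) ^ n := by unfold sgn; ring
  rw [sum_m_eq, h2, sgn_succ]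
  have := sgn_mul_self n
  linear_combination (-sgn n) * hd + this - sgn n * hs

theorem tendsto_average (n : ℕ) (x : ℝ) :
    Filter.Tendsto (fun T : ℕ => (∑ t ∈ range T, S.m n (S.f^[t] x)) / T) Filter.atTop
      (nhds (S.c.d n)) := by
  have h : Filter.Tendsto (fun T : ℕ => sgn n *
      (∑ i ∈ range (S.c.q n), (S.f^[T] (S.f^[i] x) - S.f^[i] x) / T - S.c.p n)) Filter.atTop
      (nhds (sgn n * (∑ i ∈ range (S.c.q n), α - S.c.p n))) :=
    ((tendsto_finsetSum _ fun i _ => S.tendsto (S.f^[i] x)).sub_const _).const_mul _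
  rw [sum_const, card_range, nsmul_eq_mul, sgn_mul_d] at h
  refine h.congr' ?_
  filter_upwards [Filter.eventually_gt_atTop 0] with T hT
  rw [sum_m_eq]
  have : (T : ℝ) ≠ 0 := by exact_mod_cast hT.ne'
  rw [← sum_div]
  field_simp

end SmoothLift

theorem exists_int_add_mem_Icc (x : ℝ) : ∃ p : ℤ, x + p ∈ Set.Icc (0 : ℝ) 1 :=
  ⟨-⌊x⌋, by push_cast; constructor <;> linarith [Int.floor_le x, Int.lt_floor_add_one x]⟩

theorem exists_forall_le_of_periodic {g : ℝ → ℝ} (hg : Continuous g)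
    (hp : ∀ (x : ℝ) (p : ℤ), g (x + p) = g x) : ∃ x, ∀ y, g y ≤ g x := by
  obtain ⟨x, -, hx⟩ := (isCompact_Icc (a := (0:ℝ)) (b := 1)).exists_isMaxOn ⟨0, by simp⟩
    hg.continuousOn
  refine ⟨x, fun y => ?_⟩
  obtain ⟨p, h⟩ := exists_int_add_mem_Icc y
  rw [← hp y p]
  exact hx h

theorem exists_abs_le_of_periodic {g : ℝ → ℝ} (hg : Continuous g)
    (hp : ∀ (x : ℝ) (p : ℤ), g (x + p) = g x) : ∃ B, 0 ≤ B ∧ ∀ y, |g y| ≤ B := by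
  obtain ⟨x, hx⟩ := exists_forall_le_of_periodic hg.abs (fun x p => by rw [hp])
  exact ⟨_, abs_nonneg _, hx⟩

/-- A continuous periodic function whose average along an orbit tends to `0` is `≤ 0` somewhere. -/
theorem exists_nonpos_of_average {g : ℝ → ℝ} (hg : Continuous g)
    (hp : ∀ (x : ℝ) (p : ℤ), g (x + p) = g x) {a : ℕ → ℝ}
    (h : Filter.Tendsto (fun T : ℕ => (∑ t ∈ range T, g (a t)) / T) Filter.atTop (nhds 0)) :
    ∃ x, g x ≤ 0 := by
  obtain ⟨x, hx⟩ := exists_forall_le_of_periodic (g := fun x => - g x) hg.neg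
    (fun x p => by rw [hp])
  refine ⟨x, ge_of_tendsto h ?_⟩
  filter_upwards [Filter.eventually_gt_atTop 0] with T hT
  have : (0 : ℝ) < T := by exact_mod_cast hT
  rw [le_div_iff₀ this]
  calc g x * T = ∑ t ∈ range T, g x := by simp [mul_comm]
    _ ≤ _ := sum_le_sum fun t _ => by have := hx (a t); linarith

theorem iteratedDeriv_periodic {g : ℝ → ℝ} (hp : ∀ (x : ℝ) (p : ℤ), g (x + p) = g x) (r : ℕ)
    (x : ℝ) (p : ℤ) : iteratedDeriv r g (x + p) = iteratedDeriv r g x := by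
  have := congrFun (iteratedDeriv_comp_add_const r g (p : ℝ)) x
  rw [← this]
  congr 2
  exact funext fun y => hp y p

namespace SmoothLift

variable {k : ℕ} {α : ℝ} (S : SmoothLift k α)

theorem exists_m_succ_le (n : ℕ) : ∃ x, S.m (n + 1) x * S.c.d n ≤ S.c.d (n + 1) * S.m n x := by
  obtain ⟨x, hx⟩ := exists_nonpos_of_average
    (g := fun x => S.m (n + 1) x * S.c.d n - S.c.d (n + 1) * S.m n x) (a := fun t => S.f^[t] 0)
    (((S.continuous_m _).mul_const _).sub ((S.continuous_m _).const_mul _))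
    (fun x p => by simp only [m_add_int]) (by
      have := ((S.tendsto_average (n + 1) 0).mul_const (S.c.d n)).sub
        ((S.tendsto_average n 0).const_mul (S.c.d (n + 1)))
      rw [sub_self] at this
      refine this.congr fun T => ?_
      rw [sum_sub_distrib, ← sum_mul, ← mul_sum]
      ring)
  exact ⟨x, by linarith⟩

theorem exists_d_le_m (n : ℕ) : ∃ x, S.c.d n ≤ S.m n x := by
  obtain ⟨x, hx⟩ := exists_nonpos_of_average
    (g := fun x => S.c.d n - S.m n x) (a := fun t => S.f^[t] 0)
    (continuous_const.sub (S.continuous_m _))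
    (fun x p => by simp only [m_add_int]) (by
      have := (S.tendsto_average n 0).const_sub (S.c.d n)
      rw [sub_self] at this
      refine this.congr' ?_
      filter_upwards [Filter.eventually_gt_atTop 0] with T hT
      have : (T : ℝ) ≠ 0 := by exact_mod_cast hT.ne'
      rw [sum_sub_distrib, sum_const, card_range, nsmul_eq_mul]
      field_simp)
  exact ⟨x, by linarith⟩

/-- The interval between `x` and its closest return. -/
def J (n : ℕ) (x : ℝ) : Set ℝ := Set.uIcc x (S.F n x)

theorem F_mem_J (n : ℕ) (x : ℝ) : S.F n x ∈ S.J n x := Set.right_mem_uIcc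

theorem abs_sub_le_m {n : ℕ} {x y : ℝ} (h : y ∈ S.J n x) : |y - x| ≤ S.m n x :=
  Set.abs_sub_left_of_mem_uIcc h

theorem iterate_mem_J {n : ℕ} {x y : ℝ} (h : y ∈ S.J n x) (l : ℕ) :
    S.f^[l] y ∈ S.J n (S.f^[l] x) := by
  have := (S.strictMono_iterate l).monotone.mapsTo_uIcc h
  rwa [iterate_F] at this

theorem F_mem_J_of_mem {n : ℕ} {x y : ℝ} (h : y ∈ S.J n x) (l : ℕ) :
    S.F l y ∈ S.J n (S.F l x) := by
  have := (S.strictMono_F l).monotone.mapsTo_uIcc h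
  rwa [F_comm] at this

theorem exists_abs_deriv_φ_le (hk : 2 < k) :
    ∃ V, 0 ≤ V ∧ ∀ x y, |S.φ y - S.φ x| ≤ V * |y - x| := by
  have hd : ∀ x, HasDerivAt S.φ (deriv S.φ x) x := fun x =>
    (S.contDiff_φ.differentiable (by simp; omega) x).hasDerivAt
  obtain ⟨V, hV, h⟩ := exists_abs_le_of_periodic (g := iteratedDeriv 1 S.φ)
    (S.contDiff_φ.continuous_iteratedDeriv 1 (by exact_mod_cast (by omega)))
    (iteratedDeriv_periodic S.φ_add_int 1)
  refine ⟨V, hV, fun x y => abs_sub_le_of_abs_deriv_le hd x y fun z _ => ?_⟩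
  simpa using h z

theorem sum_m_le_one {n l : ℕ} (hl : l ≤ S.c.q (n + 1)) (x : ℝ) :
    ∑ i ∈ range l, S.m n (S.f^[i] x) ≤ 1 := by
  have h := S.sum_m_add_sum_m n x
  have h1 : 0 ≤ ∑ j ∈ range (S.c.q n), S.m (n + 1) (S.f^[j] x) :=
    sum_nonneg fun _ _ => (S.m_pos _ _).le
  have h2 : ∑ i ∈ range l, S.m n (S.f^[i] x) ≤
      ∑ i ∈ range (S.c.q (n + 1)), S.m n (S.f^[i] x) :=
    sum_le_sum_of_subset_of_nonneg (range_mono hl) fun _ _ _ => (S.m_pos _ _).le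
  linarith

theorem abs_u_sub_le {V : ℝ} (hV0 : 0 ≤ V) (hV : ∀ x y, |S.φ y - S.φ x| ≤ V * |y - x|) {n l : ℕ}
    (hl : l ≤ S.c.q (n + 1)) {x y : ℝ} (h : y ∈ S.J n x) : |S.u l y - S.u l x| ≤ V := by
  rw [u, u, ← sum_sub_distrib]
  calc _ ≤ ∑ i ∈ range l, |S.φ (S.f^[i] y) - S.φ (S.f^[i] x)| := abs_sum_le_sum_abs _ _
    _ ≤ ∑ i ∈ range l, V * S.m n (S.f^[i] x) := sum_le_sum fun i _ => (hV _ _).trans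
        (mul_le_mul_of_nonneg_left (S.abs_sub_le_m (S.iterate_mem_J h i)) hV0)
    _ = V * ∑ i ∈ range l, S.m n (S.f^[i] x) := by rw [mul_sum]
    _ ≤ V * 1 := mul_le_mul_of_nonneg_left (S.sum_m_le_one hl x) hV0
    _ = V := mul_one V

theorem exists_m_iterate_eq (n l : ℕ) (x : ℝ) :
    ∃ ξ ∈ S.J n x, S.m n (S.f^[l] x) = Real.exp (S.u l ξ) * S.m n x := by
  obtain ⟨ξ, hξ, h⟩ := exists_mem_uIcc_deriv_eq (S.hasDerivAt_iterate l) x (S.F n x)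
  refine ⟨ξ, hξ, ?_⟩
  rw [m, ← iterate_F, h, abs_mul, abs_of_pos (Real.exp_pos _), m]

theorem exists_m_F_eq (n l : ℕ) (x : ℝ) :
    ∃ ξ ∈ S.J n x, S.m n (S.F l x) = Real.exp (S.ψ l ξ) * S.m n x := by
  obtain ⟨ξ, hξ, h⟩ := exists_mem_uIcc_deriv_eq (S.hasDerivAt_F l) x (S.F n x)
  refine ⟨ξ, hξ, ?_⟩
  rw [m, F_comm, h, abs_mul, abs_of_pos (Real.exp_pos _), m]

/-- The orbit segment of length `q n + q (n + 1)` of `J n x` covers the circle. -/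
theorem exists_mem_J_iterate_eq (n : ℕ) (x y : ℝ) : ∃ l < S.c.q n + S.c.q (n + 1), ∃ p : ℤ,
    ∃ x' ∈ S.J n x, y = S.f^[l] x' + p := by
  set N := S.c.q n + S.c.q (n + 1) with hN
  set s := sgn n with hs
  have hss : s * s = 1 := sgn_mul_self n
  have hNpos : 0 < N := by have := S.c.q_succ_pos n; omega
  obtain ⟨l, hl, hmin⟩ := (range N).exists_min_image (fun i => Int.fract (s * (y - S.f^[i] x)))
    ⟨0, by simpa using hNpos⟩
  rw [mem_range] at hl
  have hsZ : ∃ e : ℤ, s = e := ⟨(-1) ^ (n + 1), by simp [hs, sgn]⟩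
  obtain ⟨e, he⟩ := hsZ
  have hfl := Int.self_sub_floor (s * (y - S.f^[l] x))
  set b := ⌊s * (y - S.f^[l] x)⌋ with hb
  set r := Int.fract (s * (y - S.f^[l] x)) with hr
  have hr0 : 0 ≤ r := Int.fract_nonneg _
  set v := S.f^[l] x + ((e * b : ℤ) : ℝ) with hv
  have hyv : s * (y - v) = r := by
    rw [hv, ← hfl]; push_cast; rw [← he]; linear_combination (-(b : ℝ)) * hss
  have hclaim : ∀ (l' : ℕ) (p' : ℤ), l' < N → 0 < s * (S.f^[l'] x + p' - v) →
      s * (y - (S.f^[l'] x + p')) < 0 := by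
    intro l' p' hl' h
    by_contra! hc
    have h1 := hmin l' (mem_range.2 hl')
    have h2 : Int.fract (s * (y - S.f^[l'] x)) = s * (y - (S.f^[l'] x + p')) := by
      rw [Int.fract_eq_iff]
      refine ⟨hc, ?_, e * p', ?_⟩
      · have := Int.fract_lt_one (s * (y - S.f^[l] x))
        linarith
      · push_cast; rw [← he]; ring
    rw [h2] at h1
    linarith
  have hFv : S.F n v = S.f^[l] (S.F n x) + ((e * b : ℤ) : ℝ) := by
    rw [hv, F_add_int, iterate_F]
  have hmv := S.sgn_mul_F_sub_pos n v
  have key : s * (y - S.F n v) < 0 := by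
    rcases Nat.lt_or_ge l (S.c.q (n + 1)) with h | h
    · have e1 : S.F n v = S.f^[S.c.q n + l] x + ((e * b - S.c.p n : ℤ) : ℝ) := by
        rw [hv, F_add_int, F, ← Function.iterate_add_apply]; push_cast; ring
      have := hclaim (S.c.q n + l) (e * b - S.c.p n) (by omega) (by rw [← e1]; exact hmv)
      rwa [← e1] at this
    · obtain ⟨j, rfl⟩ := Nat.exists_eq_add_of_le h
      set z := S.f^[j] x + ((e * b + S.c.p (n + 1) : ℤ) : ℝ) with hz
      have e1 : S.F (n + 1) z = v := by
        rw [hz, F_add_int, F, ← Function.iterate_add_apply, hv]; push_cast; ring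
      have h1 := S.sgn_mul_F_sub_pos (n + 1) z
      rw [e1, sgn_succ] at h1
      have h2 := hclaim j (e * b + S.c.p (n + 1)) (by omega) (by linarith)
      have h3 := S.sgn_mul_F_F_sub_pos n z
      rw [e1] at h3
      rw [← hz] at h2
      linarith
  have hmem : y - ((e * b : ℤ) : ℝ) ∈ Set.uIcc (S.f^[l] x) (S.f^[l] (S.F n x)) := by
    rw [Set.mem_uIcc]
    have e1 : s * (y - v) = s * (y - ((e * b : ℤ) : ℝ) - S.f^[l] x) := by rw [hv]; ring
    rw [hFv] at key
    rcases sgn_eq n with h | h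
    · rw [← hs] at h
      rw [h] at e1 key hyv
      left; constructor <;> linarith
    · rw [← hs] at h
      rw [h] at e1 key hyv
      right; constructor <;> linarith
  obtain ⟨x', hx', e'⟩ := intermediate_value_uIcc (S.continuous_iterate l).continuousOn hmem
  exact ⟨l, hl, e * b, x', hx', by rw [e']; ring⟩

theorem ψ_zero (x : ℝ) : S.ψ 0 x = 0 := by rw [ψ, S.c.q_zero, u_zero]

theorem ψ_add_int (n : ℕ) (x : ℝ) (p : ℤ) : S.ψ n (x + p) = S.ψ n x := S.u_add_int _ _ _

theorem exists_ψ_eq_zero (n : ℕ) : ∃ x, S.ψ n x = 0 := by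
  obtain ⟨ξ, -, h⟩ := exists_mem_uIcc_deriv_eq (S.hasDerivAt_F n) 0 1
  refine ⟨ξ, ?_⟩
  have := S.F_add_int n 0 1
  push_cast at this
  rw [zero_add] at this
  rw [this] at h
  rw [← Real.exp_eq_one_iff]
  linarith

theorem ψ_iterate (n l : ℕ) (x : ℝ) :
    S.ψ n (S.f^[l] x) = S.ψ n x + (S.u l (S.F n x) - S.u l x) := by
  have h1 := S.u_add l (S.c.q n) x
  have h2 := S.u_add (S.c.q n) l x
  have h3 := S.u_add_int l (S.f^[S.c.q n] x) (- S.c.p n)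
  push_cast at h3
  rw [add_comm l] at h1
  rw [ψ, F, sub_eq_add_neg (S.f^[S.c.q n] x), h3]
  linarith

theorem abs_ψ_le {V : ℝ} (hV0 : 0 ≤ V) (hV : ∀ x y, |S.φ y - S.φ x| ≤ V * |y - x|) (n : ℕ)
    (y : ℝ) : |S.ψ n y| ≤ 3 * V := by
  cases n with
  | zero => rw [ψ_zero, abs_zero]; positivity
  | succ n =>
    obtain ⟨x, hx⟩ := S.exists_ψ_eq_zero (n + 1)
    obtain ⟨l, hl, p, x', hx', rfl⟩ := S.exists_mem_J_iterate_eq n x y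
    rw [ψ_add_int, ψ_iterate]
    have h1 := S.abs_u_sub_le hV0 hV le_rfl hx'
    rw [ψ] at hx ⊢
    rw [hx, sub_zero] at h1
    have h2 := S.abs_u_sub_le hV0 hV (l := l) (n := n + 1) (hl.le.trans (S.c.q_add_le n))
      (S.F_mem_J (n + 1) x')
    have h3 := abs_add_le (S.u (S.c.q (n + 1)) x') (S.u l (S.F (n + 1) x') - S.u l x')
    linarith

theorem m_succ_F_le (n : ℕ) (x : ℝ) : S.m (n + 1) (S.F n x) ≤ S.m n x := by
  have h := S.sgn_mul_F_F_sub_pos n x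
  rw [m_eq, m_eq, sgn_succ, S.F_comm (n + 1)]
  linarith

theorem m_add_two_le (n : ℕ) (x : ℝ) : S.m (n + 2) x + S.m (n + 1) (S.F n x) ≤ S.m n x := by
  have h : 0 ≤ sgn n * (S.F n (S.F (n + 1) x) - S.F (n + 2) x) := by
    rw [F_F]
    have := S.sgn_mul_orbit_nonneg (n := n) (l := S.c.q (n + 2)) (p := -S.c.p (n + 2))
      (l' := S.c.q n + S.c.q (n + 1)) (p' := - (S.c.p n + S.c.p (n + 1))) (by
      have h1 := S.sgn_mul_d n
      have h2 := S.sgn_mul_d (n + 1)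
      have h3 := S.sgn_mul_d (n + 2)
      have h4 := S.c.d_add_two n
      have h5 : (1 : ℝ) ≤ S.c.a n := by exact_mod_cast S.c.a_pos n
      have h6 := S.c.d_pos (n + 1)
      rw [sgn_succ] at h2
      rw [sgn_succ, sgn_succ] at h3
      push_cast
      nlinarith) x
    simpa [F, sub_eq_add_neg] using this
  rw [m_eq, m_eq, m_eq, sgn_succ, sgn_succ, S.F_comm (n + 1)]
  linarith

theorem exists_m_add_two_le (hk : 2 < k) :
    ∃ ρ : ℝ, 0 < ρ ∧ ρ < 1 ∧ ∀ n x, S.m (n + 2) x ≤ ρ * S.m n x := by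
  obtain ⟨V, hV0, hV⟩ := S.exists_abs_deriv_φ_le hk
  have hlow : ∀ n l x, Real.exp (-(3 * V)) * S.m n x ≤ S.m n (S.F l x) := by
    intro n l x
    obtain ⟨ξ, -, e⟩ := S.exists_m_F_eq n l x
    rw [e]
    refine mul_le_mul_of_nonneg_right (Real.exp_le_exp.2 ?_) (S.m_pos _ _).le
    have := abs_le.1 (S.abs_ψ_le hV0 hV l ξ)
    linarith
  set e := Real.exp (-(3 * V)) with he
  have he0 : 0 < e := Real.exp_pos _
  refine ⟨1 / (1 + e * e), by positivity, ?_, fun n x => ?_⟩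
  · rw [div_lt_one (by positivity)]; nlinarith
  · rw [one_div, inv_mul_eq_div, le_div_iff₀ (by positivity)]
    have h1 := S.m_add_two_le n x
    have h2 := hlow (n + 1) n x
    have h3 := hlow (n + 2) (n + 1) x
    have h4 := S.m_succ_F_le (n + 1) x
    have h5 : e * (e * S.m (n + 2) x) ≤ e * S.m (n + 1) x :=
      mul_le_mul_of_nonneg_left (h3.trans h4) he0.le
    linarith

theorem exists_forall_m_lt (hk : 2 < k) {ε : ℝ} (hε : 0 < ε) :
    ∃ N, ∀ n ≥ N, ∀ x, S.m n x < ε := by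
  obtain ⟨ρ, hρ0, hρ1, h⟩ := S.exists_m_add_two_le hk
  obtain ⟨B0, hB0, h0⟩ := exists_abs_le_of_periodic (S.continuous_m 0) (S.m_add_int 0)
  obtain ⟨B1, hB1, h1⟩ := exists_abs_le_of_periodic (S.continuous_m 1) (S.m_add_int 1)
  have key : ∀ j x, S.m (2 * j) x ≤ ρ ^ j * (B0 + B1) ∧
      S.m (2 * j + 1) x ≤ ρ ^ j * (B0 + B1) := by
    intro j x
    induction j with
    | zero =>
      have e0 := (le_abs_self _).trans (h0 x)
      have e1 := (le_abs_self _).trans (h1 x)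
      simp only [Nat.mul_zero, pow_zero, one_mul, zero_add]
      constructor <;> linarith
    | succ j ih =>
      have e0 := h (2 * j) x
      have e1 := h (2 * j + 1) x
      rw [pow_succ', mul_assoc]
      exact ⟨e0.trans (mul_le_mul_of_nonneg_left ih.1 hρ0.le),
        e1.trans (mul_le_mul_of_nonneg_left ih.2 hρ0.le)⟩
  have ht : Filter.Tendsto (fun j : ℕ => ρ ^ j * (B0 + B1)) Filter.atTop (nhds 0) := by
    simpa using (tendsto_pow_atTop_nhds_zero_of_lt_one hρ0.le hρ1).mul_const (B0 + B1)
  obtain ⟨N, hN⟩ := Filter.eventually_atTop.1 (ht.eventually_lt_const hε)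
  refine ⟨2 * N, fun n hn x => ?_⟩
  rcases Nat.even_or_odd' n with ⟨j, rfl | rfl⟩
  · exact ((key j x).1).trans_lt (hN j (by omega))
  · exact ((key j x).2).trans_lt (hN j (by omega))

end SmoothLift

namespace SmoothLift

variable {k : ℕ} {α : ℝ} (S : SmoothLift k α)

theorem sum_m_le {N : ℕ} {n l : ℕ} (hl : l ≤ N * S.c.q (n + 1)) (x : ℝ) :
    ∑ i ∈ range l, S.m n (S.f^[i] x) ≤ N := by
  refine (sum_le_sum_of_subset_of_nonneg (range_mono hl) fun _ _ _ => (S.m_pos _ _).le).trans ?_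
  clear hl
  induction N with
  | zero => simp
  | succ N ih =>
    rw [add_mul, one_mul, sum_range_add]
    have := S.sum_m_le_one (n := n) le_rfl (S.f^[N * S.c.q (n + 1)] x)
    simp only [← Function.iterate_add_apply] at this
    push_cast
    refine add_le_add ih (le_trans (le_of_eq (sum_congr rfl fun i _ => ?_)) this)
    rw [add_comm]

theorem abs_u_sub_le_mul {V : ℝ} (hV0 : 0 ≤ V) (hV : ∀ x y, |S.φ y - S.φ x| ≤ V * |y - x|)
    {N n l : ℕ} (hl : l ≤ N * S.c.q (n + 1)) {x y : ℝ} (h : y ∈ S.J n x) :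
    |S.u l y - S.u l x| ≤ N * V := by
  rw [u, u, ← sum_sub_distrib]
  calc _ ≤ ∑ i ∈ range l, |S.φ (S.f^[i] y) - S.φ (S.f^[i] x)| := abs_sum_le_sum_abs _ _
    _ ≤ ∑ i ∈ range l, V * S.m n (S.f^[i] x) := sum_le_sum fun i _ => (hV _ _).trans
        (mul_le_mul_of_nonneg_left (S.abs_sub_le_m (S.iterate_mem_J h i)) hV0)
    _ = V * ∑ i ∈ range l, S.m n (S.f^[i] x) := by rw [mul_sum]
    _ ≤ V * N := mul_le_mul_of_nonneg_left (S.sum_m_le hl x) hV0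
    _ = N * V := mul_comm _ _

theorem exp_u_mul_m_le {V : ℝ} (hV0 : 0 ≤ V) (hV : ∀ x y, |S.φ y - S.φ x| ≤ V * |y - x|)
    {N n l : ℕ} (hl : l ≤ N * S.c.q (n + 1)) (x : ℝ) :
    Real.exp (S.u l x) * S.m n x ≤ Real.exp (N * V) * S.m n (S.f^[l] x) := by
  obtain ⟨ξ, hξ, e⟩ := S.exists_m_iterate_eq n l x
  rw [e, ← mul_assoc, ← Real.exp_add]
  refine mul_le_mul_of_nonneg_right (Real.exp_le_exp.2 ?_) (S.m_pos _ _).le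
  have := abs_le.1 (S.abs_u_sub_le_mul hV0 hV hl hξ)
  linarith

theorem m_iterate_le {V : ℝ} (hV0 : 0 ≤ V) (hV : ∀ x y, |S.φ y - S.φ x| ≤ V * |y - x|)
    {N n l : ℕ} (hl : l ≤ N * S.c.q (n + 1)) (x : ℝ) :
    S.m n (S.f^[l] x) ≤ Real.exp (N * V) * (Real.exp (S.u l x) * S.m n x) := by
  obtain ⟨ξ, hξ, e⟩ := S.exists_m_iterate_eq n l x
  rw [e, ← mul_assoc, ← Real.exp_add]
  refine mul_le_mul_of_nonneg_right (Real.exp_le_exp.2 ?_) (S.m_pos _ _).le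
  have := abs_le.1 (S.abs_u_sub_le_mul hV0 hV hl hξ)
  linarith

theorem L_mul_m_le {V : ℝ} (hV0 : 0 ≤ V) (hV : ∀ x y, |S.φ y - S.φ x| ≤ V * |y - x|)
    {n l : ℕ} (hl : l ≤ S.c.q (n + 1)) (x : ℝ) : S.L l x * S.m n x ≤ Real.exp V := by
  rw [L, sum_mul]
  calc _ ≤ ∑ i ∈ range l, Real.exp V * S.m n (S.f^[i] x) := by
        refine sum_le_sum fun i hi => ?_
        have := S.exp_u_mul_m_le hV0 hV (N := 1) (n := n) (l := i)
          (by rw [one_mul]; exact (mem_range.1 hi).le.trans hl) x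
        simpa using this
    _ ≤ Real.exp V * 1 := by
        rw [← mul_sum]
        exact mul_le_mul_of_nonneg_left (S.sum_m_le_one hl x) (Real.exp_pos _).le
    _ = _ := mul_one _

theorem le_L_mul_m {V : ℝ} (hV0 : 0 ≤ V) (hV : ∀ x y, |S.φ y - S.φ x| ≤ V * |y - x|)
    {n : ℕ} (h : ∀ x, S.m (n + 1) x ≤ 2 * S.m n x) (x : ℝ) :
    1 ≤ 3 * Real.exp V * (S.L (S.c.q (n + 1)) x * S.m n x) := by
  have h1 := S.sum_m_add_sum_m n x
  have h2 : ∑ j ∈ range (S.c.q n), S.m (n + 1) (S.f^[j] x) ≤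
      2 * ∑ l ∈ range (S.c.q (n + 1)), S.m n (S.f^[l] x) := by
    calc _ ≤ ∑ j ∈ range (S.c.q n), 2 * S.m n (S.f^[j] x) := sum_le_sum fun i _ => h _
      _ = 2 * ∑ j ∈ range (S.c.q n), S.m n (S.f^[j] x) := by rw [mul_sum]
      _ ≤ _ := mul_le_mul_of_nonneg_left (sum_le_sum_of_subset_of_nonneg
        (range_mono (S.c.q_le_succ n)) fun _ _ _ => (S.m_pos _ _).le) (by norm_num)
  have h3 : ∑ l ∈ range (S.c.q (n + 1)), S.m n (S.f^[l] x) ≤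
      Real.exp V * (S.L (S.c.q (n + 1)) x * S.m n x) := by
    rw [L, sum_mul, mul_sum]
    refine sum_le_sum fun i hi => ?_
    have := S.m_iterate_le hV0 hV (N := 1) (n := n) (l := i)
          (by rw [one_mul]; exact (mem_range.1 hi).le) x
    simpa using this
  linarith

/-- Comparability of `m n` on `J n x` given a bound on the distortion of `F n`. -/
theorem m_le_of_mem_J {n : ℕ} {A : ℝ} (hA : ∀ x, |S.ψ n x| ≤ A) {x y : ℝ} (h : y ∈ S.J n x) :
    S.m n y ≤ (1 + Real.exp A) * S.m n x ∧ S.m n x ≤ (1 + Real.exp A) * S.m n y := by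
  have h1 := S.F_mem_J_of_mem h n
  have hup : ∀ z, S.m n (S.F n z) ≤ Real.exp A * S.m n z := by
    intro z
    obtain ⟨ξ, -, e⟩ := S.exists_m_F_eq n n z
    rw [e]
    exact mul_le_mul_of_nonneg_right (Real.exp_le_exp.2 ((le_abs_self _).trans (hA ξ)))
      (S.m_pos _ _).le
  have hu := S.F_sub n x
  have hu' := S.F_sub n (S.F n x)
  constructor
  · have e1 : |S.F n y - S.F n x| ≤ S.m n (S.F n x) := S.abs_sub_le_m h1
    have e2 : |S.F n x - y| ≤ S.m n x := Set.abs_sub_right_of_mem_uIcc h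
    have e3 := abs_add_le (S.F n y - S.F n x) (S.F n x - y)
    rw [sub_add_sub_cancel] at e3
    have := hup x
    rw [m]
    linarith
  · have e0 : S.F n x ∈ S.J n y := by
      have h1' := Set.mem_uIcc.1 h
      have h2' := Set.mem_uIcc.1 h1
      have p1 := S.m_pos n x
      have p2 := S.m_pos n (S.F n x)
      refine Set.mem_uIcc.2 ?_
      rcases sgn_eq n with hs | hs <;> rw [hs] at hu hu'
      · left
        constructor
        · rcases h1' with h1' | h1' <;> linarith
        · rcases h2' with h2' | h2' <;> linarith
      · right
        constructor
        · rcases h2' with h2' | h2' <;> linarith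
        · rcases h1' with h1' | h1' <;> linarith
    obtain ⟨ξ, -, e⟩ := exists_mem_uIcc_deriv_eq (S.hasDerivAt_F n) x y
    have e1 : |y - x| ≤ Real.exp A * |S.F n y - S.F n x| := by
      rw [e, abs_mul, abs_of_pos (Real.exp_pos _), ← mul_assoc, ← Real.exp_add]
      refine le_mul_of_one_le_left (abs_nonneg _) (Real.one_le_exp ?_)
      have := abs_le.1 (hA ξ)
      linarith
    have e2 : |S.F n y - S.F n x| ≤ S.m n y := Set.abs_sub_right_of_mem_uIcc e0
    have e3 : |S.F n x - y| ≤ S.m n y := S.abs_sub_le_m e0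
    have e4 := abs_add_le (S.F n x - y) (y - x)
    rw [sub_add_sub_cancel] at e4
    have e5 : Real.exp A * |S.F n y - S.F n x| ≤ Real.exp A * S.m n y :=
      mul_le_mul_of_nonneg_left e2 (Real.exp_pos _).le
    rw [m]
    linarith

theorem exists_abs_iteratedDeriv_φ_le : ∃ B : ℝ, 1 ≤ B ∧ ∀ j ≤ k - 1, ∀ x,
    |iteratedDeriv j S.φ x| ≤ B := by
  have : ∀ j : ℕ, ∃ B : ℝ, 0 ≤ B ∧ (j ≤ k - 1 → ∀ x, |iteratedDeriv j S.φ x| ≤ B) := by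
    intro j
    by_cases hj : j ≤ k - 1
    · obtain ⟨B, hB, h⟩ := exists_abs_le_of_periodic (g := iteratedDeriv j S.φ)
        (S.contDiff_φ.continuous_iteratedDeriv j (by exact_mod_cast hj))
        (iteratedDeriv_periodic S.φ_add_int j)
      exact ⟨B, hB, fun _ => h⟩
    · exact ⟨0, le_rfl, fun h => absurd h hj⟩
  choose B hB h using this
  refine ⟨1 + ∑ j ∈ range k, B j, ?_, fun j hj x => ?_⟩
  · have : 0 ≤ ∑ j ∈ range k, B j := sum_nonneg fun _ _ => hB _
    linarith
  · have h1 : B j ≤ ∑ j ∈ range k, B j :=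
      single_le_sum (f := B) (fun _ _ => hB _) (mem_range.2 (by have := S.two_le; omega))
    linarith [h j hj x]

theorem iteratedDeriv_one_u_succ (hk : 2 < k) (l : ℕ) (x : ℝ) : iteratedDeriv 1 (S.u (l + 1)) x =
    iteratedDeriv 1 (S.u l) x + iteratedDeriv 1 S.φ (S.f^[l] x) * Real.exp (S.u l x) := by
  have h1 := hasDerivAt_iteratedDeriv (r := 0) (S.contDiff_u l) (by omega) x
  have h2 := hasDerivAt_iteratedDeriv (r := 0) S.contDiff_φ (by omega) (S.f^[l] x)
  simp only [iteratedDeriv_zero] at h1 h2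
  have h3 := h1.add (h2.comp x (S.hasDerivAt_iterate l x))
  rw [iteratedDeriv_one]
  rw [← h3.deriv]
  congr 1
  exact funext fun y => S.u_succ l y

/-- The Schwarzian derivative of iterates. -/
theorem schwarzian_succ (hk : 2 < k) (l : ℕ) (x : ℝ) :
    iteratedDeriv 2 (S.u (l + 1)) x - iteratedDeriv 1 (S.u (l + 1)) x ^ 2 / 2 =
    (iteratedDeriv 2 (S.u l) x - iteratedDeriv 1 (S.u l) x ^ 2 / 2) +
      (iteratedDeriv 2 S.φ (S.f^[l] x) - iteratedDeriv 1 S.φ (S.f^[l] x) ^ 2 / 2) *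
        Real.exp (S.u l x) ^ 2 := by
  have h0 := hasDerivAt_iteratedDeriv (r := 0) (S.contDiff_u l) (by omega) x
  have h1 := hasDerivAt_iteratedDeriv (r := 1) (S.contDiff_u l) (by omega) x
  have h2 := hasDerivAt_iteratedDeriv (r := 1) S.contDiff_φ (by omega) (S.f^[l] x)
  simp only [iteratedDeriv_zero] at h0
  have h3 := h1.add ((h2.comp x (S.hasDerivAt_iterate l x)).mul h0.exp)
  have hfun : iteratedDeriv 1 (S.u (l + 1)) =
      iteratedDeriv 1 (S.u l) + iteratedDeriv 1 S.φ ∘ S.f^[l] * fun x => Real.exp (S.u l x) :=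
    funext fun y => S.iteratedDeriv_one_u_succ hk l y
  rw [← hfun] at h3
  have h4 := h3.deriv
  rw [← iteratedDeriv_succ] at h4
  rw [h4, S.iteratedDeriv_one_u_succ hk l]
  simp only [Function.comp_apply]
  ring

theorem abs_schwarzian_le {B : ℝ} (hB1 : 1 ≤ B) (hB : ∀ j ≤ k - 1, ∀ x, |iteratedDeriv j S.φ x| ≤ B)
    (hk : 2 < k) (l : ℕ) (x : ℝ) :
    |iteratedDeriv 2 (S.u l) x - iteratedDeriv 1 (S.u l) x ^ 2 / 2| ≤
      2 * B ^ 2 * ∑ i ∈ range l, Real.exp (S.u i x) ^ 2 := by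
  induction l with
  | zero => simp [u_zero']
  | succ l ih =>
    rw [S.schwarzian_succ hk, sum_range_succ, mul_add]
    refine (abs_add_le _ _).trans (add_le_add ih ?_)
    rw [abs_mul, abs_of_pos (pow_pos (Real.exp_pos _) 2)]
    refine mul_le_mul_of_nonneg_right ?_ (by positivity)
    have h1 := abs_le.1 (hB 1 (by omega) (S.f^[l] x))
    have h2 := abs_le.1 (hB 2 (by omega) (S.f^[l] x))
    rw [abs_le]
    constructor <;> nlinarith

theorem abs_iteratedDeriv_one_u_le (hk : 2 < k) : ∃ A : ℝ, 0 ≤ A ∧ ∀ (n : ℕ) (M : ℝ),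
    (∀ x, S.m n x ≤ M) → ∀ l ≤ S.c.q (n + 1), ∀ x,
      |iteratedDeriv 1 (S.u l) x| * S.m n x ≤ A * Real.sqrt M := by
  obtain ⟨V, hV0, hV⟩ := S.exists_abs_deriv_φ_le hk
  obtain ⟨B, hB1, hB⟩ := S.exists_abs_iteratedDeriv_φ_le
  set A₁ := 2 * (2 * B ^ 2 * (Real.exp (3 * V) ^ 2 * 3)) with hA₁
  set W := Real.exp (3 * V) with hW
  have hW0 : 0 < W := Real.exp_pos _
  refine ⟨2 * Real.sqrt A₁ * (W * (1 + W)), by positivity, fun n M hM l hl x => ?_⟩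
  have hM0 : 0 < M := (S.m_pos n 0).trans_le (hM 0)
  -- a point where the displacement is minimal
  obtain ⟨x₀, hx₀⟩ := exists_forall_le_of_periodic (g := fun x => - S.m n x) (S.continuous_m n).neg
    (fun x p => by rw [m_add_int])
  set μ := S.m n x₀ with hμ
  have hμ0 : 0 < μ := S.m_pos _ _
  have hμle : ∀ y, μ ≤ S.m n y := fun y => by have := hx₀ y; linarith
  have sch : ∀ t ≤ 3 * S.c.q (n + 1), ∀ y,
      |iteratedDeriv 1 (S.u t) y| ≤ Real.sqrt A₁ * Real.sqrt M / μ := by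
    intro t ht y
    obtain ⟨z, hz⟩ := exists_forall_le_of_periodic
      (g := fun y => iteratedDeriv 1 (S.u t) y ^ 2)
      (((S.contDiff_u t).continuous_iteratedDeriv 1 (by exact_mod_cast (by omega))).pow 2)
      (fun x p => by rw [iteratedDeriv_periodic (S.u_add_int t)])
    have hzd := ((hasDerivAt_iteratedDeriv (r := 1) (S.contDiff_u t) (by omega) z).pow 2)
    have hz0 := IsLocalMax.hasDerivAt_eq_zero (f := fun y => iteratedDeriv 1 (S.u t) y ^ 2)
      (Filter.Eventually.of_forall hz) hzd
    have hT := S.abs_schwarzian_le hB1 hB hk t z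
    have hsum : (∑ i ∈ range t, Real.exp (S.u i z) ^ 2) * μ ^ 2 ≤ W ^ 2 * 3 * M := by
      calc _ ≤ (∑ i ∈ range t, Real.exp (S.u i z) ^ 2) * S.m n z ^ 2 := by
            have := hμle z
            gcongr
        _ = ∑ i ∈ range t, (Real.exp (S.u i z) * S.m n z) ^ 2 := by
            rw [sum_mul]; exact sum_congr rfl fun i _ => by ring
        _ ≤ ∑ i ∈ range t, W ^ 2 * M * S.m n (S.f^[i] z) := by
            refine sum_le_sum fun i hi => ?_
            have h1 := S.exp_u_mul_m_le hV0 hV (N := 3) (n := n) (l := i)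
              ((mem_range.1 hi).le.trans ht) z
            have h2 := hM (S.f^[i] z)
            have h3 := S.m_pos n (S.f^[i] z)
            have h4 : 0 ≤ Real.exp (S.u i z) * S.m n z :=
              mul_nonneg (Real.exp_pos _).le (S.m_pos _ _).le
            push_cast at h1
            rw [← hW] at h1
            calc _ ≤ (W * S.m n (S.f^[i] z)) ^ 2 := by gcongr
              _ = W ^ 2 * (S.m n (S.f^[i] z) * S.m n (S.f^[i] z)) := by ring
              _ ≤ W ^ 2 * (M * S.m n (S.f^[i] z)) := by gcongr
              _ = _ := by ring
        _ = W ^ 2 * M * ∑ i ∈ range t, S.m n (S.f^[i] z) := by rw [mul_sum]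
        _ ≤ W ^ 2 * M * 3 := by
            have := S.sum_m_le ht z
            push_cast at this
            gcongr
        _ = _ := by ring
    have hsq : iteratedDeriv 1 (S.u t) z ^ 2 ≤ A₁ * M / μ ^ 2 := by
      have h5 : iteratedDeriv 1 (S.u t) z ^ 2 ≤
          2 * (2 * B ^ 2 * ∑ i ∈ range t, Real.exp (S.u i z) ^ 2) := by
        rcases mul_eq_zero.1 hz0 with h | h
        · have h' : iteratedDeriv 1 (S.u t) z = 0 := by simpa using h
          rw [h']
          have : 0 ≤ ∑ i ∈ range t, Real.exp (S.u i z) ^ 2 := sum_nonneg fun _ _ => by positivity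
          simp
          positivity
        · have h' : iteratedDeriv 2 (S.u t) z = 0 := h
          rw [h', zero_sub, abs_neg, abs_of_nonneg (by positivity)] at hT
          linarith
      rw [le_div_iff₀ (by positivity)]
      calc _ ≤ 2 * (2 * B ^ 2 * ∑ i ∈ range t, Real.exp (S.u i z) ^ 2) * μ ^ 2 := by gcongr
        _ = 2 * (2 * B ^ 2 * ((∑ i ∈ range t, Real.exp (S.u i z) ^ 2) * μ ^ 2)) := by ring
        _ ≤ 2 * (2 * B ^ 2 * (W ^ 2 * 3 * M)) := by gcongr
        _ = _ := by rw [hA₁]; ring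
    refine abs_le_of_sq_le_sq ?_ (by positivity)
    rw [div_pow, mul_pow, Real.sq_sqrt (by positivity), Real.sq_sqrt hM0.le]
    exact (hz y).trans hsq
  obtain ⟨j, hj, p, y, hy, rfl⟩ := S.exists_mem_J_iterate_eq n x₀ x
  have hq := S.c.q_le_succ n
  have hcoc : iteratedDeriv 1 (S.u (j + l)) y = iteratedDeriv 1 (S.u j) y +
      iteratedDeriv 1 (S.u l) (S.f^[j] y) * Real.exp (S.u j y) := by
    have h1 := hasDerivAt_iteratedDeriv (r := 0) (S.contDiff_u j) (by omega) y
    have h2 := hasDerivAt_iteratedDeriv (r := 0) (S.contDiff_u l) (by omega) (S.f^[j] y)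
    simp only [iteratedDeriv_zero] at h1 h2
    have h3 := h1.add (h2.comp y (S.hasDerivAt_iterate j y))
    rw [iteratedDeriv_one]
    rw [← h3.deriv]
    congr 1
    exact funext fun y => S.u_add j l y
  rw [iteratedDeriv_periodic (S.u_add_int l), m_add_int]
  have b1 := sch (j + l) (by omega) y
  have b2 := sch j (by omega) y
  have b3 : |iteratedDeriv 1 (S.u l) (S.f^[j] y)| * Real.exp (S.u j y) ≤
      2 * (Real.sqrt A₁ * Real.sqrt M / μ) := by
    rw [← abs_of_pos (Real.exp_pos (S.u j y)), ← abs_mul]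
    have : iteratedDeriv 1 (S.u l) (S.f^[j] y) * Real.exp (S.u j y) =
      iteratedDeriv 1 (S.u (j + l)) y - iteratedDeriv 1 (S.u j) y := by rw [hcoc]; ring
    rw [this]
    refine (abs_sub _ _).trans (by linarith)
  have b4 := S.m_iterate_le hV0 hV (N := 3) (n := n) (l := j) (by omega) y
  push_cast at b4
  rw [← hW] at b4
  have b5 := (S.m_le_of_mem_J (S.abs_ψ_le hV0 hV n) hy).1
  rw [← hW, ← hμ] at b5
  calc _ ≤ |iteratedDeriv 1 (S.u l) (S.f^[j] y)| * (W * (Real.exp (S.u j y) * ((1 + W) * μ))) := by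
        gcongr
        exact b4.trans (by gcongr)
    _ = (|iteratedDeriv 1 (S.u l) (S.f^[j] y)| * Real.exp (S.u j y)) * (W * (1 + W) * μ) := by ring
    _ ≤ 2 * (Real.sqrt A₁ * Real.sqrt M / μ) * (W * (1 + W) * μ) := by gcongr
    _ = _ := by field_simp

end SmoothLift

namespace SmoothLift

variable {k : ℕ} {α : ℝ} (S : SmoothLift k α)

theorem eventually_m_le (hk : 2 < k) {ε : ℝ} (hε : 0 < ε) :
    ∀ᶠ n in Filter.atTop, ∀ x, S.m n x ≤ ε := by
  obtain ⟨N, hN⟩ := S.exists_forall_m_lt hk hε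
  exact Filter.eventually_atTop.2 ⟨N, fun n hn x => (hN n hn x).le⟩

theorem eventually_iteratedDeriv_one_u_le (hk : 2 < k) {ε : ℝ} (hε : 0 < ε) :
    ∀ᶠ n in Filter.atTop, ∀ l ≤ S.c.q (n + 1), ∀ x,
      |iteratedDeriv 1 (S.u l) x| * S.m n x ≤ ε := by
  obtain ⟨A, hA, h⟩ := S.abs_iteratedDeriv_one_u_le hk
  filter_upwards [S.eventually_m_le hk (ε := (ε / (A + 1)) ^ 2) (by positivity)] with n hn l hl x
  refine (h n _ hn l hl x).trans ?_
  rw [Real.sqrt_sq (by positivity), mul_div_assoc', div_le_iff₀ (by positivity)]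
  nlinarith

theorem abs_sub_le_of_mem_J {n : ℕ} {A G : ℝ} (hA : ∀ x, |S.ψ n x| ≤ A) {g g' : ℝ → ℝ}
    (hg : ∀ x, HasDerivAt g (g' x) x) (hG : ∀ x, |g' x| * S.m n x ≤ G) {x y : ℝ}
    (h : y ∈ S.J n x) : |g y - g x| ≤ (1 + Real.exp A) * G := by
  have hG0 : 0 ≤ G := (mul_nonneg (abs_nonneg _) (S.m_pos n 0).le).trans (hG 0)
  have h0 := S.m_pos n x
  have h1 := abs_sub_le_of_abs_deriv_le hg (M := (1 + Real.exp A) * G / S.m n x) x y (fun z hz => by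
    rw [le_div_iff₀ h0]
    have hz' : z ∈ S.J n x := Set.uIcc_subset_uIcc_left h hz
    have h2 := (S.m_le_of_mem_J hA hz').2
    have := Real.exp_pos A
    calc _ ≤ |g' z| * ((1 + Real.exp A) * S.m n z) := by gcongr
      _ = (1 + Real.exp A) * (|g' z| * S.m n z) := by ring
      _ ≤ _ := by gcongr; exact hG z)
  refine h1.trans ?_
  have h3 := S.abs_sub_le_m h
  have := Real.exp_pos A
  calc _ ≤ (1 + Real.exp A) * G / S.m n x * S.m n x := by gcongr
    _ = _ := by field_simp

theorem eventually_ψ_le (hk : 2 < k) {ε : ℝ} (hε : 0 < ε) :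
    ∀ᶠ n in Filter.atTop, ∀ x, |S.ψ n x| ≤ ε := by
  obtain ⟨V, hV0, hV⟩ := S.exists_abs_deriv_φ_le hk
  set W := Real.exp (3 * V) with hW
  have hW0 : 0 < W := Real.exp_pos _
  obtain ⟨N, hN⟩ := Filter.eventually_atTop.1 (S.eventually_iteratedDeriv_one_u_le hk
    (ε := ε / (2 * (1 + W))) (by positivity))
  refine Filter.eventually_atTop.2 ⟨N + 1, fun n' hn' y => ?_⟩
  obtain ⟨n, rfl⟩ : ∃ n, n' = n + 1 := ⟨n' - 1, by omega⟩
  have hd : ∀ l x, HasDerivAt (S.u l) (iteratedDeriv 1 (S.u l) x) x := fun l x => by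
    simpa using hasDerivAt_iteratedDeriv (r := 0) (S.contDiff_u l) (by omega) x
  obtain ⟨x, hx⟩ := S.exists_ψ_eq_zero (n + 1)
  obtain ⟨l, hl, p, x', hx', rfl⟩ := S.exists_mem_J_iterate_eq n x y
  rw [ψ_add_int, ψ_iterate]
  have h1 := S.abs_sub_le_of_mem_J (S.abs_ψ_le hV0 hV n) (hd (S.c.q (n + 1)))
    (hN n (by omega) _ le_rfl) hx'
  have h2 := S.abs_sub_le_of_mem_J (S.abs_ψ_le hV0 hV (n + 1)) (hd l)
    (hN (n + 1) (by omega) _ (hl.le.trans (S.c.q_add_le n))) (S.F_mem_J (n + 1) x')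
  rw [ψ] at hx ⊢
  rw [hx, sub_zero] at h1
  have h3 := abs_add_le (S.u (S.c.q (n + 1)) x') (S.u l (S.F (n + 1) x') - S.u l x')
  have h4 : (1 + W) * (ε / (2 * (1 + W))) = ε / 2 := by field_simp
  rw [← hW, h4] at h1 h2
  linarith

theorem iteratedDeriv_u (l r : ℕ) (hr : r ≤ k - 1) (x : ℝ) : iteratedDeriv r (S.u l) x =
    ∑ i ∈ range l, iteratedDeriv r (fun y => S.φ (S.f^[i] y)) x := by
  unfold u
  rw [iteratedDeriv_fun_sum]
  intro i _
  refine ((S.contDiff_φ.comp ((S.contDiff_iterate i).of_le ?_)).of_le ?_).contDiffAt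
  · exact_mod_cast Nat.sub_le k 1
  · exact_mod_cast hr

theorem eventually_iteratedDeriv_u_le_L_aux (hk : 2 < k) (r : ℕ) (hr1 : 2 ≤ r) (hr : r ≤ k - 1)
    (ih : ∀ ε > 0, ∀ᶠ n in Filter.atTop, ∀ j, 1 ≤ j → j < r → ∀ l ≤ S.c.q (n + 1), ∀ x,
      |iteratedDeriv j (S.u l) x| * S.m n x ^ j ≤ ε) {ε : ℝ} (hε : 0 < ε) :
    ∀ᶠ n in Filter.atTop, ∀ l ≤ S.c.q (n + 1), ∀ x,
      |iteratedDeriv r (S.u l) x| * S.m n x ^ (r - 1) ≤ ε * S.L l x := by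
  obtain ⟨V, hV0, hV⟩ := S.exists_abs_deriv_φ_le hk
  obtain ⟨B, hB1, hB⟩ := S.exists_abs_iteratedDeriv_φ_le
  obtain ⟨C, hC, hcomp⟩ := exists_bound_iteratedDeriv_comp k
  set W := Real.exp V with hW
  have hW1 : 1 ≤ W := Real.one_le_exp hV0
  set η := min 1 (ε / (2 * C * B * W)) with hη
  have hη0 : 0 < η := by positivity
  have hη2 : 2 * C * B * W * η ≤ ε := by
    have : η ≤ ε / (2 * C * B * W) := min_le_right _ _
    rw [le_div_iff₀ (by positivity)] at this
    linarith
  filter_upwards [ih η hη0, S.eventually_m_le hk (ε := η / W) (by positivity)] with n h1 h2 l hl x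
  rw [S.iteratedDeriv_u l r hr, L, mul_sum]
  have hm := S.m_pos n x
  refine (mul_le_mul_of_nonneg_right (abs_sum_le_sum_abs _ _) (by positivity)).trans ?_
  rw [sum_mul]
  refine sum_le_sum fun i hi => ?_
  have hi : i ≤ S.c.q (n + 1) := (mem_range.1 hi).le.trans hl
  set p := Real.exp (S.u i x) with hp
  have hp0 : 0 < p := Real.exp_pos _
  have hpm : p * S.m n x ≤ η := by
    have e1 := S.exp_u_mul_m_le hV0 hV (N := 1) (n := n) (l := i) (by omega) x
    have e2 := h2 (S.f^[i] x)
    rw [le_div_iff₀ (by positivity)] at e2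
    simp only [Nat.cast_one, one_mul] at e1
    linarith
  have hη1 : η ≤ 1 := min_le_left _ _
  have hc := hcomp r (by omega) (by omega) S.φ S.f^[i] (S.u i)
    (S.contDiff_φ.of_le (by exact_mod_cast hr))
    ((S.contDiff_u i).of_le (by exact_mod_cast (by omega))) (S.hasDerivAt_iterate i) x η
    (1 / S.m n x) (B * (p * S.m n x)) hη0.le hη1 (by positivity) (by positivity)
    (fun j hj1 hjr => by
      rw [div_pow, one_pow, mul_one_div, le_div_iff₀ (by positivity)]
      have e1 := hB j (by omega) (S.f^[i] x)
      have e2 : (p * S.m n x) ^ j ≤ p * S.m n x :=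
        pow_le_of_le_one (by positivity) (hpm.trans hη1) (by omega)
      calc _ = |iteratedDeriv j S.φ (S.f^[i] x)| * (p * S.m n x) ^ j := by rw [mul_pow]; ring
        _ ≤ _ := by gcongr)
    (fun j hj1 hjr => by
      rw [div_pow, one_pow, mul_one_div, le_div_iff₀ (by positivity)]
      exact h1 j hj1 hjr i hi x)
  have e1 := hB r hr (S.f^[i] x)
  have e2 : (p * S.m n x) ^ (r - 1) ≤ η :=
    (pow_le_of_le_one (by positivity) (hpm.trans hη1) (by omega)).trans hpm
  have e3 : |iteratedDeriv r S.φ (S.f^[i] x) * p ^ r| * S.m n x ^ (r - 1) ≤ B * p * η := by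
    have e4 : p ^ r = p * p ^ (r - 1) := by rw [← pow_succ']; congr 1; omega
    rw [abs_mul, abs_of_pos (pow_pos hp0 r), e4]
    calc _ = |iteratedDeriv r S.φ (S.f^[i] x)| * p * (p * S.m n x) ^ (r - 1) := by
          rw [mul_pow]; ring
      _ ≤ _ := by gcongr
  have e5 : C * η * (B * (p * S.m n x)) * (1 / S.m n x) ^ r * S.m n x ^ (r - 1) = C * η * B * p := by
    have e4 : S.m n x ^ r = S.m n x * S.m n x ^ (r - 1) := by rw [← pow_succ']; congr 1; omega
    rw [div_pow, one_pow, e4]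
    field_simp
  have e6 := abs_sub_abs_le_abs_sub (iteratedDeriv r (fun y => S.φ (S.f^[i] y)) x)
    (iteratedDeriv r S.φ (S.f^[i] x) * p ^ r)
  calc _ ≤ (|iteratedDeriv r S.φ (S.f^[i] x) * p ^ r| +
        C * η * (B * (p * S.m n x)) * (1 / S.m n x) ^ r) * S.m n x ^ (r - 1) := by
        gcongr; linarith
    _ ≤ B * p * η + C * η * B * p := by rw [add_mul, e5]; linarith
    _ ≤ 2 * C * B * W * η * p := by
      have : B * p * η ≤ C * B * W * η * p := by
        have : 1 ≤ C * W := one_le_mul_of_one_le_of_one_le hC hW1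
        calc _ = 1 * (B * p * η) := by ring
          _ ≤ (C * W) * (B * p * η) := by gcongr
          _ = _ := by ring
      have : C * η * B * p ≤ C * B * W * η * p := by
        calc _ = (C * η * B * p) * 1 := by ring
          _ ≤ (C * η * B * p) * W := by gcongr
          _ = _ := by ring
      linarith
    _ ≤ ε * p := by gcongr

theorem eventually_iteratedDeriv_u_le (hk : 2 < k) (r : ℕ) (hr : r ≤ k - 1) :
    ∀ ε > 0, ∀ᶠ n in Filter.atTop, ∀ j, 1 ≤ j → j ≤ r → ∀ l ≤ S.c.q (n + 1), ∀ x,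
      |iteratedDeriv j (S.u l) x| * S.m n x ^ j ≤ ε := by
  induction r with
  | zero => exact fun ε _ => Filter.Eventually.of_forall fun n j h1 h2 => by omega
  | succ r ih =>
    intro ε hε
    have ih := ih (by omega)
    rcases Nat.eq_zero_or_pos r with rfl | hr0
    · filter_upwards [S.eventually_iteratedDeriv_one_u_le hk hε] with n h j h1 h2
      obtain rfl : j = 1 := by omega
      simpa using h
    · obtain ⟨V, hV0, hV⟩ := S.exists_abs_deriv_φ_le hk
      have hW := Real.exp_pos V
      filter_upwards [ih ε hε, S.eventually_iteratedDeriv_u_le_L_aux hk (r + 1) (by omega) hr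
        (fun ε hε => (ih ε hε).mono fun n h j h1 h2 => h j h1 (by omega))
        (ε := ε / Real.exp V) (by positivity)] with n h h' j h1 h2 l hl x
      rcases h2.lt_or_eq with h2 | rfl
      · exact h j h1 (by omega) l hl x
      · have e1 := h' l hl x
        have e2 := S.L_mul_m_le hV0 hV hl x
        have hm := S.m_pos n x
        rw [Nat.add_sub_cancel] at e1
        calc _ = |iteratedDeriv (r + 1) (S.u l) x| * S.m n x ^ r * S.m n x := by ring
          _ ≤ ε / Real.exp V * S.L l x * S.m n x := by gcongr
          _ = ε / Real.exp V * (S.L l x * S.m n x) := by ring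
          _ ≤ ε / Real.exp V * Real.exp V := by gcongr
          _ = ε := by field_simp

theorem eventually_iteratedDeriv_u_le_L (hk : 2 < k) {ε : ℝ} (hε : 0 < ε) :
    ∀ᶠ n in Filter.atTop, ∀ l ≤ S.c.q (n + 1), ∀ x,
      |iteratedDeriv (k - 1) (S.u l) x| * S.m n x ^ (k - 2) ≤ ε * S.L l x :=
  S.eventually_iteratedDeriv_u_le_L_aux hk (k - 1) (by omega) le_rfl
    (fun ε hε => (S.eventually_iteratedDeriv_u_le hk (k - 1) le_rfl ε hε).mono
      fun _ h j h1 h2 => h j h1 h2.le) hε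

end SmoothLift

theorem one_add_pow_le {x : ℝ} (h0 : 0 ≤ x) (h1 : x ≤ 1) (r : ℕ) : (1 + x) ^ r ≤ 1 + 3 ^ r * x := by
  induction r with
  | zero => simpa using h0
  | succ r ih =>
    have h3 : (1 : ℝ) ≤ 3 ^ r := one_le_pow₀ (by norm_num)
    calc (1 + x) ^ (r + 1) = (1 + x) ^ r * (1 + x) := pow_succ _ _
      _ ≤ (1 + 3 ^ r * x) * (1 + x) := by gcongr
      _ = 1 + x * (1 + 3 ^ r + 3 ^ r * x) := by ring
      _ ≤ 1 + x * (3 ^ r + 3 ^ r + 3 ^ r * 1) := by gcongr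
      _ = 1 + 3 ^ (r + 1) * x := by ring

theorem exists_bound_iteratedDeriv_comp' (n : ℕ) : ∃ C : ℝ, 1 ≤ C ∧ ∀ r ≤ n, ∀ ψ g u : ℝ → ℝ,
    ContDiff ℝ r ψ → ContDiff ℝ (r - 1 : ℕ) u → (∀ y, HasDerivAt g (Real.exp (u y)) y) →
    ∀ x ε l K, 0 ≤ ε → ε ≤ 1 → 0 ≤ l → 0 ≤ K →
    (∀ j, 1 ≤ j → j < r → |iteratedDeriv j ψ (g x)| * Real.exp (u x) ^ j ≤ K * l ^ j) →
    (∀ j, 1 ≤ j → j < r → |iteratedDeriv j u x| ≤ ε * l ^ j) →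
    |iteratedDeriv r (fun y => ψ (g y)) x - iteratedDeriv r ψ (g x) * Real.exp (u x) ^ r| ≤
      C * ε * K * l ^ r := by
  obtain ⟨C, hC, h⟩ := exists_bound_iteratedDeriv_comp n
  refine ⟨C, hC, fun r hr ψ g u hψ hu hg x ε l K hε hε1 hl hK h1 h2 => ?_⟩
  rcases Nat.eq_zero_or_pos r with rfl | h0
  · simp only [iteratedDeriv_zero, pow_zero, mul_one, sub_self, abs_zero]; positivity
  · exact h r h0 hr ψ g u hψ hu hg x ε l K hε hε1 hl hK h1 h2

/-- A pair of commuting diffeomorphisms `G`, `F` with log-derivatives `χ`, `ψ`, where `χ` is small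
and `F` moves points by at most a multiple of the displacement `m` of `G`. -/
structure CommutingPair (k : ℕ) (B : ℝ) where
  (G F χ ψ m : ℝ → ℝ)
  (A κ t E μ : ℝ)
  two_lt : 2 < k
  one_le_B : 1 ≤ B
  hasDerivAt_G : ∀ x, HasDerivAt G (Real.exp (χ x)) x
  hasDerivAt_F : ∀ x, HasDerivAt F (Real.exp (ψ x)) x
  contDiff_χ : ContDiff ℝ (k - 1 : ℕ) χ
  contDiff_ψ : ContDiff ℝ (k - 1 : ℕ) ψ
  comm : ∀ x, F (G x) = G (F x)
  cocycle : ∀ x, ψ (G x) + χ x = χ (F x) + ψ x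
  m_eq : ∀ x, m x = |G x - x|
  m_pos : ∀ x, 0 < m x
  abs_F_sub_le : ∀ x, |F x - x| ≤ μ * m x
  one_le_A : 1 ≤ A
  A_le : A ≤ 2
  t_pos : 0 < t
  t_le : t ≤ κ
  κ_le : 64 * k * 3 ^ k * κ ≤ 1
  E_pos : 0 < E
  μ_nonneg : 0 ≤ μ
  μ_le : μ ≤ 2
  χ_le : ∀ r ≤ k - 2, ∀ x, |iteratedDeriv r χ x| * m x ^ r ≤ A * κ * t ^ (r + 1)
  ψ_le : ∀ r, 1 ≤ r → r ≤ k - 2 → ∀ x, |iteratedDeriv r ψ x| * m x ^ r ≤ 2 * t ^ r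
  ψ_top_le : ∀ x, |iteratedDeriv (k - 1) ψ x| * m x ^ (k - 1) ≤ B * E

namespace CommutingPair

variable {k : ℕ} {B : ℝ} (P : CommutingPair k B)

theorem κ_pos : 0 < P.κ := P.t_pos.trans_le P.t_le

theorem κ_le' : 192 * P.κ ≤ 1 := by
  have h : (3 : ℝ) ≤ k := by exact_mod_cast P.two_lt
  have h1 : (1 : ℝ) ≤ 3 ^ k := one_le_pow₀ (by norm_num)
  have := P.κ_pos
  calc 192 * P.κ = 64 * 3 * 1 * P.κ := by ring
    _ ≤ 64 * k * 3 ^ k * P.κ := by gcongr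
    _ ≤ 1 := P.κ_le

theorem t_le_one : P.t ≤ 1 := by linarith [P.t_le, P.κ_le', P.κ_pos]

theorem abs_χ_le (x : ℝ) : |P.χ x| ≤ P.A * P.κ * P.t := by
  simpa using P.χ_le 0 (by omega) x

theorem Aκt_le : P.A * P.κ * P.t ≤ 2 * P.κ * P.t := by
  have := P.A_le; have := P.κ_pos; have := P.t_pos
  gcongr

theorem abs_χ_le' (x : ℝ) : |P.χ x| ≤ 2 * P.κ * P.t := (P.abs_χ_le x).trans P.Aκt_le

theorem two_κ_t_le : 2 * P.κ * P.t ≤ 2 * P.κ := by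
  have := P.t_le_one; have := P.κ_pos
  nlinarith

theorem abs_χ_le_one (x : ℝ) : |P.χ x| ≤ 1 := by
  have := P.abs_χ_le' x; have := P.two_κ_t_le; have := P.κ_le'; have := P.κ_pos
  linarith

theorem abs_m_sub_le {x y : ℝ} (h : |y - x| ≤ 2 * P.m x) : |P.m y - P.m x| ≤ 8 * P.κ * P.m x := by
  have h1 : ∀ z, HasDerivAt (fun z => P.G z - z) (Real.exp (P.χ z) - 1) z := fun z =>
    (P.hasDerivAt_G z).sub (hasDerivAt_id z)
  have h2 := abs_sub_le_of_abs_deriv_le h1 (M := 4 * P.κ) x y fun z _ => by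
    have := Real.abs_exp_sub_one_le (P.abs_χ_le_one z)
    have := P.abs_χ_le' z; have := P.two_κ_t_le
    linarith
  rw [P.m_eq, P.m_eq x]
  have h3 := abs_abs_sub_abs_le_abs_sub (P.G y - y) (P.G x - x)
  have := P.κ_pos
  calc _ ≤ 4 * P.κ * |y - x| := h3.trans h2
    _ ≤ 4 * P.κ * (2 * P.m x) := by gcongr
    _ = _ := by rw [P.m_eq x]; ring

theorem m_le {x y : ℝ} (h : |y - x| ≤ 2 * P.m x) : P.m x ≤ (1 + 16 * P.κ) * P.m y := by
  have h1 := (abs_le.1 (P.abs_m_sub_le h)).1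
  have h2 := P.κ_pos; have h3 := P.κ_le'; have h4 := P.m_pos x
  have h5 : (1 - 8 * P.κ) * P.m x ≤ P.m y := by linarith
  calc P.m x = 1 * P.m x := (one_mul _).symm
    _ ≤ ((1 + 16 * P.κ) * (1 - 8 * P.κ)) * P.m x := by gcongr; nlinarith
    _ = (1 + 16 * P.κ) * ((1 - 8 * P.κ) * P.m x) := by ring
    _ ≤ _ := by gcongr

theorem m_pow_le {x y : ℝ} (h : |y - x| ≤ 2 * P.m x) {r : ℕ} (hr : r ≤ k) :
    P.m x ^ r ≤ (1 + 3 ^ k * 16 * P.κ) * P.m y ^ r := by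
  have h2 := P.κ_pos; have h3 := P.κ_le'; have h4 := P.m_pos x; have h5 := P.m_pos y
  calc P.m x ^ r ≤ ((1 + 16 * P.κ) * P.m y) ^ r := by gcongr; exact P.m_le h
    _ = (1 + 16 * P.κ) ^ r * P.m y ^ r := mul_pow _ _ _
    _ ≤ (1 + 3 ^ r * (16 * P.κ)) * P.m y ^ r := by
      gcongr; exact one_add_pow_le (by positivity) (by linarith) r
    _ ≤ (1 + 3 ^ k * (16 * P.κ)) * P.m y ^ r := by gcongr; norm_num
    _ = _ := by ring

theorem m_pow_le' {x y : ℝ} (h : |y - x| ≤ 2 * P.m x) {r : ℕ} (hr : r ≤ k) :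
    P.m x ^ r ≤ 3 ^ k * P.m y ^ r := by
  have h2 := P.κ_pos; have h3 := P.κ_le'; have h5 := P.m_pos y
  have h6 : (1 : ℝ) ≤ 3 ^ k := one_le_pow₀ (by norm_num)
  refine (P.m_pow_le h hr).trans ?_
  have h7 : P.m x ≤ P.m x := le_rfl
  have h8 : (3 : ℝ) ^ k ≥ 27 := by
    calc (27 : ℝ) = 3 ^ 3 := by norm_num
      _ ≤ 3 ^ k := pow_le_pow_right₀ (by norm_num) P.two_lt
  gcongr
  nlinarith

theorem abs_F_sub_le' (x : ℝ) : |P.F x - x| ≤ 2 * P.m x :=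
  (P.abs_F_sub_le x).trans (by have := P.μ_le; have := P.m_pos x; gcongr)

theorem abs_G_sub_le (x : ℝ) : |P.G x - x| ≤ 2 * P.m x := by
  have := P.m_eq x; have := P.m_pos x
  linarith

theorem abs_sub_le_of_mem_G {x y : ℝ} (h : y ∈ Set.uIcc x (P.G x)) : |y - x| ≤ P.m x := by
  rw [P.m_eq]; exact Set.abs_sub_left_of_mem_uIcc h

/-- There is a point `ξ` near `x` where `ψ` is controlled by the first-order commutation relation. -/
theorem exists_abs_ψ_le (x : ℝ) : ∃ ξ ∈ Set.uIcc x (P.G x),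
    |P.ψ ξ| ≤ (1 + 100 * P.κ) * P.A * P.μ * P.κ * P.t := by
  obtain ⟨ξ, hξ, e1⟩ := exists_mem_uIcc_deriv_eq (g := fun z => P.F z - z)
    (fun z => (P.hasDerivAt_F z).sub (hasDerivAt_id z)) x (P.G x)
  obtain ⟨ζ, -, e2⟩ := exists_mem_uIcc_deriv_eq (g := fun z => P.G z - z)
    (fun z => (P.hasDerivAt_G z).sub (hasDerivAt_id z)) x (P.F x)
  refine ⟨ξ, hξ, ?_⟩
  have hκ := P.κ_pos; have hκ' := P.κ_le'; have hm := P.m_pos x; have ht := P.t_pos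
  have ht1 := P.t_le_one; have hA := P.one_le_A; have hμ := P.μ_nonneg
  have e3 : (Real.exp (P.ψ ξ) - 1) * (P.G x - x) = (Real.exp (P.χ ζ) - 1) * (P.F x - x) := by
    rw [← e1, ← e2, P.comm]; ring
  set D := P.A * P.κ * P.t with hD
  have hD0 : 0 < D := by positivity
  have hD1 : D ≤ 2 * P.κ := P.Aκt_le.trans P.two_κ_t_le
  have hχ : |Real.exp (P.χ ζ) - 1| ≤ (1 + 2 * P.κ) * D := by
    have h1 := Real.abs_exp_sub_one_sub_id_le (P.abs_χ_le_one ζ)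
    have h2 := P.abs_χ_le ζ
    have h3 : P.χ ζ ^ 2 ≤ D ^ 2 := by rw [← sq_abs]; gcongr
    have h4 := abs_sub_abs_le_abs_sub (Real.exp (P.χ ζ) - 1) (P.χ ζ)
    nlinarith
  have hz : |Real.exp (P.ψ ξ) - 1| ≤ (1 + 2 * P.κ) * D * P.μ := by
    have h1 : |Real.exp (P.ψ ξ) - 1| * P.m x ≤ (1 + 2 * P.κ) * D * P.μ * P.m x := by
      rw [P.m_eq x, ← abs_mul, e3, abs_mul, ← P.m_eq x]
      calc _ ≤ (1 + 2 * P.κ) * D * (P.μ * P.m x) := by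
            gcongr; exact P.abs_F_sub_le x
        _ = _ := by ring
    exact le_of_mul_le_mul_right h1 hm
  set z := Real.exp (P.ψ ξ) - 1 with hz'
  have hzb : |z| ≤ 8 * P.κ := by
    refine hz.trans ?_
    calc _ ≤ (1 + 2 * P.κ) * (2 * P.κ) * 2 := by gcongr; exact P.μ_le
      _ ≤ _ := by nlinarith
  have hzh : |z| ≤ 1 / 2 := by linarith
  have e4 : P.ψ ξ = Real.log (1 + z) := by rw [hz']; simp
  have hlog : |Real.log (1 + z)| ≤ |z| * (1 + 2 * |z|) := by
    have hz1 := abs_le.1 hzh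
    have u1 : Real.log (1 + z) ≤ z := by
      have := Real.log_le_sub_one_of_pos (x := 1 + z) (by linarith)
      linarith
    have u2 : z / (1 + z) ≤ Real.log (1 + z) := by
      have := Real.one_sub_inv_le_log_of_pos (x := 1 + z) (by linarith)
      calc z / (1 + z) = 1 - (1 + z)⁻¹ := by
            have : 1 + z ≠ 0 := by linarith
            field_simp; ring
        _ ≤ _ := this
    have u3 : z - 2 * z ^ 2 ≤ z / (1 + z) := by
      rw [le_div_iff₀ (by linarith)]
      nlinarith [mul_nonneg (sq_nonneg z) (by linarith : 0 ≤ 1 + 2 * z)]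
    have : |z| * (1 + 2 * |z|) = |z| + 2 * z ^ 2 := by
      rw [← sq_abs z]; ring
    rw [this, abs_le]
    constructor
    · linarith [neg_abs_le z]
    · nlinarith [le_abs_self z, sq_nonneg z]
  rw [e4]
  calc _ ≤ |z| * (1 + 2 * |z|) := hlog
    _ ≤ ((1 + 2 * P.κ) * D * P.μ) * (1 + 2 * (8 * P.κ)) := by gcongr
    _ = ((1 + 2 * P.κ) * (1 + 2 * (8 * P.κ))) * (D * P.μ) := by ring
    _ ≤ (1 + 100 * P.κ) * (D * P.μ) := by gcongr; nlinarith
    _ = _ := by rw [hD]; ring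

/-- Transfer of bounds on `D^r ψ` from one point of the segment `[x, G x]` to `x`. -/
theorem abs_iteratedDeriv_sub_le {r : ℕ} (hr : r + 1 ≤ k - 1) {w : ℝ}
    (hw : ∀ y, |iteratedDeriv (r + 1) P.ψ y| * P.m y ^ (r + 1) ≤ w) {x ξ : ℝ}
    (hξ : ξ ∈ Set.uIcc x (P.G x)) :
    |iteratedDeriv r P.ψ x| * P.m x ^ r ≤ |iteratedDeriv r P.ψ ξ| * P.m x ^ r + 3 ^ k * w := by
  have hm := P.m_pos x
  have h1 := abs_sub_le_of_abs_deriv_le (fun z => hasDerivAt_iteratedDeriv P.contDiff_ψ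
    (r := r) (by omega) z) (M := 3 ^ k * w / P.m x ^ (r + 1)) x ξ fun z hz => by
      have h2 : |z - x| ≤ 2 * P.m x := by
        have := Set.uIcc_subset_uIcc_left hξ hz
        have := P.abs_sub_le_of_mem_G this
        linarith
      have h3 := P.m_pow_le' h2 (r := r + 1) (by omega)
      rw [le_div_iff₀ (by positivity)]
      calc _ ≤ |iteratedDeriv (r + 1) P.ψ z| * (3 ^ k * P.m z ^ (r + 1)) := by gcongr
        _ = 3 ^ k * (|iteratedDeriv (r + 1) P.ψ z| * P.m z ^ (r + 1)) := by ring
        _ ≤ _ := by gcongr; exact hw z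
  have h4 := P.abs_sub_le_of_mem_G hξ
  have hw0 : 0 ≤ w := by
    refine le_trans ?_ (hw x)
    positivity
  have h5 : |iteratedDeriv r P.ψ x| ≤ |iteratedDeriv r P.ψ ξ| + 3 ^ k * w / P.m x ^ (r + 1) * P.m x := by
    have := abs_sub_abs_le_abs_sub (iteratedDeriv r P.ψ x) (iteratedDeriv r P.ψ ξ)
    rw [abs_sub_comm] at this
    have : |iteratedDeriv r P.ψ ξ - iteratedDeriv r P.ψ x| ≤ 3 ^ k * w / P.m x ^ (r + 1) * P.m x :=
      h1.trans (by gcongr)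
    linarith
  calc _ ≤ (|iteratedDeriv r P.ψ ξ| + 3 ^ k * w / P.m x ^ (r + 1) * P.m x) * P.m x ^ r := by gcongr
    _ = _ := by field_simp; ring

end CommutingPair

namespace CommutingPair

variable {k : ℕ} {B : ℝ} (P : CommutingPair k B)

/-- The size of the normalized derivatives of `ψ`. -/
def Y (r : ℕ) : ℝ := P.E + P.μ * P.κ * P.t ^ (r + 1)

theorem Y_pos (r : ℕ) : 0 < P.Y r := by
  have := P.κ_pos; have := P.t_pos; have := P.μ_nonneg; have := P.E_pos
  unfold Y; positivity

theorem t_pow_mul_Y_le (s r : ℕ) (h : r ≤ s) : P.t ^ (s - r) * P.Y r ≤ P.Y s := by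
  have := P.κ_pos; have := P.t_pos; have := P.μ_nonneg; have := P.E_pos
  have h1 : P.t ^ (s - r) ≤ 1 := pow_le_one₀ P.t_pos.le P.t_le_one
  unfold Y
  calc _ = P.t ^ (s - r) * P.E + P.μ * P.κ * P.t ^ (s - r + (r + 1)) := by rw [pow_add]; ring
    _ ≤ 1 * P.E + P.μ * P.κ * P.t ^ (s - r + (r + 1)) := by gcongr
    _ = _ := by rw [one_mul]; congr 3; omega

theorem Y_anti {s r : ℕ} (h : r ≤ s) : P.Y s ≤ P.Y r := by
  have := P.κ_pos; have := P.t_pos; have := P.μ_nonneg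
  unfold Y
  gcongr _ + _ * ?_
  exact pow_le_pow_of_le_one P.t_pos.le P.t_le_one (by omega)

theorem abs_ψ_le (x : ℝ) : |P.ψ x| ≤ 4 * 3 ^ k * P.t := by
  obtain ⟨ξ, hξ, h⟩ := P.exists_abs_ψ_le x
  have h1 := P.abs_iteratedDeriv_sub_le (r := 0) (by have := P.two_lt; omega)
    (w := 2 * P.t) (fun y => by simpa using P.ψ_le 1 le_rfl (by have := P.two_lt; omega) y) hξ
  simp only [iteratedDeriv_zero, pow_zero, mul_one] at h1
  have hκ := P.κ_pos; have hκ' := P.κ_le'; have ht := P.t_pos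
  have h3 : (1 : ℝ) ≤ 3 ^ k := one_le_pow₀ (by norm_num)
  have h2 : (1 + 100 * P.κ) * P.A * P.μ * P.κ * P.t ≤ 2 * 1 * P.t := by
    have := P.one_le_A; have := P.μ_nonneg
    calc _ ≤ (1 + 100 * P.κ) * 2 * 2 * P.κ * P.t := by
          gcongr
          · exact P.A_le
          · exact P.μ_le
      _ = ((1 + 100 * P.κ) * 4 * P.κ) * P.t := by ring
      _ ≤ _ := mul_le_mul_of_nonneg_right (by nlinarith) ht.le
  nlinarith

theorem mul_abs_ψ_le (x : ℝ) : k * |P.ψ x| ≤ 1 := by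
  have := P.abs_ψ_le x
  have h0 := P.κ_pos
  have h3 : (1 : ℝ) ≤ 3 ^ k := one_le_pow₀ (by norm_num)
  calc k * |P.ψ x| ≤ k * (4 * 3 ^ k * P.t) := by gcongr
    _ ≤ k * (4 * 3 ^ k * P.κ) := by gcongr; exact P.t_le
    _ = (64 * k * 3 ^ k * P.κ) / 16 := by ring
    _ ≤ 1 := by linarith [P.κ_le]

theorem abs_exp_mul_sub_one_le {s : ℕ} (hs : s ≤ k) {v : ℝ} (hv : k * |v| ≤ 1) :
    |Real.exp v ^ s - 1| ≤ 2 * k * |v| := by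
  have h : |(s : ℝ) * v| ≤ k * |v| := by
    rw [abs_mul, Nat.abs_cast]; gcongr
  rw [← Real.exp_nat_mul]
  have := Real.abs_exp_sub_one_le (h.trans hv)
  linarith

theorem exp_pow_le {s : ℕ} (hs : s ≤ k) {v : ℝ} (hv : k * |v| ≤ 1) : Real.exp v ^ s ≤ 3 := by
  have := abs_exp_mul_sub_one_le hs hv
  linarith [le_abs_self (Real.exp v ^ s - 1)]

theorem mul_abs_χ_le (x : ℝ) : k * |P.χ x| ≤ 1 := by
  have h0 := P.κ_pos
  have h3 : (1 : ℝ) ≤ 3 ^ k := one_le_pow₀ (by norm_num)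
  calc k * |P.χ x| ≤ k * (2 * P.κ) := by gcongr; exact (P.abs_χ_le' x).trans P.two_κ_t_le
    _ ≤ 64 * k * 3 ^ k * P.κ := by
      have : (0 : ℝ) ≤ k * P.κ := by positivity
      nlinarith
    _ ≤ 1 := P.κ_le

/-- The two chain-rule errors and the two multiplier errors in the commutation relation. -/
theorem exists_bound_errors (k : ℕ) : ∃ C : ℝ, 1 ≤ C ∧ ∀ (B : ℝ) (P : CommutingPair k B) (Ω : ℝ),
    0 ≤ Ω → (∀ r ≤ k - 2, ∀ x, |iteratedDeriv r P.ψ x| * P.m x ^ r ≤ Ω * P.Y r) →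
    ∀ s < k - 2, ∀ x,
    |iteratedDeriv s (fun y => P.ψ (P.G y)) x - iteratedDeriv s P.ψ (P.G x)| * P.m x ^ s ≤
        C * Ω * P.κ * P.Y (s + 1) ∧
    |iteratedDeriv s (fun y => P.χ (P.F y)) x - iteratedDeriv s P.χ (P.F x)| * P.m x ^ s ≤
        C * Ω * P.κ * P.Y (s + 1) := by
  obtain ⟨C, hC, hcomp⟩ := exists_bound_iteratedDeriv_comp' k
  refine ⟨C * (2 * 9 ^ k * 2 ^ k) + 3 ^ k * (4 * k), ?_, fun B P Ω hΩ hψ s hs x => ?_⟩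
  · have h1 : (1 : ℝ) ≤ 9 ^ k := one_le_pow₀ (by norm_num)
    have h2 : (1 : ℝ) ≤ 2 ^ k := one_le_pow₀ (by norm_num)
    have : 1 ≤ C * (2 * 9 ^ k * 2 ^ k) := by
      calc (1 : ℝ) = 1 * (1 * 1 * 1) := by norm_num
        _ ≤ C * (2 * 9 ^ k * 2 ^ k) := by gcongr; norm_num
    have : (0 : ℝ) ≤ 3 ^ k * (4 * k) := by positivity
    linarith
  have hκ := P.κ_pos; have hκ' := P.κ_le'; have hm := P.m_pos x; have ht := P.t_pos
  have ht1 := P.t_le_one; have hA := P.one_le_A; have hA2 := P.A_le; have hμ := P.μ_nonneg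
  have hYs := P.Y_pos s
  have hY1 : P.t * P.Y s ≤ P.Y (s + 1) := by
    simpa using P.t_pow_mul_Y_le (s + 1) s (by omega)
  have hGx := P.abs_G_sub_le x
  have hFx := P.abs_F_sub_le' x
  have hmG := P.m_pos (P.G x); have hmF := P.m_pos (P.F x)
  have hκt : 2 * P.κ * P.t ≤ 1 := by linarith [P.two_κ_t_le]
  have h39 : (3 : ℝ) ^ k * 3 ≤ 9 ^ k := by
    calc (3 : ℝ) ^ k * 3 ≤ 3 ^ k * 3 ^ k := by
          gcongr
          calc (3 : ℝ) = 3 ^ 1 := by norm_num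
            _ ≤ 3 ^ k := pow_le_pow_right₀ (by norm_num) (by have := P.two_lt; omega)
      _ = 9 ^ k := by rw [← mul_pow]; norm_num
  have hψx : ∀ j ≤ k - 2, |iteratedDeriv j P.ψ x| ≤ Ω * P.Y j / P.m x ^ j := fun j hj => by
    rw [le_div_iff₀ (by positivity)]; exact hψ j hj x
  have hψG : ∀ j ≤ k - 2, |iteratedDeriv j P.ψ (P.G x)| ≤ 3 ^ k * (Ω * P.Y j) / P.m x ^ j :=
    fun j hj => by
      rw [le_div_iff₀ (by positivity)]
      calc _ ≤ |iteratedDeriv j P.ψ (P.G x)| * (3 ^ k * P.m (P.G x) ^ j) := by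
            gcongr; exact P.m_pow_le' hGx (by omega)
        _ = 3 ^ k * (|iteratedDeriv j P.ψ (P.G x)| * P.m (P.G x) ^ j) := by ring
        _ ≤ _ := mul_le_mul_of_nonneg_left (hψ j hj _) (by positivity)
  have hχF : ∀ j ≤ k - 2, |iteratedDeriv j P.χ (P.F x)| ≤
      3 ^ k * (2 * P.κ * P.t ^ (j + 1)) / P.m x ^ j := fun j hj => by
      rw [le_div_iff₀ (by positivity)]
      calc _ ≤ |iteratedDeriv j P.χ (P.F x)| * (3 ^ k * P.m (P.F x) ^ j) := by
            gcongr; exact P.m_pow_le' hFx (by omega)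
        _ = 3 ^ k * (|iteratedDeriv j P.χ (P.F x)| * P.m (P.F x) ^ j) := by ring
        _ ≤ 3 ^ k * (P.A * P.κ * P.t ^ (j + 1)) :=
          mul_le_mul_of_nonneg_left (P.χ_le j hj _) (by positivity)
        _ ≤ _ := by gcongr
  have hYj : ∀ j ≤ s, P.Y j ≤ P.Y s / P.t ^ s * P.t ^ j := fun j hj => by
    have h1 := P.t_pow_mul_Y_le s j hj
    have h2 : P.t ^ s = P.t ^ (s - j) * P.t ^ j := by rw [← pow_add]; congr 1; omega
    rw [h2, div_mul_eq_mul_div, le_div_iff₀ (by positivity)]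
    calc P.Y j * (P.t ^ (s - j) * P.t ^ j) = (P.t ^ (s - j) * P.Y j) * P.t ^ j := by ring
      _ ≤ _ := by gcongr
  have ms : (P.t / P.m x) ^ s * P.m x ^ s = P.t ^ s := by
    rw [← mul_pow]; congr 1; field_simp
  have hcE : Ω * P.κ * (P.t * P.Y s) ≤ Ω * P.κ * P.Y (s + 1) := by gcongr
  constructor
  · have e1 := hcomp s (by omega) P.ψ P.G P.χ (P.contDiff_ψ.of_le (by norm_cast; omega))
      (P.contDiff_χ.of_le (by norm_cast; omega)) P.hasDerivAt_G x (2 * P.κ * P.t) (P.t / P.m x)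
      (9 ^ k * (Ω * (P.Y s / P.t ^ s))) (by positivity) hκt (by positivity) (by positivity)
      (fun j h1 h2 => by
        have := hψG j (by omega)
        have h3 := exp_pow_le (k := k) (s := j) (by omega) (P.mul_abs_χ_le x)
        have := (P.Y_pos j).le
        calc _ ≤ 3 ^ k * (Ω * P.Y j) / P.m x ^ j * 3 := by gcongr
          _ ≤ 3 ^ k * (Ω * (P.Y s / P.t ^ s * P.t ^ j)) / P.m x ^ j * 3 := by
            gcongr; exact hYj j h2.le
          _ = (3 ^ k * 3) * (Ω * (P.Y s / P.t ^ s)) * (P.t / P.m x) ^ j := by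
            rw [div_pow]; ring
          _ ≤ _ := by gcongr)
      (fun j h1 h2 => by
        have h3 := P.χ_le j (by omega) x
        rw [div_pow, ← mul_div_assoc, le_div_iff₀ (by positivity)]
        calc _ ≤ P.A * P.κ * P.t ^ (j + 1) := h3
          _ ≤ 2 * P.κ * P.t ^ (j + 1) := by gcongr
          _ = _ := by ring)
    have e2 : |iteratedDeriv s P.ψ (P.G x) * Real.exp (P.χ x) ^ s - iteratedDeriv s P.ψ (P.G x)| ≤
        3 ^ k * (Ω * P.Y s) / P.m x ^ s * (4 * k * P.κ * P.t) := by
      rw [← mul_sub_one, abs_mul]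
      have h3 := abs_exp_mul_sub_one_le (k := k) (s := s) (by omega) (P.mul_abs_χ_le x)
      have h4 := P.abs_χ_le' x
      gcongr
      · exact hψG s (by omega)
      · calc _ ≤ 2 * k * (2 * P.κ * P.t) := h3.trans (by gcongr)
          _ = _ := by ring
    have e3 := abs_sub_le (iteratedDeriv s (fun y => P.ψ (P.G y)) x)
      (iteratedDeriv s P.ψ (P.G x) * Real.exp (P.χ x) ^ s) (iteratedDeriv s P.ψ (P.G x))
    calc _ ≤ (C * (2 * P.κ * P.t) * (9 ^ k * (Ω * (P.Y s / P.t ^ s))) * (P.t / P.m x) ^ s +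
          3 ^ k * (Ω * P.Y s) / P.m x ^ s * (4 * k * P.κ * P.t)) * P.m x ^ s := by
          gcongr; linarith
      _ = C * (2 * P.κ * P.t) * (9 ^ k * (Ω * (P.Y s / P.t ^ s))) * P.t ^ s +
          3 ^ k * (Ω * P.Y s) * (4 * k * P.κ * P.t) := by
          rw [add_mul, mul_assoc _ _ (P.m x ^ s), ms]; field_simp
      _ = (C * (2 * 9 ^ k) * 1 + 3 ^ k * (4 * k)) * (Ω * P.κ * (P.t * P.Y s)) := by field_simp
      _ ≤ (C * (2 * 9 ^ k) * 2 ^ k + 3 ^ k * (4 * k)) * (Ω * P.κ * P.Y (s + 1)) := by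
          gcongr; exact one_le_pow₀ (by norm_num)
      _ = _ := by ring
  · set ε := min 1 (Ω * (P.Y s / P.t ^ s)) with hε
    have hε0 : 0 ≤ ε := le_min zero_le_one (by positivity)
    have e1 := hcomp s (by omega) P.χ P.F P.ψ (P.contDiff_χ.of_le (by norm_cast; omega))
      (P.contDiff_ψ.of_le (by norm_cast; omega)) P.hasDerivAt_F x ε (2 * P.t / P.m x)
      (9 ^ k * (2 * P.κ * P.t)) hε0 (min_le_left _ _) (by positivity) (by positivity)
      (fun j h1 h2 => by
        have := hχF j (by omega)
        have h3 := exp_pow_le (k := k) (s := j) (by omega) (P.mul_abs_ψ_le x)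
        calc _ ≤ 3 ^ k * (2 * P.κ * P.t ^ (j + 1)) / P.m x ^ j * 3 := by gcongr
          _ = (3 ^ k * 3) * (2 * P.κ * P.t) * (P.t / P.m x) ^ j := by
            rw [div_pow]; ring
          _ ≤ 9 ^ k * (2 * P.κ * P.t) * (2 * P.t / P.m x) ^ j := by gcongr; linarith)
      (fun j h1 h2 => by
        rw [div_pow, ← mul_div_assoc, le_div_iff₀ (by positivity), mul_pow]
        have h2j : (2 : ℝ) ≤ 2 ^ j := by
          calc (2 : ℝ) = 2 ^ 1 := by norm_num
            _ ≤ 2 ^ j := pow_le_pow_right₀ (by norm_num) h1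
        rcases min_cases (1 : ℝ) (Ω * (P.Y s / P.t ^ s)) with ⟨h, -⟩ | ⟨h, -⟩
        · rw [hε, h, one_mul]
          exact (P.ψ_le j h1 (by omega) x).trans (by gcongr)
        · rw [hε, h]
          calc _ ≤ Ω * P.Y j := hψ j (by omega) x
            _ ≤ Ω * (P.Y s / P.t ^ s * P.t ^ j) := by gcongr; exact hYj j h2.le
            _ = Ω * (P.Y s / P.t ^ s) * (1 * P.t ^ j) := by ring
            _ ≤ _ := by gcongr; linarith)
    have e2 : |iteratedDeriv s P.χ (P.F x) * Real.exp (P.ψ x) ^ s - iteratedDeriv s P.χ (P.F x)| ≤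
        3 ^ k * (2 * P.κ * P.t ^ (s + 1)) / P.m x ^ s * (2 * k * (Ω * P.Y 0)) := by
      rw [← mul_sub_one, abs_mul]
      have h3 := abs_exp_mul_sub_one_le (k := k) (s := s) (by omega) (P.mul_abs_ψ_le x)
      have h4 := hψ 0 (by omega) x
      simp only [iteratedDeriv_zero, pow_zero, mul_one] at h4
      gcongr
      · exact hχF s (by omega)
      · exact h3.trans (by gcongr)
    have e3 := abs_sub_le (iteratedDeriv s (fun y => P.χ (P.F y)) x)
      (iteratedDeriv s P.χ (P.F x) * Real.exp (P.ψ x) ^ s) (iteratedDeriv s P.χ (P.F x))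
    have ms2 : (2 * P.t / P.m x) ^ s * P.m x ^ s = 2 ^ s * P.t ^ s := by
      rw [← mul_pow, ← mul_pow]; congr 1; field_simp
    have hY0 : P.t ^ (s + 1) * P.Y 0 ≤ P.Y (s + 1) := P.t_pow_mul_Y_le (s + 1) 0 (by omega)
    calc _ ≤ (C * ε * (9 ^ k * (2 * P.κ * P.t)) * (2 * P.t / P.m x) ^ s +
          3 ^ k * (2 * P.κ * P.t ^ (s + 1)) / P.m x ^ s * (2 * k * (Ω * P.Y 0))) * P.m x ^ s := by
          gcongr; linarith
      _ = C * ε * (9 ^ k * (2 * P.κ * P.t)) * (2 ^ s * P.t ^ s) +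
          3 ^ k * (2 * P.κ) * (2 * k * Ω) * (P.t ^ (s + 1) * P.Y 0) := by
          rw [add_mul, mul_assoc _ _ (P.m x ^ s), ms2]; field_simp
      _ ≤ C * (Ω * (P.Y s / P.t ^ s)) * (9 ^ k * (2 * P.κ * P.t)) * (2 ^ k * P.t ^ s) +
          3 ^ k * (2 * P.κ) * (2 * k * Ω) * P.Y (s + 1) := by
          gcongr
          · exact min_le_right _ _
          · norm_num
          · omega
      _ = (C * (2 * 9 ^ k * 2 ^ k)) * (Ω * P.κ * (P.t * P.Y s)) +
          3 ^ k * (4 * k) * (Ω * P.κ * P.Y (s + 1)) := by field_simp; ring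
      _ ≤ (C * (2 * 9 ^ k * 2 ^ k)) * (Ω * P.κ * P.Y (s + 1)) +
          3 ^ k * (4 * k) * (Ω * P.κ * P.Y (s + 1)) := by gcongr
      _ = _ := by ring

/-- There is a point `ξ` near `x` where `D^r ψ` is controlled by the commutation relation. -/
theorem exists_bound_near (k : ℕ) : ∃ C : ℝ, 1 ≤ C ∧ ∀ (B : ℝ) (P : CommutingPair k B) (Ω : ℝ),
    0 ≤ Ω → (∀ r ≤ k - 2, ∀ x, |iteratedDeriv r P.ψ x| * P.m x ^ r ≤ Ω * P.Y r) →
    ∀ r ≤ k - 2, ∀ x, ∃ ξ ∈ Set.uIcc x (P.G x), |iteratedDeriv r P.ψ ξ| * P.m x ^ r ≤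
      (1 + C * P.κ) * P.A * P.μ * P.κ * P.t ^ (r + 1) + C * Ω * P.κ * P.Y r := by
  obtain ⟨C, hC, herr⟩ := exists_bound_errors k
  refine ⟨100 + 3 ^ k * 16 + 2 * C, by have : (0 : ℝ) ≤ 3 ^ k * 16 := by positivity
                                       linarith, fun B P Ω hΩ hψ r hr x => ?_⟩
  have h3k : (0 : ℝ) ≤ 3 ^ k * 16 := by positivity
  have hκ := P.κ_pos; have hκ' := P.κ_le'; have hm := P.m_pos x; have ht := P.t_pos
  have ht1 := P.t_le_one; have hA := P.one_le_A; have hA2 := P.A_le; have hμ := P.μ_nonneg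
  have hYr := P.Y_pos r
  rcases Nat.eq_zero_or_pos r with rfl | hr0
  · obtain ⟨ξ, hξ, h⟩ := P.exists_abs_ψ_le x
    refine ⟨ξ, hξ, ?_⟩
    simp only [iteratedDeriv_zero, pow_zero, mul_one, zero_add, pow_one]
    calc _ ≤ (1 + 100 * P.κ) * P.A * P.μ * P.κ * P.t + 0 := by rw [add_zero]; exact h
      _ ≤ _ := by
        gcongr
        · linarith
        · positivity
  obtain ⟨s, rfl⟩ : ∃ s, r = s + 1 := ⟨r - 1, by omega⟩
  obtain ⟨h1, h2⟩ := herr B P Ω hΩ hψ s (by omega) x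
  obtain ⟨ξ, hξ, e⟩ := exists_mem_uIcc_deriv_eq (fun z => hasDerivAt_iteratedDeriv P.contDiff_ψ
    (r := s) (by omega) z) x (P.G x)
  refine ⟨ξ, hξ, ?_⟩
  have hco : iteratedDeriv s (fun y => P.ψ (P.G y)) x + iteratedDeriv s P.χ x =
      iteratedDeriv s (fun y => P.χ (P.F y)) x + iteratedDeriv s P.ψ x := by
    have hψ' : ContDiff ℝ s P.ψ := P.contDiff_ψ.of_le (by norm_cast; omega)
    have hχ' : ContDiff ℝ s P.χ := P.contDiff_χ.of_le (by norm_cast; omega)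
    have hG : ContDiff ℝ s P.G := by
      have : ContDiff ℝ ((s : ℕ) + 1 : ℕ) P.G := by
        rw [Nat.cast_add, Nat.cast_one, contDiff_succ_iff_deriv]
        refine ⟨fun z => (P.hasDerivAt_G z).differentiableAt, by simp, ?_⟩
        rw [show deriv P.G = fun z => Real.exp (P.χ z) from funext fun z => (P.hasDerivAt_G z).deriv]
        exact Real.contDiff_exp.comp hχ'
      exact this.of_le (by norm_cast; omega)
    have hF : ContDiff ℝ s P.F := by
      have : ContDiff ℝ ((s : ℕ) + 1 : ℕ) P.F := by
        rw [Nat.cast_add, Nat.cast_one, contDiff_succ_iff_deriv]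
        refine ⟨fun z => (P.hasDerivAt_F z).differentiableAt, by simp, ?_⟩
        rw [show deriv P.F = fun z => Real.exp (P.ψ z) from funext fun z => (P.hasDerivAt_F z).deriv]
        exact Real.contDiff_exp.comp hψ'
      exact this.of_le (by norm_cast; omega)
    have hψG : ContDiff ℝ s fun y => P.ψ (P.G y) := hψ'.comp hG
    have hχF : ContDiff ℝ s fun y => P.χ (P.F y) := hχ'.comp hF
    rw [← iteratedDeriv_fun_add hψG.contDiffAt hχ'.contDiffAt,
      ← iteratedDeriv_fun_add hχF.contDiffAt hψ'.contDiffAt]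
    congr 1
    exact funext P.cocycle
  have hmain : |iteratedDeriv s P.χ (P.F x) - iteratedDeriv s P.χ x| * P.m x ^ s ≤
      (1 + 3 ^ k * 16 * P.κ) * P.A * P.μ * P.κ * P.t ^ (s + 1 + 1) := by
    have h4 := abs_sub_le_of_abs_deriv_le (fun z => hasDerivAt_iteratedDeriv P.contDiff_χ
      (r := s) (by omega) z)
      (M := (1 + 3 ^ k * 16 * P.κ) * (P.A * P.κ * P.t ^ (s + 1 + 1)) / P.m x ^ (s + 1)) x (P.F x)
      fun z hz => by
        have h5 : |z - x| ≤ 2 * P.m x :=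
          (Set.abs_sub_left_of_mem_uIcc hz).trans (P.abs_F_sub_le' x)
        have h6 := P.m_pow_le h5 (r := s + 1) (by omega)
        rw [le_div_iff₀ (by positivity)]
        calc _ ≤ |iteratedDeriv (s + 1) P.χ z| * ((1 + 3 ^ k * 16 * P.κ) * P.m z ^ (s + 1)) := by
              gcongr
          _ = (1 + 3 ^ k * 16 * P.κ) * (|iteratedDeriv (s + 1) P.χ z| * P.m z ^ (s + 1)) := by ring
          _ ≤ _ := mul_le_mul_of_nonneg_left (P.χ_le (s + 1) hr z) (by positivity)
    have h7 := P.abs_F_sub_le x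
    calc _ ≤ (1 + 3 ^ k * 16 * P.κ) * (P.A * P.κ * P.t ^ (s + 1 + 1)) / P.m x ^ (s + 1) *
          (P.μ * P.m x) * P.m x ^ s := by gcongr; exact h4.trans (by gcongr)
      _ = _ := by field_simp; try ring
  have e4 : |iteratedDeriv (s + 1) P.ψ ξ| * P.m x ^ (s + 1) =
      |iteratedDeriv s P.ψ (P.G x) - iteratedDeriv s P.ψ x| * P.m x ^ s := by
    rw [e, abs_mul, ← P.m_eq, pow_succ']; ring
  have e5 : |iteratedDeriv s P.ψ (P.G x) - iteratedDeriv s P.ψ x| ≤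
      |iteratedDeriv s (fun y => P.ψ (P.G y)) x - iteratedDeriv s P.ψ (P.G x)| +
      |iteratedDeriv s (fun y => P.χ (P.F y)) x - iteratedDeriv s P.χ (P.F x)| +
      |iteratedDeriv s P.χ (P.F x) - iteratedDeriv s P.χ x| := by
    rw [abs_le]
    constructor <;>
    linarith [le_abs_self (iteratedDeriv s (fun y => P.ψ (P.G y)) x - iteratedDeriv s P.ψ (P.G x)),
      neg_abs_le (iteratedDeriv s (fun y => P.ψ (P.G y)) x - iteratedDeriv s P.ψ (P.G x)),
      le_abs_self (iteratedDeriv s (fun y => P.χ (P.F y)) x - iteratedDeriv s P.χ (P.F x)),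
      neg_abs_le (iteratedDeriv s (fun y => P.χ (P.F y)) x - iteratedDeriv s P.χ (P.F x)),
      le_abs_self (iteratedDeriv s P.χ (P.F x) - iteratedDeriv s P.χ x),
      neg_abs_le (iteratedDeriv s P.χ (P.F x) - iteratedDeriv s P.χ x)]
  rw [e4]
  calc _ ≤ (|iteratedDeriv s (fun y => P.ψ (P.G y)) x - iteratedDeriv s P.ψ (P.G x)| +
      |iteratedDeriv s (fun y => P.χ (P.F y)) x - iteratedDeriv s P.χ (P.F x)| +
      |iteratedDeriv s P.χ (P.F x) - iteratedDeriv s P.χ x|) * P.m x ^ s := by gcongr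
    _ ≤ (1 + 3 ^ k * 16 * P.κ) * P.A * P.μ * P.κ * P.t ^ (s + 1 + 1) +
        2 * C * Ω * P.κ * P.Y (s + 1) := by rw [add_mul, add_mul]; linarith
    _ ≤ _ := by
      gcongr
      · linarith
      · linarith

end CommutingPair

namespace CommutingPair

theorem exists_bound_descent (k : ℕ) (B : ℝ) (hB : 1 ≤ B) (i : ℕ) : ∃ C : ℝ, 1 ≤ C ∧
    ∀ (P : CommutingPair k B) (Ω : ℝ), 0 ≤ Ω →
    (∀ r ≤ k - 2, ∀ x, |iteratedDeriv r P.ψ x| * P.m x ^ r ≤ Ω * P.Y r) →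
    ∀ r ≤ k - 2, k - 1 ≤ r + i → ∀ x, |iteratedDeriv r P.ψ x| * P.m x ^ r ≤
      (1 + C * P.κ) * P.A * P.μ * P.κ * P.t ^ (r + 1) + C * Ω * P.κ * P.Y r + C * P.E := by
  obtain ⟨D, hD, hnear⟩ := exists_bound_near k
  induction i with
  | zero => exact ⟨1, le_rfl, fun P Ω _ _ r hr hi => by have := P.two_lt; omega⟩
  | succ i ih =>
    obtain ⟨C, hC, ih⟩ := ih
    have h3 : (1 : ℝ) ≤ 3 ^ k := one_le_pow₀ (by norm_num)
    refine ⟨D + 3 ^ k * (C + B + 1), by nlinarith, fun P Ω hΩ hψ r hr hi x => ?_⟩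
    have hκ := P.κ_pos; have hκ' := P.κ_le'; have hm := P.m_pos x; have ht := P.t_pos
    have hA := P.one_le_A; have hμ := P.μ_nonneg; have hE := P.E_pos
    have hYr := P.Y_pos r
    have hk := P.two_lt
    have hw : ∀ y, |iteratedDeriv (r + 1) P.ψ y| * P.m y ^ (r + 1) ≤
        (1 + C * P.κ) * P.A * P.μ * P.κ * P.t ^ (r + 2) + C * Ω * P.κ * P.Y (r + 1) + (C + B) * P.E := by
      intro y
      have := P.Y_pos (r + 1)
      rcases (show r + 1 ≤ k - 1 by omega).lt_or_eq with h | h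
      · refine (ih P Ω hΩ hψ (r + 1) (by omega) (by omega) y).trans ?_
        gcongr
        linarith
      · refine (h ▸ P.ψ_top_le y).trans ?_
        have h1 : 0 ≤ (1 + C * P.κ) * P.A * P.μ * P.κ * P.t ^ (r + 2) := by positivity
        have h2 : 0 ≤ C * Ω * P.κ * P.Y (r + 1) := by positivity
        have h3 : 0 ≤ C * P.E := by positivity
        linarith [add_mul C B P.E]
    obtain ⟨ξ, hξ, h⟩ := hnear B P Ω hΩ hψ r hr x
    have h1 := P.abs_iteratedDeriv_sub_le (r := r) (by omega) hw hξ
    have hY : P.Y (r + 1) ≤ P.Y r := P.Y_anti (by omega)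
    have ht2 : (1 + C * P.κ) * P.A * P.μ * P.κ * P.t ^ (r + 2) ≤
        (C + 1) * P.κ * P.A * P.μ * P.κ * P.t ^ (r + 1) := by
      have : (1 + C * P.κ) * P.t ≤ (C + 1) * P.κ := by
        calc _ ≤ (1 + C * 1) * P.κ := by gcongr; linarith; exact P.t_le
          _ = _ := by ring
      calc _ = ((1 + C * P.κ) * P.t) * (P.A * P.μ * P.κ * P.t ^ (r + 1)) := by ring
        _ ≤ ((C + 1) * P.κ) * (P.A * P.μ * P.κ * P.t ^ (r + 1)) := by gcongr
        _ = _ := by ring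
    calc _ ≤ ((1 + D * P.κ) * P.A * P.μ * P.κ * P.t ^ (r + 1) + D * Ω * P.κ * P.Y r) +
        3 ^ k * ((C + 1) * P.κ * P.A * P.μ * P.κ * P.t ^ (r + 1) + C * Ω * P.κ * P.Y r +
          (C + B) * P.E) := by
          refine h1.trans (add_le_add h (mul_le_mul_of_nonneg_left ?_ (by positivity)))
          gcongr
      _ = (1 + (D + 3 ^ k * (C + 1)) * P.κ) * P.A * P.μ * P.κ * P.t ^ (r + 1) +
          (D + 3 ^ k * C) * Ω * P.κ * P.Y r + (3 ^ k * (C + B)) * P.E := by ring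
      _ ≤ _ := by
        gcongr (1 + (_ + _ * ?_) * P.κ) * P.A * P.μ * P.κ * P.t ^ (r + 1) + (_ + _ * ?_) * Ω * P.κ * P.Y r +
          ?_ * P.E
        · linarith
        · linarith
        · nlinarith

/-- Control of the log-derivative of the second generator of a commuting pair. -/
theorem exists_bound (k : ℕ) (B : ℝ) (hB : 1 ≤ B) : ∃ C κ₀ : ℝ, 1 ≤ C ∧ 0 < κ₀ ∧
    ∀ P : CommutingPair k B, P.κ ≤ κ₀ → ∀ r ≤ k - 2, ∀ x,
      |iteratedDeriv r P.ψ x| * P.m x ^ r ≤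
        (1 + C * P.κ) * P.A * P.μ * P.κ * P.t ^ (r + 1) + C * P.E := by
  obtain ⟨C, hC, h⟩ := exists_bound_descent k B hB k
  have h' := fun (P : CommutingPair k B) Ω hΩ hψ r (hr : r ≤ k - 2) =>
    h P Ω hΩ hψ r hr (by omega)
  set Ω : ℝ := 2 * (3 * C + 2) with hΩ
  refine ⟨C + C * Ω + C * Ω, 1 / (2 * C), by nlinarith, by positivity, fun P hκ₀ r hr x => ?_⟩
  have hκ := P.κ_pos; have hκ' := P.κ_le'; have ht := P.t_pos
  have hA := P.one_le_A; have hA2 := P.A_le; have hμ := P.μ_nonneg; have hE := P.E_pos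
  have hCκ : C * P.κ ≤ 1 / 2 := by
    calc C * P.κ ≤ C * (1 / (2 * C)) := by gcongr
      _ = 1 / 2 := by field_simp
  have hbdd : BddAbove (Set.range fun z : Set.Iic (k - 2) × ℝ =>
      |iteratedDeriv (z.1 : ℕ) P.ψ z.2| * P.m z.2 ^ (z.1 : ℕ) / P.Y z.1) := by
    refine ⟨(4 * 3 ^ k * P.t + 2) / P.E, ?_⟩
    rintro _ ⟨⟨⟨j, hj⟩, y⟩, rfl⟩
    have hYj := P.Y_pos j
    have hm := P.m_pos y
    have ht1 := P.t_le_one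
    have h1 : |iteratedDeriv j P.ψ y| * P.m y ^ j ≤ 4 * 3 ^ k * P.t + 2 := by
      rcases Nat.eq_zero_or_pos j with rfl | hj0
      · simpa using (P.abs_ψ_le y).trans (by linarith)
      · have h2 : P.t ^ j ≤ 1 := pow_le_one₀ ht.le ht1
        have h3 : 0 ≤ 4 * 3 ^ k * P.t := by positivity
        linarith [P.ψ_le j hj0 hj y]
    have h2 : P.E ≤ P.Y j := by
      have : 0 ≤ P.μ * P.κ * P.t ^ (j + 1) := by positivity
      unfold Y; linarith
    exact div_le_div₀ (by positivity) h1 hE h2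
  have : Nonempty (Set.Iic (k - 2) × ℝ) := ⟨⟨⟨0, Nat.zero_le _⟩, 0⟩⟩
  have hbd := le_div_of_bootstrap hbdd (a := 3 * C + 2) (ρ := 1 / 2) (by norm_num) (by
    rintro M hM ⟨⟨j, hj⟩, y⟩
    have hM0 : 0 ≤ M := by
      refine le_trans ?_ (hM ⟨⟨j, hj⟩, y⟩)
      have := P.Y_pos j; have := P.m_pos y
      positivity
    have hYj := P.Y_pos j
    have h1 := h' P M hM0 (fun i hi z => by
      have := hM ⟨⟨i, hi⟩, z⟩
      rwa [div_le_iff₀ (P.Y_pos i)] at this) j hj y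
    show _ / _ ≤ _
    rw [div_le_iff₀ hYj]
    have hEY : P.E + P.μ * P.κ * P.t ^ (j + 1) = P.Y j := rfl
    have h3 : 0 ≤ P.μ * P.κ * P.t ^ (j + 1) := by positivity
    have h4 : (1 + C * P.κ) * P.A ≤ 3 := by nlinarith
    calc _ ≤ _ := h1
      _ = ((1 + C * P.κ) * P.A) * (P.μ * P.κ * P.t ^ (j + 1)) + (C * P.κ) * (M * P.Y j) + C * P.E := by
        ring
      _ ≤ (3 * C + 2) * (P.μ * P.κ * P.t ^ (j + 1)) + 1 / 2 * (M * P.Y j) + (3 * C + 2) * P.E := by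
        gcongr
        · linarith
        · linarith
      _ = _ := by rw [← hEY]; ring)
  have hψ : ∀ r ≤ k - 2, ∀ x, |iteratedDeriv r P.ψ x| * P.m x ^ r ≤ Ω * P.Y r := fun i hi z => by
    have := hbd ⟨⟨i, hi⟩, z⟩
    rw [div_le_iff₀ (P.Y_pos i)] at this
    refine this.trans (le_of_eq ?_)
    rw [hΩ]; ring
  have h1 := h' P Ω (by positivity) hψ r hr x
  have h3 : 0 ≤ P.μ * P.κ * P.t ^ (r + 1) := by positivity
  calc _ ≤ _ := h1
    _ = (1 + C * P.κ) * P.A * P.μ * P.κ * P.t ^ (r + 1) +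
        (C * Ω * P.κ) * 1 * (P.μ * P.κ * P.t ^ (r + 1)) + (C + C * P.κ * Ω) * P.E := by
      unfold Y; ring
    _ ≤ (1 + C * P.κ) * P.A * P.μ * P.κ * P.t ^ (r + 1) +
        (C * Ω * P.κ) * P.A * (P.μ * P.κ * P.t ^ (r + 1)) + (C + C * 1 * Ω) * P.E := by
      gcongr
      linarith
    _ = (1 + (C + C * Ω) * P.κ) * P.A * P.μ * P.κ * P.t ^ (r + 1) + (C + C * Ω) * P.E := by ring
    _ ≤ _ := by
      gcongr
      · have : 0 ≤ C * Ω := by positivity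
        linarith
      · have : 0 ≤ C * Ω := by positivity
        linarith

end CommutingPair

namespace SmoothLift

variable {k : ℕ} {α : ℝ} (S : SmoothLift k α)

/-- Scale-invariant bounds at the `n`-th renormalization level. -/
structure Bounds (n : ℕ) (A N κ t E : ℝ) : Prop where
  ψ_le : ∀ r ≤ k - 2, ∀ x, |iteratedDeriv r (S.ψ n) x| * S.m n x ^ r ≤ A * κ * t ^ (r + 1)
  u_le : ∀ r, 1 ≤ r → r ≤ k - 2 → ∀ l ≤ S.c.q (n + 1), ∀ x,
    |iteratedDeriv r (S.u l) x| * S.m n x ^ r ≤ A * t ^ r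
  u_top_le : ∀ l ≤ S.c.q (n + 1), ∀ x,
    |iteratedDeriv (k - 1) (S.u l) x| * S.m n x ^ (k - 2) ≤ A * E * S.L l x
  m_le : ∀ x, S.m n x ≤ A * N

/-- Smallness conditions on the parameters of `SmoothLift.Bounds`. -/
structure _root_.Admissible (k : ℕ) (A κ t E : ℝ) : Prop where
  two_lt : 2 < k
  one_le_A : 1 ≤ A
  A_le : A ≤ 2
  t_pos : 0 < t
  t_le : t ≤ κ
  κ_le : 64 * k * 3 ^ k * κ ≤ 1
  E_pos : 0 < E

variable {S} {n : ℕ} {A N κ t E : ℝ}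

theorem cocycle (S : SmoothLift k α) (n : ℕ) (x : ℝ) :
    S.ψ (n + 1) (S.F n x) + S.ψ n x = S.ψ n (S.F (n + 1) x) + S.ψ (n + 1) x := by
  have h : ∀ i j, S.u (S.c.q i) (S.F j x) = S.u (S.c.q i) (S.f^[S.c.q j] x) := fun i j => by
    have := S.u_add_int (S.c.q i) (S.F j x) (S.c.p j)
    rw [← this, F, sub_add_cancel]
  rw [ψ, ψ, h, h, add_comm, ← u_add, add_comm (S.u _ _) (S.u (S.c.q (n + 1)) x), ← u_add, add_comm]

/-- Consecutive return maps form a commuting pair. -/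
noncomputable def Bounds.pair (h : S.Bounds n A N κ t E) (ha : Admissible k A κ t E) {V : ℝ}
    (hV0 : 0 ≤ V) (hV : ∀ x y, |S.φ y - S.φ x| ≤ V * |y - x|) (μ : ℝ) (hμ2 : μ ≤ 2)
    (hμ : ∀ x, S.m (n + 1) x ≤ μ * S.m n x) : CommutingPair k (2 * Real.exp V) where
  G := S.F n
  F := S.F (n + 1)
  χ := S.ψ n
  ψ := S.ψ (n + 1)
  m := S.m n
  A := A
  κ := κ
  t := t
  E := E
  μ := μ
  two_lt := ha.two_lt
  one_le_B := by linarith [Real.one_le_exp hV0]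
  hasDerivAt_G := S.hasDerivAt_F n
  hasDerivAt_F := S.hasDerivAt_F (n + 1)
  contDiff_χ := S.contDiff_ψ n
  contDiff_ψ := S.contDiff_ψ (n + 1)
  comm := fun x => S.F_comm _ _ x
  cocycle := S.cocycle n
  m_eq := fun _ => rfl
  m_pos := S.m_pos n
  abs_F_sub_le := hμ
  one_le_A := ha.one_le_A
  A_le := ha.A_le
  t_pos := ha.t_pos
  t_le := ha.t_le
  κ_le := ha.κ_le
  E_pos := ha.E_pos
  μ_nonneg := by
    have h1 := (S.m_pos (n + 1) 0).trans_le (hμ 0)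
    exact (pos_of_mul_pos_left h1 (S.m_pos n 0).le).le
  μ_le := hμ2
  χ_le := h.ψ_le
  ψ_le := fun r h1 h2 x => (h.u_le r h1 h2 _ le_rfl x).trans
    (mul_le_mul_of_nonneg_right ha.A_le (pow_nonneg ha.t_pos.le r))
  ψ_top_le := fun x => by
    have h1 := h.u_top_le _ le_rfl x
    have h2 := S.L_mul_m_le hV0 hV (n := n) le_rfl x
    have hm := S.m_pos n x
    have hE := ha.E_pos
    have hk := ha.two_lt
    have e : S.m n x ^ (k - 1) = S.m n x ^ (k - 2) * S.m n x := by rw [← pow_succ]; congr 1; omega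
    calc _ = |iteratedDeriv (k - 1) (S.u (S.c.q (n + 1))) x| * S.m n x ^ (k - 2) * S.m n x := by
          rw [e, mul_assoc]; rfl
      _ ≤ A * E * S.L (S.c.q (n + 1)) x * S.m n x := by gcongr
      _ = A * E * (S.L (S.c.q (n + 1)) x * S.m n x) := by ring
      _ ≤ 2 * E * Real.exp V := by
        have := ha.one_le_A; have := ha.A_le; have := S.L_nonneg (S.c.q (n + 1)) x
        gcongr
      _ = _ := by ring

theorem Bounds.m_succ_le_two_mul (h : S.Bounds n A N κ t E) (ha : Admissible k A κ t E) (x : ℝ) :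
    S.m (n + 1) x ≤ 2 * S.m n x := by
  obtain ⟨ξ, -, e⟩ := S.exists_m_F_eq (n + 1) n x
  have h1 := S.m_succ_F_le n x
  have h2 : |S.ψ n ξ| ≤ 1 / 2 := by
    have h3 := h.ψ_le 0 (Nat.zero_le _) ξ
    simp only [iteratedDeriv_zero, pow_zero, mul_one, zero_add, pow_one] at h3
    have hk : (3 : ℝ) ≤ k := by exact_mod_cast ha.two_lt
    have h4 : (1 : ℝ) ≤ 3 ^ k := one_le_pow₀ (by norm_num)
    have ht := ha.t_pos; have htκ := ha.t_le; have hA := ha.one_le_A; have hA2 := ha.A_le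
    have hκ : 0 < κ := ht.trans_le htκ
    have h5 : 192 * κ ≤ 1 := by
      calc 192 * κ = 64 * 3 * 1 * κ := by ring
        _ ≤ 64 * k * 3 ^ k * κ := by gcongr
        _ ≤ 1 := ha.κ_le
    calc _ ≤ A * κ * t := h3
      _ ≤ 2 * κ * 1 := by gcongr; linarith
      _ ≤ _ := by linarith
  have h6 : 1 / 2 ≤ Real.exp (S.ψ n ξ) := by
    have := Real.add_one_le_exp (S.ψ n ξ)
    linarith [(abs_le.1 h2).1]
  have hm := S.m_pos (n + 1) x
  nlinarith

theorem _root_.Real.exp_le_one_add_two_mul {x : ℝ} (h0 : 0 ≤ x) (h1 : x ≤ 1) :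
    Real.exp x ≤ 1 + 2 * x := by
  have := Real.abs_exp_sub_one_le (x := x) (by rwa [abs_of_nonneg h0])
  rw [abs_of_nonneg h0] at this
  linarith [le_abs_self (Real.exp x - 1)]

/-- The ratio of consecutive displacements is nearly invariant along short orbits. -/
theorem Bounds.ratio_iterate_le (h : S.Bounds n A N κ t E) (ha : Admissible k A κ t E) {V : ℝ}
    (hV0 : 0 ≤ V) (hV : ∀ x y, |S.φ y - S.φ x| ≤ V * |y - x|) {l : ℕ} (hl : l ≤ S.c.q (n + 1))
    (x : ℝ) : S.m (n + 1) (S.f^[l] x) / S.m n (S.f^[l] x) ≤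
      Real.exp (12 * t) * (S.m (n + 1) x / S.m n x) := by
  set P := h.pair ha hV0 hV 2 le_rfl (h.m_succ_le_two_mul ha)
  obtain ⟨ξ, hξ, e1⟩ := S.exists_m_iterate_eq (n + 1) l x
  obtain ⟨ζ, hζ, e2⟩ := S.exists_m_iterate_eq n l x
  have hm := S.m_pos n x
  have hm1 := S.m_pos (n + 1) x
  have hξ' : |ξ - x| ≤ 2 * S.m n x := (S.abs_sub_le_m hξ).trans (h.m_succ_le_two_mul ha x)
  have hζ' : |ζ - x| ≤ S.m n x := S.abs_sub_le_m hζ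
  have hk := ha.two_lt
  have ht := ha.t_pos
  have h1 := abs_sub_le_of_abs_deriv_le (fun z => hasDerivAt_iteratedDeriv (S.contDiff_u l)
    (r := 0) (by omega) z) (M := 4 * t / S.m n x) ζ ξ fun z hz => by
      have hz' : |z - x| ≤ 2 * P.m x := by
        show |z - x| ≤ 2 * S.m n x
        rcases Set.mem_uIcc.1 hz with ⟨u1, u2⟩ | ⟨u1, u2⟩ <;>
        · rw [abs_le] at *
          constructor <;> linarith [hξ'.1, hξ'.2, hζ'.1, hζ'.2]
      have h3 : S.m n x ≤ (1 + 16 * κ) * S.m n z := P.m_le hz'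
      have h4 : 192 * κ ≤ 1 := P.κ_le'
      have h5 := h.u_le 1 le_rfl (by omega) l hl z
      have hmz := S.m_pos n z
      rw [le_div_iff₀ hm]
      simp only [pow_one] at h5
      calc _ ≤ |iteratedDeriv 1 (S.u l) z| * (2 * S.m n z) := by gcongr; nlinarith
        _ = 2 * (|iteratedDeriv 1 (S.u l) z| * S.m n z) := by ring
        _ ≤ 2 * (A * t) := by linarith
        _ ≤ 2 * (2 * t) := by have := ha.A_le; gcongr
        _ = 4 * t := by ring
  simp only [iteratedDeriv_zero] at h1
  have h2 : |ξ - ζ| ≤ 3 * S.m n x := by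
    rw [abs_le] at *
    constructor <;> linarith [hξ'.1, hξ'.2, hζ'.1, hζ'.2]
  have h3 : S.u l ξ ≤ 12 * t + S.u l ζ := by
    have : 4 * t / S.m n x * |ξ - ζ| ≤ 12 * t := by
      calc _ ≤ 4 * t / S.m n x * (3 * S.m n x) := by gcongr
        _ = _ := by field_simp; ring
    linarith [le_abs_self (S.u l ξ - S.u l ζ)]
  rw [e1, e2, div_le_iff₀ (by positivity)]
  calc Real.exp (S.u l ξ) * S.m (n + 1) x ≤ Real.exp (12 * t + S.u l ζ) * S.m (n + 1) x := by gcongr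
    _ = _ := by rw [Real.exp_add]; field_simp

/-- Comparison of the ratios of consecutive displacements at two arbitrary points. -/
theorem exists_ratio_le (S : SmoothLift k α) (hk : 2 < k) : ∃ C κ₀ : ℝ, 1 ≤ C ∧ 0 < κ₀ ∧
    ∀ (n : ℕ) (A N κ t E : ℝ), S.Bounds n A N κ t E → Admissible k A κ t E → κ ≤ κ₀ →
    ∀ x, S.m (n + 1) x / S.m n x ≤
      (1 + C * κ) * (S.c.d (n + 1) / S.c.d n) + C * E := by
  obtain ⟨V, hV0, hV⟩ := S.exists_abs_deriv_φ_le hk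
  obtain ⟨C, κ₀, hC, hκ₀, hbd⟩ := CommutingPair.exists_bound k (2 * Real.exp V)
    (by linarith [Real.one_le_exp hV0])
  refine ⟨160 + 64 * C + 64 * C, min κ₀ (1 / (128 * C)), by linarith, by positivity,
    fun n A N κ t E h ha hκ y => ?_⟩
  have hκ1 : κ ≤ κ₀ := hκ.trans (min_le_left _ _)
  have hκ2 : κ ≤ 1 / (128 * C) := hκ.trans (min_le_right _ _)
  have hκ0 : 0 < κ := ha.t_pos.trans_le ha.t_le
  have ht := ha.t_pos
  have hE := ha.E_pos
  have hA := ha.one_le_A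
  have hCκ : C * κ ≤ 1 / 128 := by
    calc C * κ ≤ C * (1 / (128 * C)) := by gcongr
      _ = 1 / 128 := by field_simp
  have h192 : 192 * κ ≤ 1 := (h.pair ha hV0 hV 2 le_rfl (h.m_succ_le_two_mul ha)).κ_le'
  obtain ⟨x, hx⟩ := S.exists_m_succ_le n
  have hd := S.c.d_pos n
  have hd1 := S.c.d_pos (n + 1)
  have hσ : S.m (n + 1) x / S.m n x ≤ S.c.d (n + 1) / S.c.d n := by
    rw [div_le_div_iff₀ (S.m_pos n x) hd]; exact hx
  set σ := S.c.d (n + 1) / S.c.d n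
  have hσ0 : 0 < σ := by positivity
  have key : ∀ M, (∀ y, S.m (n + 1) y / S.m n y ≤ M) → ∀ y, S.m (n + 1) y / S.m n y ≤
      (1 + 80 * κ) * σ + 4 * C * E + 16 * (C * κ) * M := by
    intro M hM y
    set μ := min M 2
    have hμ : ∀ z, S.m (n + 1) z ≤ μ * S.m n z := fun z => by
      have hz := S.m_pos n z
      rw [← div_le_iff₀ hz]
      exact le_min (hM z) (by rw [div_le_iff₀ hz]; exact h.m_succ_le_two_mul ha z)
    set P := h.pair ha hV0 hV μ (min_le_right _ _) hμ
    have hμ0 : 0 ≤ μ := P.μ_nonneg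
    have hw : ∀ z, |S.ψ (n + 1) z| ≤ 4 * C * κ * μ + C * E := fun z => by
      have h1 := hbd P hκ1 0 (by omega) z
      simp only [iteratedDeriv_zero, pow_zero, mul_one, zero_add, pow_one] at h1
      have h2 : (1 + C * κ) * A * μ * κ * t ≤ 4 * C * κ * μ := by
        calc _ ≤ (1 + 1) * 2 * μ * κ * 1 := by
              have := ha.A_le; have := ha.t_le
              gcongr <;> linarith
          _ = 4 * 1 * κ * μ := by ring
          _ ≤ 4 * C * κ * μ := by gcongr
      exact h1.trans (add_le_add_left h2 _)
    set w := 4 * C * κ * μ + C * E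
    have hw0 : 0 ≤ w := by positivity
    have hψ1 : ∀ z, |S.ψ (n + 1) z| ≤ 1 := fun z => by
      have h1 : (k : ℝ) * |S.ψ (n + 1) z| ≤ 1 := P.mul_abs_ψ_le z
      have h2 : (1 : ℝ) ≤ k := by exact_mod_cast (by omega : 1 ≤ k)
      nlinarith [abs_nonneg (S.ψ (n + 1) z)]
    obtain ⟨l, hl, p, x', hx', rfl⟩ := S.exists_mem_J_iterate_eq n x y
    rw [S.m_add_int, S.m_add_int]
    have hx'' : |x' - x| ≤ S.m n x := S.abs_sub_le_m hx'
    have hmx := S.m_pos n x; have hmx' := S.m_pos n x'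
    have step1 : S.m (n + 1) x' / S.m n x' ≤ (1 + 16 * κ) * (σ + 2 * w) := by
      have h1 := abs_sub_le_of_abs_deriv_le (g := fun z => S.F (n + 1) z - z)
        (fun z => (S.hasDerivAt_F (n + 1) z).sub (hasDerivAt_id z)) (M := 2 * w) x x' fun z _ => by
          have := Real.abs_exp_sub_one_le (hψ1 z)
          linarith [hw z]
      have h2 : S.m (n + 1) x' ≤ S.m (n + 1) x + 2 * w * S.m n x := by
        have h3 := (abs_abs_sub_abs_le_abs_sub (S.F (n + 1) x' - x') (S.F (n + 1) x - x)).trans h1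
        have h4 : 2 * w * |x' - x| ≤ 2 * w * S.m n x := by gcongr
        have h5 := (le_abs_self _).trans (h3.trans h4)
        unfold m at h5 ⊢
        linarith
      have h3 : S.m n x ≤ (1 + 16 * κ) * S.m n x' := P.m_le (x := x) (y := x') (by
        show |x' - x| ≤ 2 * S.m n x; linarith)
      rw [div_le_iff₀ hmx']
      calc S.m (n + 1) x' ≤ S.m (n + 1) x + 2 * w * S.m n x := h2
        _ ≤ σ * S.m n x + 2 * w * S.m n x := by
          rw [div_le_iff₀ hmx] at hσ; linarith
        _ = (σ + 2 * w) * S.m n x := by ring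
        _ ≤ (σ + 2 * w) * ((1 + 16 * κ) * S.m n x') := by gcongr
        _ = _ := by ring
    have step2 : S.m (n + 1) (S.f^[l] x') / S.m n (S.f^[l] x') ≤
        Real.exp (12 * t) * (Real.exp (12 * t) * (S.m (n + 1) x' / S.m n x')) := by
      have hl2 : l = min l (S.c.q (n + 1)) + (l - S.c.q (n + 1)) := by omega
      have hq := S.c.q_le_succ n
      rw [hl2, Nat.add_comm (min _ _), Function.iterate_add_apply]
      clear hl2
      refine (h.ratio_iterate_le ha hV0 hV (l := l - S.c.q (n + 1)) (by omega) _).trans ?_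
      gcongr
      exact h.ratio_iterate_le ha hV0 hV (min_le_right _ _) _
    have h24 : Real.exp (12 * t) * Real.exp (12 * t) * (1 + 16 * κ) ≤ 1 + 80 * κ := by
      have h12 := Real.exp_le_one_add_two_mul (x := 12 * t + 12 * t) (by positivity)
        (by linarith [ha.t_le])
      rw [← Real.exp_add]
      calc _ ≤ (1 + 48 * κ) * (1 + 16 * κ) := by
            gcongr; linarith [ha.t_le]
        _ ≤ _ := by nlinarith
    calc _ ≤ _ := step2
      _ ≤ Real.exp (12 * t) * (Real.exp (12 * t) * ((1 + 16 * κ) * (σ + 2 * w))) := by gcongr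
      _ = (Real.exp (12 * t) * Real.exp (12 * t) * (1 + 16 * κ)) * (σ + 2 * w) := by ring
      _ ≤ (1 + 80 * κ) * (σ + 2 * w) := by gcongr
      _ = (1 + 80 * κ) * σ + (1 + 80 * κ) * (8 * (C * κ) * μ + 2 * C * E) := by ring
      _ ≤ (1 + 80 * κ) * σ + 2 * (8 * (C * κ) * M + 2 * C * E) := by
        gcongr
        · linarith
        · exact min_le_left _ _
      _ = _ := by ring
  have hbdd : BddAbove (Set.range fun y => S.m (n + 1) y / S.m n y) := by
    refine ⟨2, ?_⟩
    rintro _ ⟨z, rfl⟩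
    show _ / _ ≤ _
    rw [div_le_iff₀ (S.m_pos n z)]
    exact h.m_succ_le_two_mul ha z
  have hM := le_div_of_bootstrap hbdd (a := (1 + 80 * κ) * σ + 4 * C * E) (ρ := 1 / 2) (by norm_num)
    fun M hM z => by
      refine (key M hM z).trans (add_le_add_right ?_ _)
      have : 0 ≤ M := le_trans (div_pos (S.m_pos (n + 1) z) (S.m_pos n z)).le (hM z)
      gcongr
      linarith
  have hM' : ∀ z, S.m (n + 1) z / S.m n z ≤ 4 * σ + 8 * C * E := fun z => by
    refine (hM z).trans ?_
    have : 80 * κ * σ ≤ 1 * σ := by gcongr; linarith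
    rw [div_le_iff₀ (by norm_num)]
    linarith
  refine (key _ hM' y).trans ?_
  calc _ = (1 + (80 + 64 * C) * κ) * σ + (4 * C + 128 * (C * κ) * C) * E := by ring
    _ ≤ (1 + (80 + 64 * C) * κ) * σ + (4 * C + 128 * (1 / 128) * C) * E := by gcongr
    _ ≤ _ := by gcongr <;> linarith

end SmoothLift

/-- The inequalities relating the parameters of consecutive renormalization levels. -/
structure StepParams (k : ℕ) (κ t E μ κ' t' E' κ₃ : ℝ) : Prop where
  μ_pos : 0 < μ
  μ_le : μ ≤ 1
  κ'_pos : 0 < κ'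
  t'_pos : 0 < t'
  E'_pos : 0 < E'
  κ₃_pos : 0 < κ₃
  κ₃_le : κ₃ ≤ κ
  E_le : E ≤ κ * μ
  t'_le : t' ≤ κ
  mul_t_le : μ * t ≤ t'
  pow_mul_E_le : ∀ r ≤ k - 2, μ ^ r * E ≤ κ * κ' * t' ^ (r + 1)
  pow_mul_κ_le : ∀ r ≤ k - 2, μ ^ (r + 1) * κ * t ^ (r + 1) ≤ κ' * t' ^ (r + 1)
  pow_pred_mul_E_le : ∀ s, 1 ≤ s → s ≤ k - 2 → μ ^ (s - 1) * E ≤ κ₃ * t' ^ s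
  pow_mul_κ_le' : ∀ s, 1 ≤ s → s ≤ k - 2 → μ ^ s * κ * t ^ (s + 1) ≤ κ₃ * t' ^ s
  κ₃_mul_le : κ₃ * t' ^ (k - 1) ≤ κ * E'
  pow_top_le : μ ^ (k - 2) * E ≤ E'

namespace SmoothLift

variable {k : ℕ} {α : ℝ} (S : SmoothLift k α)

/-- Everything known about level `n` that is used to pass to level `n + 1`. -/
structure Step (n : ℕ) (A N κ t E μ κ' t' E' κ₃ C V : ℝ) : Prop where
  bounds : S.Bounds n A N κ t E
  admissible : Admissible k A κ t E
  params : StepParams k κ t E μ κ' t' E' κ₃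
  V_nonneg : 0 ≤ V
  abs_φ_sub_le : ∀ x y, |S.φ y - S.φ x| ≤ V * |y - x|
  one_le_C : 1 ≤ C
  Cκ_le : C * κ ≤ 1
  m_succ_le : ∀ x, S.m (n + 1) x ≤ (1 + C * κ) * μ * S.m n x
  ψ_succ_le : ∀ r ≤ k - 2, ∀ x, |iteratedDeriv r (S.ψ (n + 1)) x| * S.m n x ^ r ≤
    (1 + C * κ) * A * μ * κ * t ^ (r + 1) + C * E

theorem exists_step (hk : 2 < k) {V : ℝ} (hV0 : 0 ≤ V)
    (hV : ∀ x y, |S.φ y - S.φ x| ≤ V * |y - x|) : ∃ C κ₀ : ℝ, 1 ≤ C ∧ 0 < κ₀ ∧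
    ∀ (n : ℕ) (A N κ t E μ κ' t' E' κ₃ : ℝ), S.Bounds n A N κ t E → Admissible k A κ t E →
      StepParams k κ t E μ κ' t' E' κ₃ → S.c.d (n + 1) / S.c.d n ≤ μ → κ ≤ κ₀ →
      S.Step n A N κ t E μ κ' t' E' κ₃ C V := by
  obtain ⟨C₁, κ₁, hC₁, hκ₁, h₁⟩ := S.exists_ratio_le hk
  obtain ⟨C₂, κ₂, hC₂, hκ₂, h₂⟩ := CommutingPair.exists_bound k (2 * Real.exp V)
    (by linarith [Real.one_le_exp hV0])
  refine ⟨2 * C₁ + 3 * C₂, min (min κ₁ κ₂) (1 / (2 * C₁ + 3 * C₂)), by linarith, by positivity,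
    fun n A N κ t E μ κ' t' E' κ₃ h ha hp hσ hκ => ?_⟩
  have l1 : κ ≤ κ₁ := hκ.trans ((min_le_left _ _).trans (min_le_left _ _))
  have l2 : κ ≤ κ₂ := hκ.trans ((min_le_left _ _).trans (min_le_right _ _))
  have l3 : (2 * C₁ + 3 * C₂) * κ ≤ 1 := by
    have := hκ.trans (min_le_right _ _)
    rw [le_div_iff₀ (by positivity)] at this
    linarith
  have hκ0 : 0 < κ := ha.t_pos.trans_le ha.t_le
  have hμ0 := hp.μ_pos
  have ht := ha.t_pos; have hE := ha.E_pos; have hA := ha.one_le_A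
  have e1 : ∀ x, S.m (n + 1) x ≤ (1 + 2 * C₁ * κ) * μ * S.m n x := fun x => by
    rw [← div_le_iff₀ (S.m_pos n x)]
    refine (h₁ n A N κ t E h ha l1 x).trans ?_
    calc _ ≤ (1 + C₁ * κ) * μ + C₁ * (κ * μ) := by
          have := hp.E_le
          gcongr
      _ = _ := by ring
  have l4 : 2 * C₁ * κ ≤ 1 := by nlinarith
  have l5 : C₂ * κ ≤ 1 := by nlinarith
  refine ⟨h, ha, hp, hV0, hV, by linarith, l3, fun x => (e1 x).trans ?_, fun r hr x => ?_⟩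
  · have := S.m_pos n x
    gcongr; linarith
  · set P := h.pair ha hV0 hV ((1 + 2 * C₁ * κ) * μ)
      (by nlinarith [hp.μ_le]) e1
    refine (h₂ P l2 r hr x).trans ?_
    show (1 + C₂ * κ) * A * ((1 + 2 * C₁ * κ) * μ) * κ * t ^ (r + 1) + C₂ * E ≤ _
    have e2 : (1 + C₂ * κ) * (1 + 2 * C₁ * κ) ≤ 1 + (2 * C₁ + 3 * C₂) * κ := by
      nlinarith [mul_nonneg (by positivity : 0 ≤ C₂ * κ) (sub_nonneg.2 l4)]
    calc _ = ((1 + C₂ * κ) * (1 + 2 * C₁ * κ)) * A * μ * κ * t ^ (r + 1) + C₂ * E := by ring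
      _ ≤ _ := by gcongr; linarith

variable {S} {n : ℕ} {A N κ t E μ κ' t' E' κ₃ C V : ℝ}

namespace Step

theorem κ_pos (h : S.Step n A N κ t E μ κ' t' E' κ₃ C V) : 0 < κ :=
  h.admissible.t_pos.trans_le h.admissible.t_le

theorem C_pos (h : S.Step n A N κ t E μ κ' t' E' κ₃ C V) : 0 < C := by linarith [h.one_le_C]

theorem A_pos (h : S.Step n A N κ t E μ κ' t' E' κ₃ C V) : 0 < A := by
  linarith [h.admissible.one_le_A]

theorem one_add_pow_le (h : S.Step n A N κ t E μ κ' t' E' κ₃ C V) {r : ℕ} (hr : r ≤ k) :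
    (1 + C * κ) ^ r ≤ 1 + 3 ^ k * C * κ := by
  have := h.κ_pos; have := h.C_pos
  refine (_root_.one_add_pow_le (by positivity) h.Cκ_le r).trans ?_
  have : (3 : ℝ) ^ r ≤ 3 ^ k := pow_le_pow_right₀ (by norm_num) hr
  rw [mul_assoc]
  gcongr

theorem m_succ_le_two (h : S.Step n A N κ t E μ κ' t' E' κ₃ C V) (x : ℝ) :
    S.m (n + 1) x ≤ 2 * μ * S.m n x := by
  refine (h.m_succ_le x).trans ?_
  have := h.params.μ_pos; have := S.m_pos n x; have := h.Cκ_le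
  gcongr; linarith

theorem ψ_succ_le_four (h : S.Step n A N κ t E μ κ' t' E' κ₃ C V) {r : ℕ} (hr : r ≤ k - 2)
    (x : ℝ) : |iteratedDeriv r (S.ψ (n + 1)) x| * S.m n x ^ r ≤
      4 * C * (μ * κ * t ^ (r + 1) + E) := by
  refine (h.ψ_succ_le r hr x).trans ?_
  have := h.params.μ_pos; have := h.κ_pos; have ht := h.admissible.t_pos
  have hE := h.admissible.E_pos; have hC := h.one_le_C; have hA := h.A_pos
  have : (1 + C * κ) * A ≤ 4 * C := by
    calc (1 + C * κ) * A ≤ (1 + 1) * 2 := by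
          have := h.admissible.A_le; have := h.Cκ_le
          gcongr
      _ ≤ _ := by linarith
  calc _ = ((1 + C * κ) * A) * (μ * κ * t ^ (r + 1)) + C * E := by ring
    _ ≤ (4 * C) * (μ * κ * t ^ (r + 1)) + (4 * C) * E := by gcongr; linarith
    _ = _ := by ring

/-- The first bound at level `n + 1`. -/
theorem ψ_bound (h : S.Step n A N κ t E μ κ' t' E' κ₃ C V) {r : ℕ} (hr : r ≤ k - 2) (x : ℝ) :
    |iteratedDeriv r (S.ψ (n + 1)) x| * S.m (n + 1) x ^ r ≤
      (1 + 2 * 3 ^ k * (1 + C) * C * κ) * A * κ' * t' ^ (r + 1) := by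
  have hμ := h.params.μ_pos; have hκ := h.κ_pos; have ht := h.admissible.t_pos
  have hE := h.admissible.E_pos; have hC := h.one_le_C; have hA := h.admissible.one_le_A
  have hm := S.m_pos n x; have hm' := S.m_pos (n + 1) x; have hκ' := h.params.κ'_pos
  have ht' := h.params.t'_pos; have hC' := h.C_pos
  have hkk := h.admissible.two_lt
  have e1 : (1 + C * κ) ^ (r + 1) ≤ 1 + 3 ^ k * C * κ := h.one_add_pow_le (by omega)
  have e2 : (1 + C * κ) ^ r ≤ 3 ^ k * (1 + C) := by
    calc _ ≤ (3 : ℝ) ^ r := by gcongr; linarith [h.Cκ_le]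
      _ ≤ 3 ^ k := pow_le_pow_right₀ (by norm_num) (by omega)
      _ ≤ _ := le_mul_of_one_le_right (by positivity) (by linarith)
  calc _ ≤ |iteratedDeriv r (S.ψ (n + 1)) x| * ((1 + C * κ) * μ * S.m n x) ^ r := by
        have := h.m_succ_le x
        gcongr
    _ = ((1 + C * κ) * μ) ^ r * (|iteratedDeriv r (S.ψ (n + 1)) x| * S.m n x ^ r) := by
        rw [mul_pow]; ring
    _ ≤ ((1 + C * κ) * μ) ^ r * ((1 + C * κ) * A * μ * κ * t ^ (r + 1) + C * E) := by
        have := h.ψ_succ_le r hr x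
        gcongr
    _ = (1 + C * κ) ^ (r + 1) * A * (μ ^ (r + 1) * κ * t ^ (r + 1)) +
        (1 + C * κ) ^ r * C * (μ ^ r * E) := by rw [mul_pow]; ring
    _ ≤ (1 + 3 ^ k * C * κ) * A * (κ' * t' ^ (r + 1)) +
        3 ^ k * (1 + C) * C * (κ * κ' * t' ^ (r + 1)) := by
      have := h.params.pow_mul_κ_le r hr; have := h.params.pow_mul_E_le r hr
      gcongr
    _ ≤ (1 + 3 ^ k * C * κ) * A * (κ' * t' ^ (r + 1)) +
        A * (3 ^ k * (1 + C) * C * (κ * κ' * t' ^ (r + 1))) := by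
      exact add_le_add le_rfl (le_mul_of_one_le_left (by positivity) hA)
    _ ≤ (1 + 3 ^ k * C * κ) * A * (κ' * t' ^ (r + 1)) +
        A * (3 ^ k * (1 + C) * C * (κ * κ' * t' ^ (r + 1))) +
        A * (3 ^ k * C * C * (κ * κ' * t' ^ (r + 1))) := le_add_of_nonneg_right (by positivity)
    _ = _ := by ring

theorem m_bound (h : S.Step n A N κ t E μ κ' t' E' κ₃ C V) (x : ℝ) :
    S.m (n + 1) x ≤ (1 + C * κ) * A * (μ * N) := by
  have hμ := h.params.μ_pos; have hκ := h.κ_pos; have hC' := h.C_pos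
  calc _ ≤ (1 + C * κ) * μ * S.m n x := h.m_succ_le x
    _ ≤ (1 + C * κ) * μ * (A * N) := by gcongr; exact h.bounds.m_le x
    _ = _ := by ring

/-- Derivatives of the return cocycle, pulled back along a short orbit. -/
theorem pullback_le (h : S.Step n A N κ t E μ κ' t' E' κ₃ C V) {l j : ℕ}
    (hl : l ≤ S.c.q (n + 2)) (hj1 : 1 ≤ j) (hj : j ≤ k - 2) (x : ℝ) :
    |iteratedDeriv j (S.ψ (n + 1)) (S.f^[l] x)| * (Real.exp (S.u l x) * S.m (n + 1) x) ^ j ≤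
      8 * C * (2 * Real.exp V) ^ k * (S.m (n + 1) (S.f^[l] x) / S.m n (S.f^[l] x)) *
        κ₃ * t' ^ j := by
  have hμ := h.params.μ_pos; have hκ := h.κ_pos; have ht := h.admissible.t_pos
  have hE := h.admissible.E_pos; have hC := h.C_pos
  have ht' := h.params.t'_pos; have hκ₃ := h.params.κ₃_pos
  have e0 := S.exp_u_mul_m_le h.V_nonneg h.abs_φ_sub_le (N := 1) (n := n + 1) (l := l)
    (by rw [one_mul]; exact hl) x
  rw [Nat.cast_one, one_mul] at e0
  set z := S.f^[l] x
  have hm := S.m_pos n z; have hm' := S.m_pos (n + 1) z; have hm'x := S.m_pos (n + 1) x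
  set ρ := S.m (n + 1) z / S.m n z with hρ
  have hρ0 : 0 < ρ := by positivity
  have hρ2 : ρ ≤ 2 * μ := by rw [hρ, div_le_iff₀ hm]; exact h.m_succ_le_two z
  have e1 : S.m (n + 1) z = ρ * S.m n z := by rw [hρ]; field_simp
  obtain ⟨i, rfl⟩ : ∃ i, j = i + 1 := ⟨j - 1, by omega⟩
  have e2 := h.params.pow_pred_mul_E_le (i + 1) hj1 hj
  have e3 := h.params.pow_mul_κ_le' (i + 1) hj1 hj
  rw [Nat.add_sub_cancel] at e2
  have hk2 : Real.exp V * (2 * Real.exp V) ^ i ≤ (2 * Real.exp V) ^ k := by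
    have hV := Real.one_le_exp h.V_nonneg
    calc _ ≤ (2 * Real.exp V) * (2 * Real.exp V) ^ i := by gcongr; linarith
      _ = (2 * Real.exp V) ^ (i + 1) := by ring
      _ ≤ _ := pow_le_pow_right₀ (by linarith) (by omega)
  calc _ ≤ |iteratedDeriv (i + 1) (S.ψ (n + 1)) z| * (Real.exp V * (ρ * S.m n z)) ^ (i + 1) := by
        rw [e1] at e0
        gcongr
    _ = Real.exp V * Real.exp V ^ i * ρ * ρ ^ i *
        (|iteratedDeriv (i + 1) (S.ψ (n + 1)) z| * S.m n z ^ (i + 1)) := by ring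
    _ ≤ Real.exp V * Real.exp V ^ i * ρ * (2 * μ) ^ i *
        (4 * C * (μ * κ * t ^ (i + 1 + 1) + E)) := by
      have := h.ψ_succ_le_four hj z
      gcongr
    _ = 4 * C * (Real.exp V * (2 * Real.exp V) ^ i) * ρ *
        (μ ^ (i + 1) * κ * t ^ (i + 1 + 1) + μ ^ i * E) := by rw [mul_pow, mul_pow]; ring
    _ ≤ 4 * C * (2 * Real.exp V) ^ k * ρ * (κ₃ * t' ^ (i + 1) + κ₃ * t' ^ (i + 1)) := by gcongr
    _ = _ := by ring

end Step

end SmoothLift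

namespace SmoothLift

variable {k : ℕ} {α : ℝ}

/-- The chain rule for `u_{l+q} = u_l + ψ ∘ f^l`, up to lower order terms. -/
theorem exists_chain_error (k : ℕ) {C V : ℝ} (hC : 1 ≤ C) : ∃ D : ℝ, 1 ≤ D ∧
    ∀ {α : ℝ} (S : SmoothLift k α) {n : ℕ} {A N κ t E μ κ' t' E' κ₃ : ℝ},
      S.Step n A N κ t E μ κ' t' E' κ₃ C V → ∀ l ≤ S.c.q (n + 2), ∀ x,
      (∀ j, 1 ≤ j → j ≤ k - 2 → |iteratedDeriv j (S.u l) x| * S.m (n + 1) x ^ j ≤ 4 * t' ^ j) →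
      ∀ r, 1 ≤ r → r ≤ k - 1 →
      |iteratedDeriv r (S.u (l + S.c.q (n + 1))) x - iteratedDeriv r (S.u l) x -
        iteratedDeriv r (S.ψ (n + 1)) (S.f^[l] x) * Real.exp (S.u l x) ^ r| *
        S.m (n + 1) x ^ r ≤
      D * (S.m (n + 1) (S.f^[l] x) / S.m n (S.f^[l] x)) * κ₃ * t' ^ r := by
  obtain ⟨C₀, hC₀, hcomp⟩ := exists_bound_iteratedDeriv_comp' (k - 1)
  have hX : 1 ≤ 4 ^ k * (8 * C * (2 * Real.exp V) ^ k + 1) := by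
    have : (1 : ℝ) ≤ 4 ^ k := one_le_pow₀ (by norm_num)
    have : 0 ≤ 8 * C * (2 * Real.exp V) ^ k := by positivity
    nlinarith
  refine ⟨C₀ * (4 ^ k * (8 * C * (2 * Real.exp V) ^ k + 1)), by nlinarith,
    fun {α} S {n A N κ t E μ κ' t' E' κ₃} h l hl x hlow r hr1 hr => ?_⟩
  have hm := S.m_pos n (S.f^[l] x); have hm' := S.m_pos (n + 1) (S.f^[l] x)
  have hm'x := S.m_pos (n + 1) x
  have ht' := h.params.t'_pos; have hκ₃ := h.params.κ₃_pos
  have hpull := fun j h1 h2 => h.pullback_le hl (j := j) h1 h2 x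
  set ρ := S.m (n + 1) (S.f^[l] x) / S.m n (S.f^[l] x)
  have hρ : 0 < ρ := by positivity
  set c := 8 * C * (2 * Real.exp V) ^ k with hc
  have hc0 : 0 ≤ c := by positivity
  have hkk := h.admissible.two_lt
  have h1 : ContDiff ℝ r (S.u l) := (S.contDiff_u l).of_le (by norm_cast)
  have h2 : ContDiff ℝ r (fun y => S.ψ (n + 1) (S.f^[l] y)) :=
    ((S.contDiff_ψ (n + 1)).of_le (by norm_cast)).comp
      ((S.contDiff_iterate l).of_le (by norm_cast; omega))
  have e1 : iteratedDeriv r (S.u (l + S.c.q (n + 1))) x = iteratedDeriv r (S.u l) x +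
      iteratedDeriv r (fun y => S.ψ (n + 1) (S.f^[l] y)) x := by
    rw [show S.u (l + S.c.q (n + 1)) = fun y => S.u l y + S.ψ (n + 1) (S.f^[l] y) from
      funext fun y => S.u_add _ _ y]
    exact iteratedDeriv_fun_add h1.contDiffAt h2.contDiffAt
  have key := hcomp r hr (S.ψ (n + 1)) (S.f^[l]) (S.u l)
    ((S.contDiff_ψ (n + 1)).of_le (by norm_cast)) ((S.contDiff_u l).of_le (by norm_cast; omega))
    (fun y => S.hasDerivAt_iterate l y) x 1 (4 * t' / S.m (n + 1) x) (c * ρ * κ₃) zero_le_one le_rfl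
    (by positivity) (by positivity) (fun j hj1 hj => by
      have h3 := hpull j hj1 (by omega)
      rw [div_pow, mul_div_assoc', le_div_iff₀ (by positivity), mul_assoc, ← mul_pow]
      refine h3.trans ?_
      gcongr
      linarith) (fun j hj1 hj => by
      have h3 := hlow j hj1 (by omega)
      rw [div_pow, one_mul, le_div_iff₀ (by positivity), mul_pow]
      refine h3.trans ?_
      gcongr
      exact le_self_pow₀ (by norm_num) (by omega))
  rw [e1, add_sub_cancel_left]
  calc _ ≤ C₀ * 1 * (c * ρ * κ₃) * (4 * t' / S.m (n + 1) x) ^ r * S.m (n + 1) x ^ r := by gcongr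
    _ = C₀ * (4 ^ r * c) * ρ * κ₃ * t' ^ r := by
      rw [div_pow, mul_pow]; field_simp
    _ ≤ C₀ * (4 ^ k * (c + 1)) * ρ * κ₃ * t' ^ r := by
      gcongr
      · norm_num
      · omega
      · linarith

variable {S : SmoothLift k α} {n : ℕ} {A N κ t E μ κ' t' E' κ₃ C V : ℝ}

namespace Step

theorem ratio_le_mul_L (h : S.Step n A N κ t E μ κ' t' E' κ₃ C V) (z : ℝ) :
    S.m (n + 1) z / S.m n z ≤
      3 * Real.exp V * (S.L (S.c.q (n + 1)) z * S.m (n + 1) z) := by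
  have h1 := S.le_L_mul_m h.V_nonneg h.abs_φ_sub_le (h.bounds.m_succ_le_two_mul h.admissible) z
  have hm := S.m_pos n z; have hm' := S.m_pos (n + 1) z
  rw [div_le_iff₀ hm]
  calc _ = 1 * S.m (n + 1) z := (one_mul _).symm
    _ ≤ 3 * Real.exp V * (S.L (S.c.q (n + 1)) z * S.m n z) * S.m (n + 1) z := by gcongr
    _ = _ := by ring

theorem ratio_le_sum (h : S.Step n A N κ t E μ κ' t' E' κ₃ C V) (z : ℝ) :
    S.m (n + 1) z / S.m n z ≤ 3 * Real.exp V * Real.exp V *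
      ∑ i ∈ range (S.c.q (n + 1)), S.m (n + 1) (S.f^[i] z) := by
  refine (h.ratio_le_mul_L z).trans ?_
  rw [mul_assoc (3 * Real.exp V) (Real.exp V), L, Finset.sum_mul, Finset.mul_sum (range _) _ (Real.exp V)]
  refine mul_le_mul_of_nonneg_left (Finset.sum_le_sum fun i hi => ?_) (by positivity)
  have := S.exp_u_mul_m_le h.V_nonneg h.abs_φ_sub_le (N := 1) (n := n + 1) (l := i)
    (by rw [one_mul]; exact (Finset.mem_range.1 hi).le.trans (S.c.q_le_succ _)) z
  simpa using this

theorem ratio_iterate_le_L (h : S.Step n A N κ t E μ κ' t' E' κ₃ C V) {l : ℕ}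
    (hl : l ≤ S.c.q (n + 2)) (x : ℝ) :
    S.m (n + 1) (S.f^[l] x) / S.m n (S.f^[l] x) ≤ 3 * Real.exp V * Real.exp V *
      (S.L (l + S.c.q (n + 1)) x - S.L l x) * S.m (n + 1) x := by
  refine (h.ratio_le_mul_L _).trans ?_
  have h1 := S.m_iterate_le h.V_nonneg h.abs_φ_sub_le (N := 1) (n := n + 1) (l := l)
    (by rw [one_mul]; exact hl) x
  rw [Nat.cast_one, one_mul] at h1
  have := S.L_nonneg (S.c.q (n + 1)) (S.f^[l] x)
  rw [L_add, add_sub_cancel_left]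
  calc _ ≤ 3 * Real.exp V * (S.L (S.c.q (n + 1)) (S.f^[l] x) *
        (Real.exp V * (Real.exp (S.u l x) * S.m (n + 1) x))) := by gcongr
    _ = _ := by ring

end Step

/-- The second family of bounds at level `n + 1`. -/
theorem exists_u_bound (k : ℕ) {C V : ℝ} (hC : 1 ≤ C) : ∃ D : ℝ, 1 ≤ D ∧
    ∀ {α : ℝ} (S : SmoothLift k α) {n : ℕ} {A N κ t E μ κ' t' E' κ₃ : ℝ},
      S.Step n A N κ t E μ κ' t' E' κ₃ C V → D * κ ≤ 1 → ∀ l ≤ S.c.q (n + 2), ∀ x,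
      ∀ r, 1 ≤ r → r ≤ k - 2 → |iteratedDeriv r (S.u l) x| * S.m (n + 1) x ^ r ≤
        (1 + D * κ) * A * t' ^ r := by
  obtain ⟨D₀, hD₀, herr⟩ := exists_chain_error k (V := V) hC
  set c := 8 * C * (2 * Real.exp V) ^ k with hc
  have hc0 : 0 < c := by positivity
  set D := (c + D₀) * (3 * Real.exp V * Real.exp V) with hD
  have hD0 : 0 < D := by positivity
  refine ⟨3 ^ k * C + D, by nlinarith [one_le_pow₀ (by norm_num : (1 : ℝ) ≤ 3) (n := k)],
    fun {α} S {n A N κ t E μ κ' t' E' κ₃} h hDκ => ?_⟩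
  have hμ := h.params.μ_pos; have hκ := h.κ_pos; have ht := h.admissible.t_pos
  have ht' := h.params.t'_pos; have hκ₃ := h.params.κ₃_pos
  have hA := h.admissible.one_le_A; have hA2 := h.admissible.A_le
  have hkk := h.admissible.two_lt
  have main : ∀ l ≤ S.c.q (n + 2), ∀ x, ∀ r, 1 ≤ r → r ≤ k - 2 →
      |iteratedDeriv r (S.u l) x| * S.m (n + 1) x ^ r ≤ (1 + 3 ^ k * C * κ) * A * t' ^ r +
        D * κ * t' ^ r * ∑ i ∈ range l, S.m (n + 1) (S.f^[i] x) := by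
    intro l
    induction l using Nat.strong_induction_on with
    | _ l ih =>
      intro hl x r hr1 hr
      have hm'x := S.m_pos (n + 1) x; have hmx := S.m_pos n x
      rcases le_or_gt l (S.c.q (n + 1)) with hl1 | hl1
      · have h1 : |iteratedDeriv r (S.u l) x| * S.m (n + 1) x ^ r ≤
            (1 + 3 ^ k * C * κ) * A * t' ^ r := by
          calc _ ≤ |iteratedDeriv r (S.u l) x| * ((1 + C * κ) * μ * S.m n x) ^ r := by
                gcongr; exact h.m_succ_le x
            _ = (1 + C * κ) ^ r * μ ^ r * (|iteratedDeriv r (S.u l) x| * S.m n x ^ r) := by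
                rw [mul_pow, mul_pow]; ring
            _ ≤ (1 + C * κ) ^ r * μ ^ r * (A * t ^ r) := by
                have := h.bounds.u_le r hr1 hr l hl1 x
                gcongr
            _ = (1 + C * κ) ^ r * A * (μ * t) ^ r := by ring
            _ ≤ _ := by
                have := h.one_add_pow_le (r := r) (by omega)
                have := h.params.mul_t_le
                gcongr
        have : 0 ≤ ∑ i ∈ range l, S.m (n + 1) (S.f^[i] x) :=
          Finset.sum_nonneg fun i _ => (S.m_pos _ _).le
        have : 0 ≤ D * κ * t' ^ r * ∑ i ∈ range l, S.m (n + 1) (S.f^[i] x) := by positivity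
        linarith
      · obtain ⟨l', rfl⟩ : ∃ l', l = l' + S.c.q (n + 1) := ⟨l - S.c.q (n + 1), by omega⟩
        have hq := S.c.q_succ_pos n
        have hl' : l' ≤ S.c.q (n + 2) := by omega
        have ih' := ih l' (by omega) hl' x
        have hsum : ∑ i ∈ range l', S.m (n + 1) (S.f^[i] x) ≤ 1 :=
          S.sum_m_le_one hl' x
        have hlow : ∀ j, 1 ≤ j → j ≤ k - 2 →
            |iteratedDeriv j (S.u l') x| * S.m (n + 1) x ^ j ≤ 4 * t' ^ j := fun j h1 h2 => by
          refine (ih' j h1 h2).trans ?_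
          calc _ ≤ (1 + 3 ^ k * C * κ) * 2 * t' ^ j + D * κ * t' ^ j * 1 := by gcongr
            _ = (2 + 2 * (3 ^ k * C * κ) + D * κ) * t' ^ j := by ring
            _ ≤ _ := by
                gcongr
                nlinarith [mul_pos hD0 hκ]
        have e1 := herr S h l' hl' x hlow r hr1 (by omega)
        have e2 := h.pullback_le hl' hr1 hr x
        have e3 := ih' r hr1 hr
        have e4 := h.ratio_le_sum (S.f^[l'] x)
        have hm := S.m_pos n (S.f^[l'] x); have hm' := S.m_pos (n + 1) (S.f^[l'] x)
        set ρ := S.m (n + 1) (S.f^[l'] x) / S.m n (S.f^[l'] x)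
        have hρ : 0 < ρ := by positivity
        have e5 : ∑ i ∈ range (l' + S.c.q (n + 1)), S.m (n + 1) (S.f^[i] x) =
            ∑ i ∈ range l', S.m (n + 1) (S.f^[i] x) +
              ∑ i ∈ range (S.c.q (n + 1)), S.m (n + 1) (S.f^[i] (S.f^[l'] x)) := by
          rw [Finset.sum_range_add]
          simp only [← Function.iterate_add_apply, Nat.add_comm]
        rw [e5]
        set s₁ := ∑ i ∈ range l', S.m (n + 1) (S.f^[i] x)
        set s₂ := ∑ i ∈ range (S.c.q (n + 1)), S.m (n + 1) (S.f^[i] (S.f^[l'] x))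
        set a := iteratedDeriv r (S.u (l' + S.c.q (n + 1))) x
        set b := iteratedDeriv r (S.u l') x
        set w := iteratedDeriv r (S.ψ (n + 1)) (S.f^[l'] x)
        have tri : |a| ≤ |b| + |w| * Real.exp (S.u l' x) ^ r + |a - b - w * Real.exp (S.u l' x) ^ r| := by
          have := abs_add_three b (w * Real.exp (S.u l' x) ^ r) (a - b - w * Real.exp (S.u l' x) ^ r)
          rw [abs_mul, abs_of_nonneg (by positivity : 0 ≤ Real.exp (S.u l' x) ^ r)] at this
          refine le_trans (le_of_eq ?_) this
          congr 1; ring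
        calc |a| * S.m (n + 1) x ^ r ≤ (|b| + |w| * Real.exp (S.u l' x) ^ r +
              |a - b - w * Real.exp (S.u l' x) ^ r|) * S.m (n + 1) x ^ r := by gcongr
          _ = |b| * S.m (n + 1) x ^ r + |w| * (Real.exp (S.u l' x) * S.m (n + 1) x) ^ r +
              |a - b - w * Real.exp (S.u l' x) ^ r| * S.m (n + 1) x ^ r := by ring
          _ ≤ ((1 + 3 ^ k * C * κ) * A * t' ^ r + D * κ * t' ^ r * s₁) + c * ρ * κ₃ * t' ^ r +
              D₀ * ρ * κ₃ * t' ^ r := by gcongr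
          _ = ((1 + 3 ^ k * C * κ) * A * t' ^ r + D * κ * t' ^ r * s₁) +
              (c + D₀) * ρ * κ₃ * t' ^ r := by ring
          _ ≤ ((1 + 3 ^ k * C * κ) * A * t' ^ r + D * κ * t' ^ r * s₁) +
              (c + D₀) * (3 * Real.exp V * Real.exp V * s₂) * κ * t' ^ r := by
            have := h.params.κ₃_le
            gcongr
            exact mul_nonneg (by positivity) (hρ.le.trans e4)
          _ = _ := by rw [hD]; ring
  intro l hl x r hr1 hr
  have hsum : ∑ i ∈ range l, S.m (n + 1) (S.f^[i] x) ≤ 1 := S.sum_m_le_one hl x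
  calc _ ≤ _ := main l hl x r hr1 hr
    _ ≤ (1 + 3 ^ k * C * κ) * A * t' ^ r + A * (D * κ * t' ^ r * 1) := by
      refine add_le_add le_rfl ?_
      refine le_trans ?_ (le_mul_of_one_le_left (by positivity) hA)
      gcongr
    _ = _ := by ring

end SmoothLift

namespace SmoothLift

variable {k : ℕ} {α : ℝ}

namespace Step

variable {S : SmoothLift k α} {n : ℕ} {A N κ t E μ κ' t' E' κ₃ C V : ℝ}

theorem abs_ψ_succ_le (h : S.Step n A N κ t E μ κ' t' E' κ₃ C V) (x : ℝ) :
    |S.ψ (n + 1) x| ≤ 8 * C * κ := by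
  have h1 := h.ψ_succ_le_four (Nat.zero_le _) x
  simp only [iteratedDeriv_zero, pow_zero, mul_one, zero_add, pow_one] at h1
  have hκ := h.κ_pos; have ht := h.admissible.t_pos; have htκ := h.admissible.t_le
  have hC := h.C_pos; have hC1 := h.one_le_C; have hCκ := h.Cκ_le
  have hμ := h.params.μ_pos
  have hκ1 : κ ≤ 1 := by nlinarith
  calc _ ≤ _ := h1
    _ ≤ 4 * C * (1 * κ * 1 + κ * 1) := by
      have := h.params.μ_le
      gcongr
      · linarith
      · exact h.params.E_le.trans (by gcongr)
    _ = _ := by ring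

/-- Distortion of the displacement along a short orbit. -/
theorem exp_u_mul_m_pow_le (h : S.Step n A N κ t E μ κ' t' E' κ₃ C V) {l : ℕ} {x : ℝ}
    (hu : ∀ y, |iteratedDeriv 1 (S.u l) y| * S.m (n + 1) y ^ 1 ≤ 4 * t' ^ 1)
    (hC : 8 * C * κ ≤ 1) (hk : 16 * k * κ ≤ 1) :
    (Real.exp (S.u l x) * S.m (n + 1) x) ^ (k - 2) ≤
      (1 + 32 * k * κ) * S.m (n + 1) (S.f^[l] x) ^ (k - 2) := by
  obtain ⟨ξ, hξ, e⟩ := S.exists_m_iterate_eq (n + 1) l x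
  have hm := S.m_pos (n + 1) x
  have ht' := h.params.t'_pos; have hκ := h.κ_pos
  have hkk := h.admissible.two_lt
  have h1 := abs_sub_le_of_abs_deriv_le (fun z => hasDerivAt_iteratedDeriv (S.contDiff_u l)
    (r := 0) (by omega) z) (M := 16 * t' / S.m (n + 1) x) x ξ fun z hz => by
      have hz' : z ∈ S.J (n + 1) x := Set.uIcc_subset_uIcc_left hξ hz
      have h3 := (S.m_le_of_mem_J (fun y => (h.abs_ψ_succ_le y).trans hC) hz').2
      have h4 := Real.exp_one_lt_d9
      have h5 := hu z
      have hmz := S.m_pos (n + 1) z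
      rw [le_div_iff₀ hm]
      simp only [pow_one] at h5
      calc _ ≤ |iteratedDeriv 1 (S.u l) z| * (4 * S.m (n + 1) z) := by
            gcongr
            refine h3.trans ?_
            gcongr; linarith
        _ = 4 * (|iteratedDeriv 1 (S.u l) z| * S.m (n + 1) z) := by ring
        _ ≤ _ := by linarith
  simp only [iteratedDeriv_zero] at h1
  have h2 : S.u l x ≤ 16 * t' + S.u l ξ := by
    have h3 := S.abs_sub_le_m hξ
    have : 16 * t' / S.m (n + 1) x * |ξ - x| ≤ 16 * t' := by
      calc _ ≤ 16 * t' / S.m (n + 1) x * S.m (n + 1) x := by gcongr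
        _ = _ := by field_simp
    linarith [(abs_le.1 (h1.trans this)).1]
  have h3 : Real.exp (16 * t') ^ (k - 2) ≤ 1 + 32 * k * κ := by
    have hk2 : ((k - 2 : ℕ) : ℝ) ≤ k := by exact_mod_cast Nat.sub_le _ _
    rw [← Real.exp_nat_mul]
    calc _ ≤ Real.exp (16 * k * κ) := by
          apply Real.exp_le_exp.2
          calc _ ≤ (k : ℝ) * (16 * κ) := by have := h.params.t'_le; gcongr
            _ = _ := by ring
      _ ≤ 1 + 2 * (16 * k * κ) := Real.exp_le_one_add_two_mul (by positivity) hk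
      _ = _ := by ring
  rw [e]
  calc _ ≤ (Real.exp (16 * t' + S.u l ξ) * S.m (n + 1) x) ^ (k - 2) := by gcongr
    _ = Real.exp (16 * t') ^ (k - 2) * (Real.exp (S.u l ξ) * S.m (n + 1) x) ^ (k - 2) := by
      rw [Real.exp_add, mul_assoc, mul_pow]
    _ ≤ _ := by gcongr

end Step

/-- The bound on the highest derivatives at level `n + 1`. -/
theorem exists_u_top_bound (k : ℕ) {C V : ℝ} (hC : 1 ≤ C) : ∃ D : ℝ, 1 ≤ D ∧
    ∀ {α : ℝ} (S : SmoothLift k α) {n : ℕ} {A N κ t E μ κ' t' E' κ₃ : ℝ},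
      S.Step n A N κ t E μ κ' t' E' κ₃ C V → D * κ ≤ 1 → ∀ l ≤ S.c.q (n + 2), ∀ x,
      |iteratedDeriv (k - 1) (S.u l) x| * S.m (n + 1) x ^ (k - 2) ≤
        (1 + D * κ) * A * E' * S.L l x := by
  obtain ⟨D₀, hD₀, herr⟩ := exists_chain_error k (V := V) hC
  obtain ⟨D₁, hD₁, hu⟩ := exists_u_bound k (V := V) hC
  set D := 32 * k + 2 * 3 ^ k * C + 3 * D₀ * Real.exp V * Real.exp V + D₁ + 8 * C with hD
  have hp1 : 0 ≤ 3 * D₀ * Real.exp V * Real.exp V := by positivity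
  have hp2 : 0 ≤ 2 * 3 ^ k * C := by positivity
  have hp3 : (0 : ℝ) ≤ 32 * k := by positivity
  refine ⟨D, by linarith, fun {α} S {n A N κ t E μ κ' t' E' κ₃} h hDκ l => ?_⟩
  have hμ := h.params.μ_pos; have hκ := h.κ_pos; have ht := h.admissible.t_pos
  have ht' := h.params.t'_pos; have hκ₃ := h.params.κ₃_pos; have hE' := h.params.E'_pos
  have hA := h.admissible.one_le_A; have hA2 := h.admissible.A_le
  have hkk := h.admissible.two_lt
  have b1 : D₁ * κ ≤ 1 := le_trans (by gcongr; linarith) hDκ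
  have b2 : 8 * C * κ ≤ 1 := le_trans (by gcongr; linarith) hDκ
  have b3 : 16 * k * κ ≤ 1 := le_trans (by gcongr; linarith) hDκ
  have b4 : (32 * k) * κ ≤ 1 := le_trans (by gcongr; linarith) hDκ
  have hE := h.admissible.E_pos
  have hDp : (1 + 32 * k * κ) * (1 + 3 ^ k * C * κ) + 3 * D₀ * Real.exp V * Real.exp V * κ ≤
      1 + D * κ := by
    have : 32 * k * κ * (3 ^ k * C * κ) ≤ 1 * (3 ^ k * C * κ) := by gcongr
    have : 0 ≤ (D₁ + 8 * C) * κ := by positivity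
    rw [hD]
    linarith
  have hp4 : 1 + 3 ^ k * C * κ ≤ 1 + D * κ := by
    have : 0 ≤ (1 + 3 ^ k * C * κ) * (32 * k * κ) := by positivity
    have : 0 ≤ 3 * D₀ * Real.exp V * Real.exp V * κ := by positivity
    linarith
  induction l using Nat.strong_induction_on with
  | _ l ih =>
    intro hl x
    have hm'x := S.m_pos (n + 1) x; have hmx := S.m_pos n x
    rcases le_or_gt l (S.c.q (n + 1)) with hl1 | hl1
    · have hL := S.L_nonneg l x
      calc _ ≤ |iteratedDeriv (k - 1) (S.u l) x| * ((1 + C * κ) * μ * S.m n x) ^ (k - 2) := by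
            gcongr; exact h.m_succ_le x
        _ = (1 + C * κ) ^ (k - 2) * μ ^ (k - 2) *
            (|iteratedDeriv (k - 1) (S.u l) x| * S.m n x ^ (k - 2)) := by
            rw [mul_pow, mul_pow]; ring
        _ ≤ (1 + C * κ) ^ (k - 2) * μ ^ (k - 2) * (A * E * S.L l x) := by
            have := h.bounds.u_top_le l hl1 x
            gcongr
        _ = (1 + C * κ) ^ (k - 2) * A * (μ ^ (k - 2) * E) * S.L l x := by ring
        _ ≤ _ := by
            have := (h.one_add_pow_le (r := k - 2) (by omega)).trans hp4
            have := h.params.pow_top_le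
            gcongr
    · obtain ⟨l', rfl⟩ : ∃ l', l = l' + S.c.q (n + 1) := ⟨l - S.c.q (n + 1), by omega⟩
      have hq := S.c.q_succ_pos n
      have hl' : l' ≤ S.c.q (n + 2) := by omega
      have e3 := ih l' (by omega) hl' x
      have hlow : ∀ j, 1 ≤ j → j ≤ k - 2 → ∀ y,
          |iteratedDeriv j (S.u l') y| * S.m (n + 1) y ^ j ≤ 4 * t' ^ j := fun j h1 h2 y => by
        refine (hu S h b1 l' hl' y j h1 h2).trans ?_
        calc _ ≤ (1 + 1) * 2 * t' ^ j := by gcongr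
          _ = _ := by ring
      have e1 := herr S h l' hl' x (fun j h1 h2 => hlow j h1 h2 x) (k - 1) (by omega) le_rfl
      have e2 := h.bounds.u_top_le _ le_rfl (S.f^[l'] x)
      have e4 := h.ratio_iterate_le_L hl' x
      have e5 := h.exp_u_mul_m_pow_le (x := x) (hlow 1 le_rfl (by omega)) b2 b3
      have e6 := h.m_succ_le (S.f^[l'] x)
      have e7 := S.L_add l' (S.c.q (n + 1)) x
      have hm := S.m_pos n (S.f^[l'] x); have hm' := S.m_pos (n + 1) (S.f^[l'] x)
      have hL := S.L_nonneg l' x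
      have hLz := S.L_nonneg (S.c.q (n + 1)) (S.f^[l'] x)
      set ρ := S.m (n + 1) (S.f^[l'] x) / S.m n (S.f^[l'] x)
      set z := S.f^[l'] x
      set Δ := S.L (l' + S.c.q (n + 1)) x - S.L l' x
      have hΔ : Δ = Real.exp (S.u l' x) * S.L (S.c.q (n + 1)) z := by
        simp only [Δ]; linarith
      have hΔ0 : 0 ≤ Δ := by rw [hΔ]; positivity
      set a := iteratedDeriv (k - 1) (S.u (l' + S.c.q (n + 1))) x
      set b := iteratedDeriv (k - 1) (S.u l') x
      set w := iteratedDeriv (k - 1) (S.ψ (n + 1)) z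
      replace e2 : |w| * S.m n z ^ (k - 2) ≤ A * E * S.L (S.c.q (n + 1)) z := e2
      set X := Real.exp (S.u l' x)
      have hX : 0 < X := Real.exp_pos _
      have tri : |a| ≤ |b| + |w| * X ^ (k - 1) + |a - b - w * X ^ (k - 1)| := by
        have := abs_add_three b (w * X ^ (k - 1)) (a - b - w * X ^ (k - 1))
        rw [abs_mul, abs_of_nonneg (by positivity : 0 ≤ X ^ (k - 1))] at this
        refine le_trans (le_of_eq ?_) this
        congr 1; ring
      have main : |w| * X ^ (k - 1) * S.m (n + 1) x ^ (k - 2) ≤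
          (1 + 32 * k * κ) * (1 + 3 ^ k * C * κ) * A * E' * Δ := by
        calc _ = |w| * X * (X * S.m (n + 1) x) ^ (k - 2) := by
              rw [mul_pow, show k - 1 = k - 2 + 1 by omega, pow_succ]; ring
          _ ≤ |w| * X * ((1 + 32 * k * κ) * ((1 + C * κ) * μ * S.m n z) ^ (k - 2)) := by
              have : S.m (n + 1) z ^ (k - 2) ≤ ((1 + C * κ) * μ * S.m n z) ^ (k - 2) := by gcongr
              have := e5.trans (mul_le_mul_of_nonneg_left this (by positivity))
              gcongr
          _ = (1 + 32 * k * κ) * (1 + C * κ) ^ (k - 2) * μ ^ (k - 2) * X *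
              (|w| * S.m n z ^ (k - 2)) := by rw [mul_pow, mul_pow]; ring
          _ ≤ (1 + 32 * k * κ) * (1 + C * κ) ^ (k - 2) * μ ^ (k - 2) * X *
              (A * E * S.L (S.c.q (n + 1)) z) := by
              have := h.C_pos
              gcongr
          _ = (1 + 32 * k * κ) * (1 + C * κ) ^ (k - 2) * A * (μ ^ (k - 2) * E) * Δ := by
              rw [hΔ]; ring
          _ ≤ _ := by
              have := h.one_add_pow_le (r := k - 2) (by omega)
              have := h.params.pow_top_le
              gcongr
      have err : |a - b - w * X ^ (k - 1)| * S.m (n + 1) x ^ (k - 2) ≤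
          3 * D₀ * Real.exp V * Real.exp V * κ * E' * Δ := by
        refine le_of_mul_le_mul_right ?_ hm'x
        calc _ = |a - b - w * X ^ (k - 1)| * S.m (n + 1) x ^ (k - 1) := by
              rw [mul_assoc, ← pow_succ]; congr 2; omega
          _ ≤ D₀ * ρ * κ₃ * t' ^ (k - 1) := e1
          _ ≤ D₀ * (3 * Real.exp V * Real.exp V * Δ * S.m (n + 1) x) * κ₃ * t' ^ (k - 1) := by
              gcongr
          _ = D₀ * (3 * Real.exp V * Real.exp V * Δ * S.m (n + 1) x) * (κ₃ * t' ^ (k - 1)) := by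
              ring
          _ ≤ D₀ * (3 * Real.exp V * Real.exp V * Δ * S.m (n + 1) x) * (κ * E') := by
              have := h.params.κ₃_mul_le
              gcongr
          _ = _ := by ring
      calc |a| * S.m (n + 1) x ^ (k - 2) ≤ (|b| + |w| * X ^ (k - 1) +
            |a - b - w * X ^ (k - 1)|) * S.m (n + 1) x ^ (k - 2) := by gcongr
        _ = |b| * S.m (n + 1) x ^ (k - 2) + |w| * X ^ (k - 1) * S.m (n + 1) x ^ (k - 2) +
            |a - b - w * X ^ (k - 1)| * S.m (n + 1) x ^ (k - 2) := by ring
        _ ≤ (1 + D * κ) * A * E' * S.L l' x +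
            (1 + 32 * k * κ) * (1 + 3 ^ k * C * κ) * A * E' * Δ +
            1 * (3 * D₀ * Real.exp V * Real.exp V * κ * E' * Δ) := by
              rw [one_mul]; gcongr
        _ ≤ (1 + D * κ) * A * E' * S.L l' x +
            (1 + 32 * k * κ) * (1 + 3 ^ k * C * κ) * A * E' * Δ +
            A * (3 * D₀ * Real.exp V * Real.exp V * κ * E' * Δ) :=
              add_le_add le_rfl (mul_le_mul_of_nonneg_right hA (by positivity))
        _ = (1 + D * κ) * A * E' * S.L l' x +
            ((1 + 32 * k * κ) * (1 + 3 ^ k * C * κ) +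
              3 * D₀ * Real.exp V * Real.exp V * κ) * (A * E' * Δ) := by ring
        _ ≤ (1 + D * κ) * A * E' * S.L l' x + (1 + D * κ) * (A * E' * Δ) := by gcongr
        _ = _ := by simp only [Δ]; ring

/-- The renormalization step. -/
theorem exists_bounds_succ (S : SmoothLift k α) (hk : 2 < k) : ∃ C κ₀ : ℝ, 1 ≤ C ∧ 0 < κ₀ ∧
    ∀ (n : ℕ) (A N κ t E μ κ' t' E' κ₃ : ℝ), S.Bounds n A N κ t E → Admissible k A κ t E →
      StepParams k κ t E μ κ' t' E' κ₃ → S.c.d (n + 1) / S.c.d n ≤ μ → κ ≤ κ₀ →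
      S.Bounds (n + 1) ((1 + C * κ) * A) (μ * N) κ' t' E' ∧
      ∀ r ≤ k - 2, ∀ x, |iteratedDeriv r (S.ψ (n + 1)) x| * S.m n x ^ r ≤
        C * (μ * κ * t ^ (r + 1) + E) := by
  obtain ⟨V, hV0, hV⟩ := S.exists_abs_deriv_φ_le hk
  obtain ⟨C, κ₀, hC, hκ₀, hstep⟩ := S.exists_step hk hV0 hV
  obtain ⟨D₁, hD₁, hu⟩ := exists_u_bound k (V := V) hC
  obtain ⟨D₂, hD₂, htop⟩ := exists_u_top_bound k (V := V) hC
  set D := 2 * 3 ^ k * (1 + C) * C + 4 * C + D₁ + D₂ with hD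
  have p1 : 0 ≤ 2 * 3 ^ k * (1 + C) * C := by positivity
  have hDpos : 0 < D := by linarith
  refine ⟨D, min κ₀ (1 / D), by linarith, by positivity,
    fun n A N κ t E μ κ' t' E' κ₃ hb ha hp hσ hκ => ?_⟩
  have h := hstep n A N κ t E μ κ' t' E' κ₃ hb ha hp hσ (hκ.trans (min_le_left _ _))
  have hDκ : D * κ ≤ 1 := by
    have := hκ.trans (min_le_right _ _)
    rw [le_div_iff₀ hDpos] at this
    linarith
  have hκ0 := h.κ_pos; have hμ := hp.μ_pos; have hA := h.A_pos
  have ht' := hp.t'_pos; have hκ' := hp.κ'_pos; have hE' := hp.E'_pos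
  have ht := ha.t_pos; have hE := ha.E_pos
  have b1 : D₁ * κ ≤ 1 := le_trans (by gcongr; linarith) hDκ
  have b2 : D₂ * κ ≤ 1 := le_trans (by gcongr; linarith) hDκ
  have hN : 0 ≤ N := by
    have := (S.m_pos n 0).le.trans (hb.m_le 0)
    exact (pos_of_mul_pos_right ((S.m_pos n 0).trans_le (hb.m_le 0)) hA.le).le
  refine ⟨⟨fun r hr x => ?_, fun r hr1 hr l hl x => ?_, fun l hl x => ?_, fun x => ?_⟩,
    fun r hr x => ?_⟩
  · refine (h.ψ_bound hr x).trans ?_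
    gcongr; linarith
  · refine (hu S h b1 l hl x r hr1 hr).trans ?_
    gcongr; linarith
  · have := S.L_nonneg l x
    refine (htop S h b2 l hl x).trans ?_
    gcongr; linarith
  · refine (h.m_bound x).trans ?_
    gcongr; linarith
  · refine (h.ψ_succ_le_four hr x).trans ?_
    gcongr; linarith

end SmoothLift

theorem sum_range_le_of_two_step {x : ℕ → ℝ} (h0 : ∀ j, 0 ≤ x j) {ρ : ℝ} (hρ : ρ < 1)
    (h : ∀ j, x (j + 2) ≤ ρ * x j) (n : ℕ) :
    ∑ i ∈ range n, x i ≤ (x 0 + x 1) / (1 - ρ) := by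
  have h1 : 0 < 1 - ρ := by linarith
  suffices H : (1 - ρ) * ∑ i ∈ range n, x i + (x n + x (n + 1)) ≤ x 0 + x 1 by
    rw [le_div_iff₀ h1]
    linarith [h0 n, h0 (n + 1)]
  induction n with
  | zero => simp
  | succ n ih =>
    rw [Finset.sum_range_succ]
    linarith [h n]

/-- The choice of exponents in the renormalization scheme. -/
structure Exponents (k : ℕ) (b κ₁ θ δ e : ℝ) : Prop where
  two_lt : 2 < k
  b_pos : 0 < b
  κ₁_pos : 0 < κ₁
  κ₁_mul_le : k * κ₁ ≤ 1
  b_eq : b = k - 2 - κ₁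
  θ_eq : θ * (k - 1) = b
  δ_eq : 2 * k * δ = κ₁ * θ
  e_eq : e = b + 2 * δ

namespace Exponents

variable {k : ℕ} {b κ₁ θ δ e : ℝ}

theorem three_le (h : Exponents k b κ₁ θ δ e) : (3 : ℝ) ≤ k := by exact_mod_cast h.two_lt

theorem θ_pos (h : Exponents k b κ₁ θ δ e) : 0 < θ := by
  have := h.b_pos; have := h.three_le; have := h.θ_eq
  by_contra hc
  nlinarith

theorem θ_lt (h : Exponents k b κ₁ θ δ e) : θ < 1 := by
  have h1 := h.b_eq; have h2 := h.three_le; have h3 := h.θ_eq; have := h.κ₁_pos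
  by_contra hc
  nlinarith

theorem δ_pos (h : Exponents k b κ₁ θ δ e) : 0 < δ := by
  have h1 := h.θ_pos; have h2 := h.three_le; have h3 := h.δ_eq; have := h.κ₁_pos
  by_contra hc
  have : 0 < κ₁ * θ := by positivity
  nlinarith

theorem κ₁_le (h : Exponents k b κ₁ θ δ e) : 3 * κ₁ ≤ 1 := by
  have h2 := h.three_le; have h3 := h.κ₁_mul_le; have := h.κ₁_pos
  nlinarith

theorem six_δ_le (h : Exponents k b κ₁ θ δ e) : 6 * δ ≤ κ₁ * θ := by
  have h2 := h.three_le; have h3 := h.δ_eq; have := h.δ_pos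
  nlinarith

theorem κ₁_θ_le (h : Exponents k b κ₁ θ δ e) : κ₁ * θ ≤ κ₁ := by
  have := h.θ_lt; have := h.κ₁_pos
  nlinarith

theorem κ₁_θ_le' (h : Exponents k b κ₁ θ δ e) : 3 * (κ₁ * θ) ≤ θ := by
  have := h.κ₁_le; have := h.θ_pos
  nlinarith

theorem one_add_b_mul_θ (h : Exponents k b κ₁ θ δ e) : (1 + b) * θ = b - κ₁ * θ := by
  have h1 := h.θ_eq; have h2 := h.b_eq
  have : (k : ℝ) - 1 = 1 + b + κ₁ := by linarith
  rw [this] at h1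
  linarith

theorem k_mul_one_sub_θ (h : Exponents k b κ₁ θ δ e) : 1 ≤ k * (1 - θ) := by
  have h1 := h.θ_eq; have h2 := h.b_eq; have h3 := h.κ₁_pos
  have := h.θ_lt
  linarith

theorem k_mul_δ_le (h : Exponents k b κ₁ θ δ e) : 6 * (k * δ) ≤ 1 := by
  have h1 := h.δ_eq; have h2 := h.κ₁_θ_le; have h3 := h.κ₁_le
  linarith

theorem δ_le (h : Exponents k b κ₁ θ δ e) : δ ≤ 1 - θ := by
  have h1 := h.k_mul_one_sub_θ; have h2 := h.k_mul_δ_le; have h3 := h.three_le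
  nlinarith

theorem stepParams (h : Exponents k b κ₁ θ δ e) {N μ : ℝ} (hN0 : 0 < N) (hN1 : N < 1) (hμ1 : μ ≤ 1)
    (hμ : N ^ b ≤ μ) :
    StepParams k (N ^ δ) (N ^ θ) (N ^ e) μ ((μ * N) ^ δ) ((μ * N) ^ θ) ((μ * N) ^ e)
      (N ^ (κ₁ * θ)) := by
  obtain ⟨ν, hν0, hνb, rfl⟩ : ∃ ν, 0 ≤ ν ∧ ν ≤ b ∧ μ = N ^ ν := by
    have hμ0 : 0 < μ := (Real.rpow_pos_of_pos hN0 _).trans_le hμ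
    have e1 : N ^ (Real.logb N μ) = μ := Real.rpow_logb hN0 hN1.ne hμ0
    rw [← e1] at hμ hμ1
    refine ⟨Real.logb N μ, ?_, (Real.rpow_le_rpow_left_iff_of_base_lt_one hN0 hN1).1 hμ, e1.symm⟩
    rwa [← Real.rpow_zero N, Real.rpow_le_rpow_left_iff_of_base_lt_one hN0 hN1] at hμ1
  have hNN : N ^ ν * N = N ^ (ν + 1) := by rw [Real.rpow_add hN0, Real.rpow_one]
  have P : ∀ a b : ℝ, (N ^ a) ^ b = N ^ (a * b) := fun a b => (Real.rpow_mul hN0.le a b).symm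
  have Q : ∀ (a : ℝ) (r : ℕ), (N ^ a) ^ r = N ^ (a * r) := fun a r =>
    (Real.rpow_mul_natCast hN0.le a r).symm
  have R : ∀ a b : ℝ, N ^ a * N ^ b = N ^ (a + b) := fun a b => (Real.rpow_add hN0 a b).symm
  have I : ∀ a b : ℝ, N ^ a ≤ N ^ b ↔ b ≤ a := fun a b =>
    Real.rpow_le_rpow_left_iff_of_base_lt_one hN0 hN1
  have pos : ∀ a : ℝ, 0 < N ^ a := fun a => Real.rpow_pos_of_pos hN0 a
  have a1 := h.θ_pos; have a2 := h.θ_lt; have a3 := h.δ_pos; have a4 := h.six_δ_le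
  have a5 := h.κ₁_θ_le'; have a6 := h.one_add_b_mul_θ; have a7 := h.δ_le; have a8 := h.δ_eq
  have a9 := h.e_eq; have a10 := h.θ_eq; have a11 := h.b_eq; have a12 := h.κ₁_θ_le
  have a13 := h.b_pos; have a14 := h.three_le; have a15 := h.κ₁_pos
  have hkk := h.two_lt
  have lin : ∀ u v : ℝ, 0 ≤ v → 0 ≤ v + b * u → 0 ≤ v + ν * u := fun u v h1 h2 => by
    rcases le_or_gt 0 u with hu | hu
    · positivity
    · nlinarith
  have c1 : ((k - 1 : ℕ) : ℝ) = k - 1 := by rw [Nat.cast_sub (by omega)]; simp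
  have c2 : ((k - 2 : ℕ) : ℝ) = k - 2 := by rw [Nat.cast_sub (by omega)]; simp
  rw [hNN]
  simp only [P]
  have q1 : 0 ≤ ν * (1 - θ) := mul_nonneg hν0 (by linarith)
  have q2 : b * δ ≤ (k - 2) * δ := by gcongr; linarith
  have q3 : ν * δ ≤ b * δ := by gcongr
  have q4 : 0 ≤ κ₁ * θ := by positivity
  have q5 : 0 ≤ ν * θ := by positivity
  have q6 : 0 ≤ ν * δ := by positivity
  have q7 : 3 * δ ≤ k * δ := by gcongr
  refine ⟨pos _, hμ1, pos _, pos _, pos _, pos _, ?_, ?_, ?_, ?_, ?_, ?_, ?_, ?_, ?_, ?_⟩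
  · rw [I]; linarith
  · rw [R, I]; linarith
  · rw [I]; linarith
  · rw [R, I]; linarith
  · intro r hr
    have hr' : (r : ℝ) + 1 ≤ k - 1 := by
      rw [← c1]; exact_mod_cast (by omega : r + 1 ≤ k - 1)
    have hr0 : (0 : ℝ) ≤ r := by positivity
    have q8 := mul_le_mul_of_nonneg_left hr' a1.le
    have q9 : 0 ≤ r * (κ₁ * θ) := by positivity
    simp only [Q, R, I]
    push_cast
    have := lin (r - δ - θ * (r + 1)) (b - θ * (r + 1)) (by linarith) (by
      have e1 : b - θ * (r + 1) + b * (r - δ - θ * (r + 1)) =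
        (r + 1) * (b - (1 + b) * θ) - b * δ := by ring
      rw [e1, a6]
      linarith)
    linarith
  · intro r hr
    have hr0 : (0 : ℝ) ≤ r := by positivity
    have q8 : 0 ≤ r * (ν * (1 - θ)) := by positivity
    have q9 : 0 ≤ ν * (1 - θ - δ) := mul_nonneg hν0 (by linarith)
    simp only [Q, R, I]
    push_cast
    linarith
  · intro s hs1 hs
    have hs' : (s : ℝ) ≤ k - 2 := by rw [← c2]; exact_mod_cast hs
    have hs0 : (1 : ℝ) ≤ s := by exact_mod_cast hs1
    have q8 := mul_le_mul_of_nonneg_left hs' a1.le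
    have q9 : 0 ≤ (s - 1) * (κ₁ * θ) := mul_nonneg (by linarith) q4
    simp only [Q, R, I]
    rw [Nat.cast_sub hs1, Nat.cast_one]
    have := lin (s - 1 - θ * s) (b + 2 * δ - κ₁ * θ - θ * s) (by linarith) (by
      have e1 : b + 2 * δ - κ₁ * θ - θ * s + b * (s - 1 - θ * s) =
        2 * δ - κ₁ * θ + s * (b - (1 + b) * θ) := by ring
      rw [e1, a6]
      linarith)
    linarith
  · intro s hs1 hs
    have hs0 : (0 : ℝ) ≤ s := by positivity
    have q8 : 0 ≤ s * (ν * (1 - θ)) := by positivity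
    simp only [Q, R, I]
    push_cast
    linarith
  · simp only [Q, R, I]
    rw [c1, mul_assoc (ν + 1) θ, a10, a9]
    linarith
  · have q8 : 0 ≤ ν * (k - 2 - e) := mul_nonneg hν0 (by linarith)
    simp only [Q, R, I]
    rw [c2]
    linarith

end Exponents

/-- A sequence with a forced slow decay is eventually proportional to the sequence it follows. -/
theorem exists_eq_mul_of_max {N d : ℕ → ℝ} {C τ b : ℝ} (hN0 : ∀ j, 0 < N j) (hN1 : ∀ j, N j < 1)
    (hd : ∀ j, 0 < d j) (hdN : ∀ j, d j ≤ 2 * N j)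
    (hda : ∀ j, d (j + 1) ≤ d j) (hC : 0 < C) (hτ : 1 < τ)
    (hdio : ∀ j, C * d j ^ τ ≤ d (j + 1)) (hb : τ - 1 < b)
    (hN : ∀ j, N (j + 1) = max (N j ^ b) (d (j + 1) / d j) * N j) :
    ∃ K > 0, ∃ j₀, ∀ j ≥ j₀, N j = K * d j := by
  set c := Real.log 2 + |Real.log C| / (τ - 1) with hc
  have hτ' : 0 < τ - 1 := by linarith
  have hlog2 : 0 < Real.log 2 := Real.log_pos (by norm_num)
  have hc0 : 0 < c := by positivity
  set a : ℕ → ℝ := fun j => -Real.log (N j) with ha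
  set D : ℕ → ℝ := fun j => -Real.log (d j) + c with hD
  have ha0 : ∀ j, 0 < a j := fun j => neg_pos.2 (Real.log_neg (hN0 j) (hN1 j))
  have haD : ∀ j, a j ≤ D j := fun j => by
    have h1 := Real.log_le_log (hd j) (hdN j)
    rw [Real.log_mul (by norm_num) (hN0 j).ne'] at h1
    have : 0 ≤ |Real.log C| / (τ - 1) := by positivity
    simp only [ha, hD]; linarith
  have hD0 : ∀ j, 0 < D j := fun j => (ha0 j).trans_le (haD j)
  have hDD : ∀ j, D (j + 1) ≤ τ * D j := fun j => by
    have h1 := Real.log_le_log (mul_pos hC (Real.rpow_pos_of_pos (hd j) _)) (hdio j)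
    rw [Real.log_mul hC.ne' (Real.rpow_pos_of_pos (hd j) _).ne', Real.log_rpow (hd j)] at h1
    have h2 : |Real.log C| ≤ (τ - 1) * c := by
      rw [hc, mul_add, mul_div_cancel₀ _ hτ'.ne']
      have := mul_pos hτ' hlog2
      linarith
    have := neg_abs_le (Real.log C)
    simp only [hD]; linarith
  have good : ∀ j, N (j + 1) = d (j + 1) / d j * N j → a j / D j ≤ a (j + 1) / D (j + 1) :=
    fun j h => by
      have h1 : a (j + 1) - a j = D (j + 1) - D j := by
        simp only [ha, hD]
        rw [h, Real.log_mul (div_pos (hd _) (hd _)).ne' (hN0 j).ne',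
          Real.log_div (hd _).ne' (hd _).ne']
        ring
      have h2 : D j ≤ D (j + 1) := by
        have := Real.log_le_log (hd _) (hda j)
        simp only [hD]; linarith
      rw [div_le_div_iff₀ (hD0 _) (hD0 _)]
      nlinarith [haD j, hD0 j]
  set lam := (1 + b) / τ with hlam
  have hτ0 : 0 < τ := by linarith
  have hlam1 : 1 < lam := by rw [hlam, lt_div_iff₀ hτ0]; linarith
  have bad : ∀ j, N (j + 1) = N j ^ b * N j → lam * (a j / D j) ≤ a (j + 1) / D (j + 1) :=
    fun j h => by
      have h1 : a (j + 1) = (1 + b) * a j := by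
        simp only [ha]
        rw [h, Real.log_mul (Real.rpow_pos_of_pos (hN0 j) _).ne' (hN0 j).ne',
          Real.log_rpow (hN0 j)]
        ring
      rw [hlam, div_mul_div_comm, h1]
      have := ha0 j
      have : 0 < 1 + b := by linarith
      exact div_le_div_of_nonneg_left (by positivity) (hD0 _) (hDD j)
  have hpos : ∀ j, 0 < a j / D j := fun j => div_pos (ha0 j) (hD0 j)
  have step : ∀ j, (N (j + 1) = N j ^ b * N j) ∨ (N (j + 1) = d (j + 1) / d j * N j) := fun j => by
    rcases max_choice (N j ^ b) (d (j + 1) / d j) with h | h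
    · left; rw [hN, h]
    · right; rw [hN, h]
  have mono : Monotone fun j => a j / D j := monotone_nat_of_le_succ fun j => by
    rcases step j with h | h
    · have := bad j h; have := hpos j; nlinarith
    · exact good j h
  have bdd : BddAbove (Set.range fun j => a j / D j) := ⟨1, by
    rintro _ ⟨j, rfl⟩
    exact (div_le_one (hD0 j)).2 (haD j)⟩
  have lim := tendsto_atTop_ciSup mono bdd
  set l := ⨆ j, a j / D j
  have hl : 0 < l := (hpos 0).trans_le (le_ciSup bdd 0)
  have ev : ∀ᶠ j in Filter.atTop, l / lam < a j / D j :=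
    lim.eventually (lt_mem_nhds (div_lt_self hl hlam1))
  obtain ⟨j₀, hj₀⟩ := Filter.eventually_atTop.1 ev
  refine ⟨N j₀ / d j₀, div_pos (hN0 _) (hd _), j₀, fun j hj => ?_⟩
  induction j, hj using Nat.le_induction with
  | base => rw [div_mul_cancel₀ _ (hd j₀).ne']
  | succ j hj ih =>
    rcases step j with h | h
    · have h1 := bad j h
      have h2 := hj₀ j hj
      have h3 : a (j + 1) / D (j + 1) ≤ l := le_ciSup bdd (j + 1)
      rw [div_lt_iff₀ (by linarith)] at h2
      linarith
    · rw [h, ih]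
      have := hd j; have := hd j₀
      field_simp

namespace SmoothLift

variable {k : ℕ} {α : ℝ} (S : SmoothLift k α)

theorem exists_bounds_initial {b κ₁ θ δ e η : ℝ} (h : Exponents k b κ₁ θ δ e) (h0 : 0 < η)
    (h1 : η < 1) : ∃ n, S.Bounds n 1 η (η ^ δ) (η ^ θ) (η ^ e) := by
  have hk := h.two_lt
  have hκ : 0 < η ^ δ := Real.rpow_pos_of_pos h0 _
  have ht : 0 < η ^ θ := Real.rpow_pos_of_pos h0 _
  have hE : 0 < η ^ e := Real.rpow_pos_of_pos h0 _
  have hκ1 : η ^ δ ≤ 1 := Real.rpow_le_one h0.le h1.le h.δ_pos.le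
  have ht1 : η ^ θ ≤ 1 := Real.rpow_le_one h0.le h1.le h.θ_pos.le
  have hε : 0 < η ^ δ * (η ^ θ) ^ (k - 1) := by positivity
  have e1 := S.eventually_m_le hk h0
  have e2 := S.eventually_ψ_le hk hε
  have e3 := S.eventually_iteratedDeriv_u_le hk (k - 2) (by omega) _ hε
  have e4 := S.eventually_iteratedDeriv_u_le_L hk hE
  obtain ⟨n, f1, f2, f3, f4⟩ := (e1.and (e2.and (e3.and e4))).exists
  refine ⟨n, fun r hr x => ?_, fun r hr1 hr l hl x => ?_, fun l hl x => ?_, fun x => ?_⟩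
  · have : (η ^ θ) ^ (k - 1) ≤ (η ^ θ) ^ (r + 1) :=
      pow_le_pow_of_le_one ht.le ht1 (by omega)
    rw [one_mul]
    refine le_trans ?_ (mul_le_mul_of_nonneg_left this hκ.le)
    rcases Nat.eq_zero_or_pos r with rfl | hr0
    · simpa using f2 x
    · exact f3 r hr0 hr _ (S.c.q_le_succ n) x
  · have : (η ^ θ) ^ (k - 1) ≤ (η ^ θ) ^ r := pow_le_pow_of_le_one ht.le ht1 (by omega)
    refine (f3 r hr1 hr l hl x).trans ?_
    exact mul_le_mul hκ1 this (by positivity) zero_le_one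
  · rw [one_mul]; exact f4 l hl x
  · rw [one_mul]; exact f1 x

theorem _root_.exists_rpow_le {δ ε : ℝ} (hδ : 0 < δ) (hε : 0 < ε) : ∃ η₀ : ℝ, 0 < η₀ ∧
    ∀ η, 0 < η → η ≤ η₀ → η ^ δ ≤ ε := by
  refine ⟨ε ^ δ⁻¹, Real.rpow_pos_of_pos hε _, fun η h0 h => ?_⟩
  calc η ^ δ ≤ (ε ^ δ⁻¹) ^ δ := Real.rpow_le_rpow h0.le h hδ.le
    _ = ε := Real.rpow_inv_rpow hε.le hδ.ne'

/-- The outcome of the renormalization scheme. -/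
theorem exists_renormalization {b κ₁ θ δ e : ℝ} (h : Exponents k b κ₁ θ δ e) :
    ∃ (C : ℝ) (n₀ : ℕ) (N : ℕ → ℝ), 0 < C ∧ (∀ j, 0 < N j) ∧ (∀ j, N j < 1) ∧
      (∀ j, N (j + 1) = max (N j ^ b) (S.c.d (n₀ + j + 1) / S.c.d (n₀ + j)) * N j) ∧
      (∀ j x, S.m (n₀ + j) x ≤ 2 * N j) ∧
      ∀ j, ∀ r ≤ k - 2, ∀ x,
        |iteratedDeriv r (S.ψ (n₀ + j + 1)) x| * S.m (n₀ + j) x ^ r ≤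
        C * (max (N j ^ b) (S.c.d (n₀ + j + 1) / S.c.d (n₀ + j)) * N j ^ δ * (N j ^ θ) ^ (r + 1) +
          N j ^ e) := by
  have hk := h.two_lt
  have hb := h.b_pos; have hδ := h.δ_pos; have hθ := h.θ_pos
  obtain ⟨C, κ₀, hC, hκ₀, hstep⟩ := S.exists_bounds_succ hk
  have hC0 : 0 < C := by linarith
  set ρ : ℝ := (1 / 2) ^ δ with hρ
  have hρ1 : ρ < 1 := Real.rpow_lt_one (by norm_num) (by norm_num) hδ
  have hρ' : 0 < 1 - ρ := by linarith
  obtain ⟨η₁, hη₁, h₁⟩ := exists_rpow_le hb (by norm_num : (0 : ℝ) < 1 / 2)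
  obtain ⟨η₂, hη₂, h₂⟩ := exists_rpow_le hδ hκ₀
  obtain ⟨η₃, hη₃, h₃⟩ := exists_rpow_le hδ (by positivity : 0 < 1 / (64 * (k + 1) * 3 ^ k : ℝ))
  obtain ⟨η₄, hη₄, h₄⟩ := exists_rpow_le hδ (by positivity : 0 < (1 - ρ) / (4 * C))
  obtain ⟨η, hη0, hη⟩ : ∃ η : ℝ, 0 < η ∧ η < 1 ∧ η ≤ η₁ ∧ η ≤ η₂ ∧ η ≤ η₃ ∧ η ≤ η₄ := by
    refine ⟨min (1 / 2) (min (min η₁ η₂) (min η₃ η₄)), by positivity,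
      (min_le_left _ _).trans_lt (by norm_num), ?_, ?_, ?_, ?_⟩ <;> simp
  obtain ⟨hη1, g₁, g₂, g₃, g₄⟩ := hη
  obtain ⟨n₀, hn₀⟩ := S.exists_bounds_initial h hη0 hη1
  set N : ℕ → ℝ := fun j => Nat.rec η
    (fun j x => max (x ^ b) (S.c.d (n₀ + j + 1) / S.c.d (n₀ + j)) * x) j with hN
  have N0 : N 0 = η := rfl
  have Ns : ∀ j, N (j + 1) =
    max (N j ^ b) (S.c.d (n₀ + j + 1) / S.c.d (n₀ + j)) * N j := fun j => rfl
  clear_value N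
  have hd := S.c.d_pos
  have Npos : ∀ j, 0 < N j := fun j => by
    induction j with
    | zero => rwa [N0]
    | succ j ih =>
      rw [Ns]
      exact mul_pos (lt_max_of_lt_left (Real.rpow_pos_of_pos ih _)) ih
  have dle : ∀ j, S.c.d (n₀ + j + 1) / S.c.d (n₀ + j) ≤ 1 := fun j =>
    (div_le_one (hd _)).2 (S.c.d_succ_lt _).le
  have Nle : ∀ j, N j ≤ η := fun j => by
    induction j with
    | zero => rw [N0]
    | succ j ih =>
      rw [Ns]
      refine le_trans (mul_le_of_le_one_left (Npos j).le ?_) ih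
      exact max_le (Real.rpow_le_one (Npos j).le (ih.trans hη1.le) hb.le) (dle j)
  have N1 : ∀ j, N j < 1 := fun j => (Nle j).trans_lt hη1
  have μle : ∀ j, max (N j ^ b) (S.c.d (n₀ + j + 1) / S.c.d (n₀ + j)) ≤ 1 := fun j =>
    max_le (Real.rpow_le_one (Npos j).le (N1 j).le hb.le) (dle j)
  have Nhalf : ∀ j, N j ^ b ≤ 1 / 2 := fun j => h₁ _ (Npos j) ((Nle j).trans g₁)
  have N2 : ∀ j, N (j + 2) ≤ 1 / 2 * N j := fun j => by
    suffices max (N (j + 1) ^ b) (S.c.d (n₀ + (j + 1) + 1) / S.c.d (n₀ + (j + 1))) *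
        max (N j ^ b) (S.c.d (n₀ + j + 1) / S.c.d (n₀ + j)) ≤ 1 / 2 by
      have e1 := Ns (j + 1)
      rw [Ns j, ← mul_assoc, ← Ns j] at e1
      exact e1.le.trans (mul_le_mul_of_nonneg_right this (Npos j).le)
    have m1 := μle j
    have m2 := μle (j + 1)
    have m3 : 0 < max (N j ^ b) (S.c.d (n₀ + j + 1) / S.c.d (n₀ + j)) :=
      lt_max_of_lt_left (Real.rpow_pos_of_pos (Npos j) _)
    have m4 : 0 < max (N (j + 1) ^ b) (S.c.d (n₀ + (j + 1) + 1) / S.c.d (n₀ + (j + 1))) :=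
      lt_max_of_lt_left (Real.rpow_pos_of_pos (Npos _) _)
    rcases max_choice (N j ^ b) (S.c.d (n₀ + j + 1) / S.c.d (n₀ + j)) with c1 | c1
    · have := Nhalf j
      rw [c1] at m3 ⊢
      nlinarith
    rcases max_choice (N (j + 1) ^ b) (S.c.d (n₀ + (j + 1) + 1) / S.c.d (n₀ + (j + 1))) with c2 | c2
    · have := Nhalf (j + 1)
      rw [c2] at m4 ⊢
      nlinarith
    · rw [c1, c2]
      have a1 := hd (n₀ + j); have a2 := hd (n₀ + (j + 1))
      have a3 := S.c.d_add_two_le_half (n₀ + j)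
      rw [div_mul_div_comm, div_le_iff₀ (by positivity)]
      have a4 : S.c.d (n₀ + (j + 1) + 1) = S.c.d (n₀ + j + 2) := rfl
      have a5 : S.c.d (n₀ + j + 1) = S.c.d (n₀ + (j + 1)) := rfl
      rw [a4, a5]
      nlinarith
  have Nsum : ∀ j, ∑ i ∈ range j, C * N i ^ δ ≤ 1 / 2 := fun j => by
    have s1 := sum_range_le_of_two_step (x := fun i => N i ^ δ)
      (fun i => (Real.rpow_pos_of_pos (Npos i) _).le) hρ1 (fun i => by
        rw [hρ, ← Real.mul_rpow (by norm_num) (Npos i).le]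
        exact Real.rpow_le_rpow (Npos _).le (N2 i) hδ.le) j
    rw [← Finset.mul_sum]
    have s2 : ∀ i, N i ^ δ ≤ (1 - ρ) / (4 * C) := fun i => h₄ _ (Npos i) ((Nle i).trans g₄)
    calc _ ≤ C * ((N 0 ^ δ + N 1 ^ δ) / (1 - ρ)) := by gcongr
      _ ≤ C * (((1 - ρ) / (4 * C) + (1 - ρ) / (4 * C)) / (1 - ρ)) := by
        have := s2 0; have := s2 1
        gcongr
      _ = 1 / 2 := by field_simp; norm_num
  set A : ℕ → ℝ := fun j => ∏ i ∈ range j, (1 + C * N i ^ δ) with hA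
  have Npδ : ∀ j, 0 < N j ^ δ := fun j => Real.rpow_pos_of_pos (Npos j) _
  have A1 : ∀ j, 1 ≤ A j := fun j => by
    induction j with
    | zero => simp [hA]
    | succ j ih =>
      have : 0 < C * N j ^ δ := mul_pos hC0 (Npδ j)
      have e : A (j + 1) = A j * (1 + C * N j ^ δ) := Finset.prod_range_succ _ _
      rw [e]
      nlinarith
  have A2 : ∀ j, A j ≤ 2 := fun j => by
    calc A j ≤ ∏ i ∈ range j, Real.exp (C * N i ^ δ) :=
          Finset.prod_le_prod (fun i _ => (add_pos one_pos (mul_pos hC0 (Npδ i))).le)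
            fun i _ => by rw [add_comm]; exact Real.add_one_le_exp _
      _ = Real.exp (∑ i ∈ range j, C * N i ^ δ) := (Real.exp_sum _ _).symm
      _ ≤ Real.exp (1 / 2) := Real.exp_le_exp.2 (Nsum j)
      _ ≤ 1 + 2 * (1 / 2) := Real.exp_le_one_add_two_mul (by norm_num) (by norm_num)
      _ = 2 := by norm_num
  have adm : ∀ j, Admissible k (A j) (N j ^ δ) (N j ^ θ) (N j ^ e) := fun j => by
    refine ⟨hk, A1 j, A2 j, Real.rpow_pos_of_pos (Npos j) _,
      Real.rpow_le_rpow_of_exponent_ge (Npos j) (N1 j).le ?_, ?_, Real.rpow_pos_of_pos (Npos j) _⟩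
    · have := h.six_δ_le; have := h.κ₁_θ_le'
      linarith
    · have := h₃ _ (Npos j) ((Nle j).trans g₃)
      rw [le_div_iff₀ (by positivity)] at this
      calc _ ≤ N j ^ δ * (64 * (k + 1) * 3 ^ k) := by
            rw [mul_comm]
            exact mul_le_mul_of_nonneg_left (by gcongr; linarith) (Npδ j).le
        _ ≤ 1 := this
  have par := fun j => h.stepParams (Npos j) (N1 j) (μle j) (le_max_left _ _)
  have bds : ∀ j, S.Bounds (n₀ + j) (A j) (N j) (N j ^ δ) (N j ^ θ) (N j ^ e) := fun j => by
    induction j with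
    | zero => simpa [hA, N0] using hn₀
    | succ j ih =>
      have := (hstep _ _ _ _ _ _ _ _ _ _ _ ih (adm j) (par j) (le_max_right _ _)
        (h₂ _ (Npos j) ((Nle j).trans g₂))).1
      rw [← Ns] at this
      have e : A (j + 1) = (1 + C * N j ^ δ) * A j := by
        rw [mul_comm]; exact Finset.prod_range_succ _ _
      rw [e]
      exact this
  refine ⟨C, n₀, N, hC0, Npos, N1, Ns, fun j x => ((bds j).m_le x).trans ?_, fun j r hr x => ?_⟩
  · have := Npos j; have := A2 j
    gcongr
  · exact (hstep _ _ _ _ _ _ _ _ _ _ _ (bds j) (adm j) (par j) (le_max_right _ _)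
        (h₂ _ (Npos j) ((Nle j).trans g₂))).2 r hr x

end SmoothLift

theorem _root_.exists_exponents {k M : ℕ} {τ : ℝ} (hk : 3 ≤ k) (hτ : 1 < τ)
    (hM : (M : ℝ) + 1 < k - τ) :
    ∃ b κ₁ θ δ e : ℝ, Exponents k b κ₁ θ δ e ∧ τ - 1 + M < b := by
  have hk' : (3 : ℝ) ≤ k := by exact_mod_cast hk
  have h0 : 0 < k - 2 - (τ - 1) - M := by linarith
  obtain ⟨κ₁, h1, h2, h3⟩ : ∃ κ₁ : ℝ, 0 < κ₁ ∧ κ₁ ≤ 1 / k ∧ κ₁ ≤ (k - 2 - (τ - 1) - M) / 2 :=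
    ⟨min (1 / k) ((k - 2 - (τ - 1) - M) / 2), by positivity, min_le_left _ _, min_le_right _ _⟩
  have h4 : κ₁ ≤ 1 / 3 := h2.trans (by gcongr)
  rw [le_div_iff₀ (by positivity)] at h2
  refine ⟨k - 2 - κ₁, κ₁, (k - 2 - κ₁) / (k - 1), κ₁ * ((k - 2 - κ₁) / (k - 1)) / (2 * k), _,
    ⟨by omega, by linarith, h1, by linarith, rfl, ?_, ?_, rfl⟩, by linarith⟩
  · field_simp [show (k : ℝ) - 1 ≠ 0 by linarith]
  · field_simp

namespace SmoothLift

variable {k : ℕ} {α : ℝ} (S : SmoothLift k α)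

theorem exists_abs_iteratedDeriv_ψ_le {b κ₁ θ δ e C τ : ℝ} (h : Exponents k b κ₁ θ δ e)
    (hC : 0 < C) (hτ : 1 < τ) (hdio : ∀ n, C * S.c.d n ^ τ ≤ S.c.d (n + 1)) (hb : τ - 1 < b) :
    ∃ D > 0, ∃ n₁, ∀ n ≥ n₁, ∀ r ≤ k - 2, ∀ x,
      |iteratedDeriv r (S.ψ (n + 1)) x| * S.m n x ^ r ≤
        D * (S.c.d (n + 1) / S.c.d n * S.c.d n ^ ((r + 1) * θ + δ) + S.c.d n ^ e) := by
  obtain ⟨C₁, n₀, N, hC₁, hN0, hN1, hN, hm, hψ⟩ := S.exists_renormalization h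
  have hd := S.c.d_pos
  obtain ⟨K, hK, j₀, hj₀⟩ := exists_eq_mul_of_max (d := fun j => S.c.d (n₀ + j)) hN0 hN1
    (fun j => hd _) (fun j => by
      obtain ⟨x, hx⟩ := S.exists_d_le_m (n₀ + j)
      exact hx.trans (hm j x)) (fun j => (S.c.d_succ_lt _).le) hC hτ (fun j => hdio _) hb hN
  set L := max K 1 with hL
  have hL1 : 1 ≤ L := le_max_right _ _
  have hL0 : 0 < L := by linarith
  have hθ := h.θ_pos
  have hδ := h.δ_pos
  have he : 0 < e := by rw [h.e_eq]; linarith [h.b_pos]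
  set s := k * θ + δ + e with hs
  have hpow : ∀ j ≥ j₀, ∀ t : ℝ, 0 ≤ t → t ≤ s → N j ^ t ≤ L ^ s * S.c.d (n₀ + j) ^ t := by
    intro j hj t ht hts
    have h1 : N j ≤ L * S.c.d (n₀ + j) := by
      rw [hj₀ j hj]
      exact mul_le_mul_of_nonneg_right (le_max_left _ _) (hd _).le
    calc N j ^ t ≤ (L * S.c.d (n₀ + j)) ^ t := Real.rpow_le_rpow (hN0 j).le h1 ht
      _ = L ^ t * S.c.d (n₀ + j) ^ t := Real.mul_rpow hL0.le (hd _).le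
      _ ≤ L ^ s * S.c.d (n₀ + j) ^ t := by
        have := Real.rpow_le_rpow_of_exponent_le hL1 hts
        have := Real.rpow_nonneg (hd (n₀ + j)).le t
        gcongr
  refine ⟨C₁ * L ^ s, by positivity, n₀ + j₀, fun n hn r hr x => ?_⟩
  obtain ⟨j, rfl⟩ : ∃ j, n = n₀ + j := ⟨n - n₀, by omega⟩
  have hj : j₀ ≤ j := by omega
  have hk := h.two_lt
  have hrk : (r : ℝ) + 1 ≤ k := by
    have : r + 1 ≤ k := by omega
    exact_mod_cast this
  have hrθ : ((r : ℝ) + 1) * θ ≤ k * θ := mul_le_mul_of_nonneg_right hrk hθ.le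
  have hmax : max (N j ^ b) (S.c.d (n₀ + j + 1) / S.c.d (n₀ + j)) =
      S.c.d (n₀ + j + 1) / S.c.d (n₀ + j) := by
    have h1 := (hN j).symm
    have h2 := hj₀ (j + 1) (by omega)
    have h3 := hj₀ j hj
    have h4 := hN0 j
    rw [← eq_div_iff h4.ne'] at h1
    rw [h1, h2, h3]
    have := hd (n₀ + j)
    field_simp
    rfl
  have h1 := hψ j r hr x
  rw [hmax] at h1
  refine h1.trans ?_
  have e1 : N j ^ δ * (N j ^ θ) ^ (r + 1) = N j ^ ((r + 1) * θ + δ) := by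
    rw [← Real.rpow_natCast, ← Real.rpow_mul (hN0 j).le, ← Real.rpow_add (hN0 j)]
    congr 1
    push_cast
    ring
  have e2 := hpow j hj ((r + 1) * θ + δ) (by positivity) (by linarith)
  have e3 := hpow j hj e he.le (by
    have : 0 ≤ (k : ℝ) * θ := by positivity
    linarith)
  have hq : 0 ≤ S.c.d (n₀ + j + 1) / S.c.d (n₀ + j) := (div_pos (hd _) (hd _)).le
  rw [mul_assoc (S.c.d (n₀ + j + 1) / S.c.d (n₀ + j)), e1]
  have e4 := mul_le_mul_of_nonneg_left e2 hq
  rw [mul_assoc C₁]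
  refine mul_le_mul_of_nonneg_left ?_ hC₁.le
  linarith

theorem exists_ratio_mul_le {M : ℕ} {C τ : ℝ} (hk : 3 ≤ k) (hC : 0 < C) (hτ : 1 < τ)
    (hdio : ∀ n, C * S.c.d n ^ τ ≤ S.c.d (n + 1)) (hM : (M : ℝ) + 1 < k - τ) :
    ∃ D > 0, ∃ σ > 0, ∃ n₁, ∀ n ≥ n₁, ∀ r ≤ M, ∀ x,
      (S.c.q (n + 2) / S.c.q (n + 1) : ℝ) * (|iteratedDeriv r (S.ψ (n + 1)) x| * S.m n x ^ r) ≤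
        D * S.c.d n ^ (σ : ℝ) * S.c.d n ^ r := by
  obtain ⟨b, κ₁, θ, δ, e, h, hb⟩ := exists_exponents hk hτ hM
  have hM0 : (0 : ℝ) ≤ M := Nat.cast_nonneg _
  obtain ⟨D, hD, n₁, hn₁⟩ := S.exists_abs_iteratedDeriv_ψ_le h hC hτ hdio (by linarith)
  have hθ := h.θ_pos; have hδ := h.δ_pos
  have hθ1 := h.θ_eq; have hκ := h.κ₁_mul_le; have hbe := h.b_eq; have he := h.e_eq
  have hκ0 := h.κ₁_pos
  have hk' : (3 : ℝ) ≤ k := by exact_mod_cast hk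
  have hMk : M + 3 ≤ k := by
    have : ((M + 2 : ℕ) : ℝ) < k := by push_cast; linarith
    have := Nat.cast_lt.1 this
    omega
  have hMk' : (M : ℝ) + 3 ≤ k := by exact_mod_cast hMk
  have key : 0 < (k - 2) * θ - (k - 3) := by
    have : ((k - 2) * θ - (k - 3)) * (k - 1) = 1 - κ₁ * (k - 2) := by
      have : ((k - 2) * θ - (k - 3)) * (k - 1) = (k - 2) * (θ * (k - 1)) - (k - 3) * (k - 1) := by
        ring
      rw [this, hθ1, hbe]; ring
    have h1 : 0 < ((k - 2) * θ - (k - 3)) * (k - 1) := by rw [this]; linarith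
    exact pos_of_mul_pos_left h1 (by linarith)
  have hθlt : θ ≤ 1 := h.θ_lt.le
  obtain ⟨σ, hσ, hσ1, hσ2⟩ : ∃ σ : ℝ, 0 < σ ∧ σ ≤ (k - 2) * θ - (k - 3) ∧ σ ≤ b - (τ - 1) - M :=
    ⟨min _ _, lt_min key (by linarith), min_le_left _ _, min_le_right _ _⟩
  refine ⟨2 * D * (1 + C⁻¹), by positivity, σ, hσ, n₁, fun n hn r hr x => ?_⟩
  have d0 := S.c.d_pos n; have d1 := S.c.d_pos (n + 1); have dle := S.c.d_le_one n
  have q1 : (0 : ℝ) < S.c.q (n + 1) := by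
    have := S.c.q_succ_pos n
    exact_mod_cast this
  have hratio : (S.c.q (n + 2) / S.c.q (n + 1) : ℝ) ≤ 2 * (S.c.d n / S.c.d (n + 1)) := by
    have a1 := S.c.q_succ_mul_d_le (n + 1)
    have a2 := S.c.half_le_q_succ_mul_d n
    rw [div_le_iff₀ q1]
    have : 2 * (S.c.d n / S.c.d (n + 1)) * S.c.q (n + 1) =
        2 * (S.c.q (n + 1) * S.c.d n) / S.c.d (n + 1) := by ring
    rw [this, le_div_iff₀ d1]
    linarith
  have hr' : (r : ℝ) ≤ M := by exact_mod_cast hr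
  have hdσ : S.c.d n ^ σ * S.c.d n ^ r = S.c.d n ^ (σ + r) := by
    rw [Real.rpow_add d0, Real.rpow_natCast]
  have f1 : S.c.d n ^ ((r + 1) * θ + δ) ≤ S.c.d n ^ (σ + r) := by
    refine Real.rpow_le_rpow_of_exponent_ge d0 dle ?_
    have : ((k : ℝ) - 3 - r) * (1 - θ) ≥ 0 := mul_nonneg (by linarith) (by linarith)
    linarith
  have f2 : S.c.d n / S.c.d (n + 1) * S.c.d n ^ e ≤ C⁻¹ * S.c.d n ^ (σ + r) := by
    have g1 : S.c.d n / S.c.d (n + 1) ≤ C⁻¹ * S.c.d n ^ (1 - τ) := by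
      rw [div_le_iff₀ d1]
      have : S.c.d n = C⁻¹ * S.c.d n ^ (1 - τ) * (C * S.c.d n ^ τ) := by
        have : S.c.d n ^ (1 - τ) * S.c.d n ^ τ = S.c.d n := by
          rw [← Real.rpow_add d0]; simp
        calc S.c.d n = S.c.d n ^ (1 - τ) * S.c.d n ^ τ := this.symm
          _ = _ := by field_simp
      calc S.c.d n = C⁻¹ * S.c.d n ^ (1 - τ) * (C * S.c.d n ^ τ) := this
        _ ≤ _ := mul_le_mul_of_nonneg_left (hdio n) (by positivity)
    calc S.c.d n / S.c.d (n + 1) * S.c.d n ^ e ≤ C⁻¹ * S.c.d n ^ (1 - τ) * S.c.d n ^ e := by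
          gcongr
      _ = C⁻¹ * S.c.d n ^ (1 - τ + e) := by rw [Real.rpow_add d0]; ring
      _ ≤ C⁻¹ * S.c.d n ^ (σ + r) := by
        refine mul_le_mul_of_nonneg_left ?_ (by positivity)
        exact Real.rpow_le_rpow_of_exponent_ge d0 dle (by linarith)
  have hm := S.m_pos n x
  calc (S.c.q (n + 2) / S.c.q (n + 1) : ℝ) * (|iteratedDeriv r (S.ψ (n + 1)) x| * S.m n x ^ r)
      ≤ 2 * (S.c.d n / S.c.d (n + 1)) *
        (D * (S.c.d (n + 1) / S.c.d n * S.c.d n ^ ((r + 1) * θ + δ) + S.c.d n ^ e)) :=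
        mul_le_mul hratio (hn₁ n hn r (by omega) x) (by positivity) (by positivity)
    _ = 2 * D * (S.c.d n ^ ((r + 1) * θ + δ) + S.c.d n / S.c.d (n + 1) * S.c.d n ^ e) := by
        field_simp
    _ ≤ 2 * D * (S.c.d n ^ (σ + r) + C⁻¹ * S.c.d n ^ (σ + r)) := by gcongr
    _ = 2 * D * (1 + C⁻¹) * S.c.d n ^ σ * S.c.d n ^ r := by
        rw [mul_assoc _ (S.c.d n ^ σ), hdσ]; ring

theorem summable_d_rpow {σ : ℝ} (hσ : 0 < σ) : Summable fun n => S.c.d n ^ σ := by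
  refine summable_of_sum_range_le (fun n => (Real.rpow_pos_of_pos (S.c.d_pos n) _).le)
    (sum_range_le_of_two_step (ρ := (1 / 2) ^ σ)
      (fun n => (Real.rpow_pos_of_pos (S.c.d_pos n) _).le)
      (Real.rpow_lt_one (by norm_num) (by norm_num) hσ) fun n => ?_)
  rw [← Real.mul_rpow (by norm_num) (S.c.d_pos n).le]
  refine Real.rpow_le_rpow (S.c.d_pos _).le ?_ hσ.le
  linarith [S.c.d_add_two_le_half n]

end SmoothLift

theorem _root_.abs_add_mul_sub_le {v : ℕ → ℝ} {q : ℕ} {η : ℝ} (h : ∀ j, |v (j + q) - v j| ≤ η)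
    (a j : ℕ) : |v (j + a * q) - v j| ≤ a * η := by
  induction a with
  | zero => simp
  | succ a ih =>
    have h1 := h (j + a * q)
    have e1 : j + (a + 1) * q = j + a * q + q := by ring
    rw [e1]
    have := abs_sub_le (v (j + a * q + q)) (v (j + a * q)) (v j)
    push_cast
    linarith

theorem _root_.Convergents.abs_average_sub_le {α : ℝ} (c : Convergents α) {v ε : ℕ → ℝ}
    (h : ∀ n j, c.q (n + 2) * |v (j + c.q (n + 1)) - v j| ≤ c.q (n + 1) * ε n) (n : ℕ) :
    |(∑ j ∈ range (c.q (n + 2)), v j) / c.q (n + 2) -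
      (∑ j ∈ range (c.q (n + 1)), v j) / c.q (n + 1)| ≤
    1 / 2 * |(∑ j ∈ range (c.q (n + 1)), v j) / c.q (n + 1) -
      (∑ j ∈ range (c.q n), v j) / c.q n| + ε n := by
  have q1 : (0 : ℝ) < c.q (n + 1) := by exact_mod_cast c.q_succ_pos n
  have q2 : (0 : ℝ) < c.q (n + 2) := by exact_mod_cast c.q_succ_pos (n + 1)
  have q0 : (0 : ℝ) ≤ c.q n := Nat.cast_nonneg _
  have qe : (c.q (n + 2) : ℝ) = c.q n + c.a n * c.q (n + 1) := by exact_mod_cast c.q_add_two n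
  set η := c.q (n + 1) * ε n / c.q (n + 2) with hη
  have hv : ∀ j, |v (j + c.q (n + 1)) - v j| ≤ η := fun j => by
    rw [hη, le_div_iff₀ q2, mul_comm]
    exact h n j
  have hηq : c.q (n + 2) * η = c.q (n + 1) * ε n := by rw [hη]; field_simp
  have hη0 : 0 ≤ η := (abs_nonneg _).trans (hv 0)
  have hmul := abs_add_mul_sub_le hv
  set s0 := ∑ j ∈ range (c.q n), v j with hs0
  set s1 := ∑ j ∈ range (c.q (n + 1)), v j with hs1
  have blocks : ∀ a ≤ c.a n, |∑ j ∈ range (a * c.q (n + 1)), v j - a * s1| ≤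
      a * c.q (n + 1) * (c.a n * η) := by
    intro a
    induction a with
    | zero => simp
    | succ a ih =>
      intro ha
      have ih := ih (by omega)
      rw [add_mul, one_mul, sum_range_add]
      have e : |∑ j ∈ range (c.q (n + 1)), v (a * c.q (n + 1) + j) - s1| ≤
          c.q (n + 1) * (c.a n * η) := by
        rw [hs1, ← sum_sub_distrib]
        refine (abs_sum_le_sum_abs _ _).trans ?_
        refine (sum_le_card_nsmul _ _ (c.a n * η) fun j _ => ?_).trans (by simp)
        rw [add_comm]
        refine (hmul a j).trans ?_
        have : (a : ℝ) ≤ c.a n := by exact_mod_cast (by omega : a ≤ c.a n)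
        gcongr
      have := abs_add_le (∑ j ∈ range (a * c.q (n + 1)), v j - a * s1)
        (∑ j ∈ range (c.q (n + 1)), v (a * c.q (n + 1) + j) - s1)
      push_cast
      rw [show ∑ j ∈ range (a * c.q (n + 1)), v j +
        ∑ j ∈ range (c.q (n + 1)), v (a * c.q (n + 1) + j) - ((a : ℝ) + 1) * s1 =
        ∑ j ∈ range (a * c.q (n + 1)), v j - a * s1 +
        (∑ j ∈ range (c.q (n + 1)), v (a * c.q (n + 1) + j) - s1) by ring]
      linarith
  have total : |∑ j ∈ range (c.q (n + 2)), v j - (s0 + c.a n * s1)| ≤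
      c.q (n + 2) * (c.a n * η) := by
    have e : |∑ j ∈ range (c.q n), v (c.a n * c.q (n + 1) + j) - s0| ≤
        c.q n * (c.a n * η) := by
      rw [hs0, ← sum_sub_distrib]
      refine (abs_sum_le_sum_abs _ _).trans ?_
      refine (sum_le_card_nsmul _ _ (c.a n * η) fun j _ => ?_).trans (by simp)
      rw [add_comm]
      exact hmul _ j
    have b := blocks _ le_rfl
    rw [c.q_add_two, add_comm (c.q n), sum_range_add]
    have := abs_add_le (∑ j ∈ range (c.a n * c.q (n + 1)), v j - c.a n * s1)
        (∑ j ∈ range (c.q n), v (c.a n * c.q (n + 1) + j) - s0)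
    push_cast
    rw [show ∑ j ∈ range (c.a n * c.q (n + 1)), v j +
        ∑ j ∈ range (c.q n), v (c.a n * c.q (n + 1) + j) - (s0 + (c.a n : ℝ) * s1) =
        ∑ j ∈ range (c.a n * c.q (n + 1)), v j - c.a n * s1 +
        (∑ j ∈ range (c.q n), v (c.a n * c.q (n + 1) + j) - s0) by ring]
    linarith
  have haη : c.a n * η ≤ ε n := by
    have : c.q (n + 1) * (c.a n * η) ≤ c.q (n + 1) * ε n := by
      rw [← hηq, qe]
      have : 0 ≤ c.q n * η := by positivity
      linarith
    exact le_of_mul_le_mul_left this q1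
  set A0 := s0 / c.q n with hA0
  have hs0A : s0 = c.q n * A0 := by
    rcases eq_or_lt_of_le q0 with h0 | h0
    · have : c.q n = 0 := by exact_mod_cast h0.symm
      rw [hs0, this]; simp
    · rw [hA0]; field_simp
  set A1 := s1 / c.q (n + 1) with hA1
  have hs1A : s1 = c.q (n + 1) * A1 := by rw [hA1]; field_simp
  set s2 := ∑ j ∈ range (c.q (n + 2)), v j
  have e : s2 / c.q (n + 2) - A1 =
      -(c.q n / c.q (n + 2)) * (A1 - A0) + (s2 - (s0 + c.a n * s1)) / c.q (n + 2) := by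
    rw [hs0A, hs1A]
    field_simp
    rw [qe]; ring
  rw [e]
  have hhalf : (c.q n / c.q (n + 2) : ℝ) ≤ 1 / 2 := by
    rw [div_le_iff₀ q2]
    have h1 : (c.q n : ℝ) + c.q (n + 1) ≤ c.q (n + 2) := by exact_mod_cast c.q_add_le n
    have h2 : (c.q n : ℝ) ≤ c.q (n + 1) := by exact_mod_cast c.q_le_succ n
    linarith
  refine (abs_add_le _ _).trans (add_le_add ?_ ?_)
  · rw [abs_mul, abs_neg, abs_of_nonneg (by positivity)]
    exact mul_le_mul_of_nonneg_right hhalf (abs_nonneg _)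
  · rw [abs_div, abs_of_pos q2, div_le_iff₀ q2, mul_comm (ε n)]
    exact total.trans (mul_le_mul_of_nonneg_left haη q2.le)

theorem _root_.exists_summable_of_contraction {ε : ℕ → ℝ} (h0 : ∀ n, 0 ≤ ε n) (hε : Summable ε) :
    ∃ w : ℕ → ℝ, Summable w ∧
      ∀ x : ℕ → ℝ, x 0 = 0 → (∀ n, x (n + 1) ≤ 1 / 2 * x n + ε n) → ∀ n, x n ≤ w n := by
  let w : ℕ → ℝ := fun n => Nat.rec 0 (fun n y => 1 / 2 * y + ε n) n
  have w0 : w 0 = 0 := rfl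
  have ws : ∀ n, w (n + 1) = 1 / 2 * w n + ε n := fun n => rfl
  have wn : ∀ n, 0 ≤ w n := fun n => by
    induction n with
    | zero => exact w0.ge
    | succ n ih => rw [ws]; have := h0 n; positivity
  refine ⟨w, summable_of_sum_range_le wn (c := 2 * ∑' n, ε n) fun n => ?_, fun x x0 hx n => ?_⟩
  · induction n with
    | zero => simpa using tsum_nonneg h0
    | succ n ih =>
      rw [sum_range_succ', w0]
      simp only [ws, sum_add_distrib, ← mul_sum]
      have := hε.sum_le_tsum (range n) fun i _ => h0 i
      linarith
  · induction n with
    | zero => rw [x0, w0]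
    | succ n ih => rw [ws]; linarith [hx n]

namespace SmoothLift

variable {k : ℕ} {α : ℝ} (S : SmoothLift k α)

theorem exists_abs_iteratedDeriv_comp_le {r : ℕ} (hr : r ≤ k - 1) {Λ : ℝ}
    (hΛ : ∀ j < r, ∀ l x, |iteratedDeriv j (S.u l) x| ≤ Λ) :
    ∃ C, 0 ≤ C ∧ ∀ n l x η, (∀ s ≤ r, ∀ y, |iteratedDeriv s (S.ψ n) y| ≤ η) →
      |iteratedDeriv r (fun y => S.ψ n (S.f^[l] y)) x| ≤ C * η := by
  rcases Nat.eq_zero_or_pos r with rfl | hr0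
  · refine ⟨1, zero_le_one, fun n l x η h => ?_⟩
    simpa using h 0 le_rfl (S.f^[l] x)
  obtain ⟨B, hB, hcomp⟩ := exists_bound_iteratedDeriv_comp' r
  have hΛ0 : 0 ≤ Λ := (abs_nonneg _).trans (hΛ 0 hr0 0 0)
  set L := max 1 Λ with hL
  have hL1 : 1 ≤ L := le_max_left _ _
  refine ⟨Real.exp Λ ^ r + B * 1 * Real.exp Λ ^ r * L ^ r, by positivity, fun n l x η h => ?_⟩
  have hη : 0 ≤ η := (abs_nonneg _).trans (h 0 (Nat.zero_le _) 0)
  have hu : Real.exp (S.u l x) ≤ Real.exp Λ := by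
    have := hΛ 0 hr0 l x
    rw [iteratedDeriv_zero] at this
    exact Real.exp_le_exp.2 ((le_abs_self _).trans this)
  have hE1 : 1 ≤ Real.exp Λ := Real.one_le_exp hΛ0
  have h1 := hcomp r le_rfl (S.ψ n) S.f^[l] (S.u l)
    ((S.contDiff_ψ n).of_le (by exact_mod_cast hr))
    ((S.contDiff_u l).of_le (by norm_cast; omega)) (S.hasDerivAt_iterate l) x 1 L
    (η * Real.exp Λ ^ r) zero_le_one le_rfl (by linarith) (by positivity) (fun j hj1 hj => by
      calc |iteratedDeriv j (S.ψ n) (S.f^[l] x)| * Real.exp (S.u l x) ^ j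
          ≤ η * Real.exp Λ ^ j := by
            have := h j hj.le (S.f^[l] x)
            gcongr
        _ ≤ η * Real.exp Λ ^ r := by
            have := pow_le_pow_right₀ hE1 hj.le
            gcongr
        _ ≤ η * Real.exp Λ ^ r * L ^ j :=
            le_mul_of_one_le_right (by positivity) (one_le_pow₀ hL1)) fun j hj1 hj => by
      rw [one_mul]
      calc |iteratedDeriv j (S.u l) x| ≤ Λ := hΛ j hj l x
        _ ≤ L := le_max_right _ _
        _ ≤ L ^ j := le_self_pow₀ hL1 (by omega)
  have h2 : |iteratedDeriv r (S.ψ n) (S.f^[l] x) * Real.exp (S.u l x) ^ r| ≤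
      η * Real.exp Λ ^ r := by
    rw [abs_mul, abs_of_pos (by positivity : 0 < Real.exp (S.u l x) ^ r)]
    have := h r le_rfl (S.f^[l] x)
    gcongr
  have h3 := abs_sub_abs_le_abs_sub (iteratedDeriv r (fun y => S.ψ n (S.f^[l] y)) x)
    (iteratedDeriv r (S.ψ n) (S.f^[l] x) * Real.exp (S.u l x) ^ r)
  linarith

theorem exists_iteratedDeriv_u_add_sub_le {M r : ℕ} (hM : M ≤ k - 1) (hr : r ≤ M) {ε : ℕ → ℝ}
    (hε : ∀ n, ∀ s ≤ M, ∀ x,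
      S.c.q (n + 2) * |iteratedDeriv s (S.ψ (n + 1)) x| ≤ S.c.q (n + 1) * ε n) {Λ : ℝ}
    (hΛ : ∀ j < r, ∀ l x, |iteratedDeriv j (S.u l) x| ≤ Λ) :
    ∃ C, 0 ≤ C ∧ ∀ n l x, S.c.q (n + 2) * |iteratedDeriv r (S.u (l + S.c.q (n + 1))) x -
      iteratedDeriv r (S.u l) x| ≤ S.c.q (n + 1) * (C * ε n) := by
  obtain ⟨C, hC, h⟩ := S.exists_abs_iteratedDeriv_comp_le (hr.trans hM) hΛ
  refine ⟨C, hC, fun n l x => ?_⟩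
  have q2 : (0 : ℝ) < S.c.q (n + 2) := by exact_mod_cast S.c.q_succ_pos (n + 1)
  have h1 := h (n + 1) l x (S.c.q (n + 1) * ε n / S.c.q (n + 2)) fun s hs y => by
    rw [le_div_iff₀ q2, mul_comm]
    exact hε n s (hs.trans hr) y
  have e : iteratedDeriv r (S.u (l + S.c.q (n + 1))) x - iteratedDeriv r (S.u l) x =
      iteratedDeriv r (fun y => S.ψ (n + 1) (S.f^[l] y)) x := by
    have e1 : S.u (l + S.c.q (n + 1)) = fun y => S.u l y + S.ψ (n + 1) (S.f^[l] y) :=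
      funext fun y => S.u_add _ _ _
    have c1 : ContDiff ℝ r (S.u l) := (S.contDiff_u l).of_le (by norm_cast; omega)
    have c2 : ContDiff ℝ r fun y => S.ψ (n + 1) (S.f^[l] y) :=
      ((S.contDiff_ψ (n + 1)).of_le (by norm_cast; omega)).comp
        ((S.contDiff_iterate l).of_le (by norm_cast; omega))
    rw [e1, iteratedDeriv_fun_add c1.contDiffAt c2.contDiffAt, add_sub_cancel_left]
  rw [e]
  calc _ ≤ S.c.q (n + 2) * (C * (S.c.q (n + 1) * ε n / S.c.q (n + 2))) := by gcongr
    _ = _ := by field_simp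

theorem exists_iteratedDeriv_u_le {M : ℕ} (hM : M ≤ k - 1) {ε : ℕ → ℝ} (h0 : ∀ n, 0 ≤ ε n)
    (hs : Summable ε) (hε : ∀ n, ∀ s ≤ M, ∀ x,
      S.c.q (n + 2) * |iteratedDeriv s (S.ψ (n + 1)) x| ≤ S.c.q (n + 1) * ε n) :
    ∀ r ≤ M + 1, ∃ Λ, ∀ j < r, ∀ l x, |iteratedDeriv j (S.u l) x| ≤ Λ := by
  intro r
  induction r with
  | zero => exact fun _ => ⟨0, fun j hj => absurd hj (Nat.not_lt_zero _)⟩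
  | succ r ih =>
    intro hr
    obtain ⟨Λ, hΛ⟩ := ih (by omega)
    obtain ⟨C, hC, h⟩ := S.exists_iteratedDeriv_u_add_sub_le hM (by omega : r ≤ M) hε hΛ
    have key : ∀ n, ∀ l < S.c.q (n + 1), ∀ x,
        |iteratedDeriv r (S.u l) x| ≤ C * ∑ i ∈ range n, ε i := by
      intro n
      induction n with
      | zero =>
        intro l hl x
        rw [zero_add, S.c.q_one, Nat.lt_one_iff] at hl
        subst hl
        rw [S.u_zero']
        simp
      | succ n ihn =>
        intro l hl x
        have q1 := S.c.q_succ_pos n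
        have q1' : (0 : ℝ) < S.c.q (n + 1) := by exact_mod_cast q1
        have q2 : (0 : ℝ) < S.c.q (n + 2) := by exact_mod_cast S.c.q_succ_pos (n + 1)
        have b1 := ihn (l % S.c.q (n + 1)) (Nat.mod_lt _ q1) x
        have b2 := abs_add_mul_sub_le (v := fun l => iteratedDeriv r (S.u l) x)
          (q := S.c.q (n + 1)) (η := S.c.q (n + 1) * (C * ε n) / S.c.q (n + 2)) (fun j => by
            rw [le_div_iff₀ q2, mul_comm]; exact h n j x) (l / S.c.q (n + 1))
          (l % S.c.q (n + 1))
        simp only [Nat.mod_add_div'] at b2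
        have b3 : (l / S.c.q (n + 1) : ℕ) * (S.c.q (n + 1) * (C * ε n) / S.c.q (n + 2)) ≤
            C * ε n := by
          have a1 : ((l / S.c.q (n + 1) : ℕ) : ℝ) * S.c.q (n + 1) ≤ S.c.q (n + 2) := by
            exact_mod_cast (Nat.div_mul_le_self _ _).trans hl.le
          rw [mul_div_assoc', div_le_iff₀ q2, ← mul_assoc, mul_comm (C * ε n)]
          exact mul_le_mul_of_nonneg_right a1 (mul_nonneg hC (h0 n))
        have b4 := abs_sub_abs_le_abs_sub (iteratedDeriv r (S.u l) x)
          (iteratedDeriv r (S.u (l % S.c.q (n + 1))) x)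
        rw [sum_range_succ, mul_add]
        linarith
    refine ⟨max Λ (C * ∑' i, ε i), fun j hj l x => ?_⟩
    rcases Nat.lt_succ_iff_lt_or_eq.1 hj with hj | rfl
    · exact (hΛ j hj l x).trans (le_max_left _ _)
    · have hl : l < S.c.q (2 * l + 1 + 1) := by
        have := S.c.le_q (2 * l + 1 + 1)
        omega
      refine (key _ l hl x).trans (le_trans ?_ (le_max_right _ _))
      exact mul_le_mul_of_nonneg_left (hs.sum_le_tsum _ fun i _ => h0 i) hC

end SmoothLift

namespace SmoothLift

variable {k : ℕ} {α : ℝ} (S : SmoothLift k α)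

theorem exists_mul_d_le_m {Λ : ℝ} (hΛ : ∀ l x, |S.u l x| ≤ Λ) :
    ∃ c > 0, ∀ n x, c * S.c.d n ≤ S.m n x := by
  refine ⟨Real.exp (-Λ) * (1 + Real.exp Λ)⁻¹, by positivity, fun n y => ?_⟩
  obtain ⟨x, hx⟩ := S.exists_d_le_m n
  obtain ⟨l, -, p, x', hx', rfl⟩ := S.exists_mem_J_iterate_eq n x y
  obtain ⟨ξ, -, h⟩ := S.exists_m_iterate_eq n l x'
  rw [m_add_int, h]
  have h1 := (S.m_le_of_mem_J (hΛ (S.c.q n)) hx').2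
  have h2 : S.c.d n ≤ (1 + Real.exp Λ) * S.m n x' := hx.trans h1
  have h3 : (1 + Real.exp Λ)⁻¹ * S.c.d n ≤ S.m n x' := by
    rwa [inv_mul_le_iff₀ (by positivity)]
  have h4 : Real.exp (-Λ) ≤ Real.exp (S.u l ξ) := Real.exp_le_exp.2 (abs_le.1 (hΛ l ξ)).1
  have h5 := S.c.d_pos n
  rw [mul_assoc]
  exact mul_le_mul h4 h3 (by positivity) (Real.exp_pos _).le

theorem exists_summable_of_eventually {M n₁ : ℕ} {D σ : ℝ} (hM : M ≤ k - 1) (hD : 0 < D)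
    (hσ : 0 < σ) (h : ∀ n ≥ n₁, ∀ r ≤ M, ∀ x,
      (S.c.q (n + 2) / S.c.q (n + 1) : ℝ) * |iteratedDeriv r (S.ψ (n + 1)) x| ≤
        D * S.c.d n ^ σ) :
    ∃ ε : ℕ → ℝ, (∀ n, 0 ≤ ε n) ∧ Summable ε ∧ ∀ n, ∀ r ≤ M, ∀ x,
      S.c.q (n + 2) * |iteratedDeriv r (S.ψ (n + 1)) x| ≤ S.c.q (n + 1) * ε n := by
  have hb : ∀ n, ∀ r ≤ M, ∃ B, 0 ≤ B ∧ ∀ x, |iteratedDeriv r (S.ψ (n + 1)) x| ≤ B :=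
    fun n r hr => exists_abs_le_of_periodic
      ((S.contDiff_ψ (n + 1)).continuous_iteratedDeriv r (by norm_cast; omega))
      (iteratedDeriv_periodic (S.ψ_add_int _) r)
  choose! B hB0 hB using hb
  have hq : ∀ n, (0 : ℝ) < S.c.q (n + 1) := fun n => by exact_mod_cast S.c.q_succ_pos n
  set b : ℕ → ℝ := fun n => ∑ r ∈ range (M + 1), B n r with hbdef
  have hb0 : ∀ n, 0 ≤ b n := fun n => sum_nonneg fun r hr =>
    hB0 n r (Nat.lt_succ_iff.1 (mem_range.1 hr))
  refine ⟨fun n => if n < n₁ then S.c.q (n + 2) / S.c.q (n + 1) * b n else D * S.c.d n ^ σ,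
    fun n => ?_, ?_, fun n r hr x => ?_⟩
  · have := hb0 n
    have := Real.rpow_pos_of_pos (S.c.d_pos n) σ
    dsimp only
    split_ifs <;> positivity
  · rw [← summable_nat_add_iff n₁]
    refine ((summable_nat_add_iff n₁).2 ((S.summable_d_rpow hσ).mul_left D)).congr fun n => ?_
    rw [if_neg (by omega)]
  · have h1 := hq n
    dsimp only
    split_ifs with hn
    · have h2 : |iteratedDeriv r (S.ψ (n + 1)) x| ≤ b n := (hB n r hr x).trans
        (single_le_sum (f := B n) (fun r hr => hB0 n r (Nat.lt_succ_iff.1 (mem_range.1 hr)))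
          (mem_range.2 (Nat.lt_succ_iff.2 hr)))
      calc _ ≤ S.c.q (n + 2) * b n := by gcongr
        _ = _ := by field_simp
    · have h2 := h n (not_lt.1 hn) r hr x
      rw [div_mul_eq_mul_div, div_le_iff₀ h1] at h2
      linarith

theorem exists_summable {M : ℕ} {C τ : ℝ} (hk : 3 ≤ k) (hC : 0 < C) (hτ : 1 < τ)
    (hdio : ∀ n, C * S.c.d n ^ τ ≤ S.c.d (n + 1)) (hM : (M : ℝ) + 1 < k - τ) :
    ∃ ε : ℕ → ℝ, (∀ n, 0 ≤ ε n) ∧ Summable ε ∧ ∀ n, ∀ r ≤ M, ∀ x,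
      S.c.q (n + 2) * |iteratedDeriv r (S.ψ (n + 1)) x| ≤ S.c.q (n + 1) * ε n := by
  obtain ⟨D, hD, σ, hσ, n₁, h⟩ := S.exists_ratio_mul_le hk hC hτ hdio hM
  have hMk : M ≤ k - 1 := by
    have : ((M + 2 : ℕ) : ℝ) < k := by push_cast; linarith
    have := Nat.cast_lt.1 this
    omega
  obtain ⟨ε₀, h0, hs, hε⟩ := S.exists_summable_of_eventually (M := 0) (Nat.zero_le _) hD hσ
    (n₁ := n₁) fun n hn r hr x => by
      obtain rfl : r = 0 := by omega
      simpa using h n hn 0 (Nat.zero_le _) x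
  obtain ⟨Λ, hΛ⟩ := S.exists_iteratedDeriv_u_le (M := 0) (Nat.zero_le _) h0 hs hε 1 le_rfl
  obtain ⟨c, hc, hm⟩ := S.exists_mul_d_le_m (Λ := Λ) fun l x => by
    simpa using hΛ 0 one_pos l x
  refine S.exists_summable_of_eventually (n₁ := n₁) (D := D * (min c 1)⁻¹ ^ M) hMk
    (by positivity) hσ fun n hn r hr x => ?_
  have hc' : 0 < min c 1 := lt_min hc one_pos
  have hd := S.c.d_pos n
  have hdr : 0 < S.c.d n ^ r := by positivity
  have hdσ := Real.rpow_pos_of_pos hd σ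
  have h1 : S.c.d n ^ r ≤ (min c 1)⁻¹ ^ r * S.m n x ^ r := by
    rw [← mul_pow]
    refine pow_le_pow_left₀ hd.le ?_ _
    rw [le_inv_mul_iff₀ hc']
    exact (mul_le_mul_of_nonneg_right (min_le_left _ _) hd.le).trans (hm n x)
  have h2 : (min c 1)⁻¹ ^ r ≤ (min c 1)⁻¹ ^ M :=
    pow_le_pow_right₀ ((one_le_inv₀ hc').2 (min_le_right _ _)) hr
  set X := (S.c.q (n + 2) / S.c.q (n + 1) : ℝ) * |iteratedDeriv r (S.ψ (n + 1)) x| with hX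
  have hX0 : 0 ≤ X := by positivity
  have h3 := h n hn r hr x
  rw [← mul_assoc, ← hX] at h3
  have hmr : 0 < S.m n x ^ r := pow_pos (S.m_pos n x) r
  refine le_of_mul_le_mul_right ?_ hmr
  calc X * S.m n x ^ r ≤ D * S.c.d n ^ σ * S.c.d n ^ r := h3
    _ ≤ D * S.c.d n ^ σ * ((min c 1)⁻¹ ^ M * S.m n x ^ r) := by
      refine mul_le_mul_of_nonneg_left (h1.trans ?_) (by positivity)
      gcongr
    _ = _ := by ring

/-- The Birkhoff averages of `u j` along the denominators of the convergents. -/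
noncomputable def average (n : ℕ) (x : ℝ) : ℝ := (∑ j ∈ range (S.c.q n), S.u j x) / S.c.q n

theorem contDiff_average (n : ℕ) : ContDiff ℝ (k - 1 : ℕ) (S.average n) :=
  (ContDiff.sum fun j _ => S.contDiff_u j).div_const _

theorem iteratedDeriv_average {r : ℕ} (hr : r ≤ k - 1) (n : ℕ) (x : ℝ) :
    iteratedDeriv r (S.average n) x =
      (∑ j ∈ range (S.c.q n), iteratedDeriv r (S.u j) x) / S.c.q n := by
  have h : ∀ j ∈ range (S.c.q n), ContDiffAt ℝ r (S.u j) x := fun j _ =>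
    ((S.contDiff_u j).of_le (by exact_mod_cast hr)).contDiffAt
  unfold average
  rw [iteratedDeriv_div_const, iteratedDeriv_fun_sum h]

theorem average_comp_sub {n : ℕ} (hn : n ≠ 0) (x : ℝ) :
    S.average n (S.f x) - S.average n x = S.ψ n x / S.c.q n - S.φ x := by
  obtain ⟨n, rfl⟩ := Nat.exists_eq_succ_of_ne_zero hn
  have hq : (0 : ℝ) < S.c.q (n + 1) := by exact_mod_cast S.c.q_succ_pos n
  have e : ∀ j, S.u j (S.f x) = S.u (j + 1) x - S.φ x := fun j => by
    rw [add_comm j 1, S.u_add 1 j]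
    simp [u]
  have : ∑ j ∈ range (S.c.q (n + 1)), S.u j (S.f x) =
      ∑ j ∈ range (S.c.q (n + 1)), S.u j x + S.ψ (n + 1) x - S.c.q (n + 1) * S.φ x := by
    simp only [e, sum_sub_distrib]
    have h1 := sum_range_succ (fun j => S.u j x) (S.c.q (n + 1))
    rw [sum_range_succ', u_zero, add_zero] at h1
    rw [h1, ψ]
    simp
  simp only [average, Nat.succ_eq_add_one, this]
  field_simp
  ring

theorem exists_cohomological_solution {M : ℕ} {C τ : ℝ} (hk : 3 ≤ k) (hC : 0 < C) (hτ : 1 < τ)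
    (hdio : ∀ n, C * S.c.d n ^ τ ≤ S.c.d (n + 1)) (hM : (M : ℝ) + 1 < k - τ) :
    ∃ g : ℝ → ℝ, ContDiff ℝ M g ∧ (∀ (x : ℝ) (p : ℤ), g (x + p) = g x) ∧
      ∀ x, g (S.f x) = g x - S.φ x := by
  obtain ⟨ε, h0, hs, hε⟩ := S.exists_summable hk hC hτ hdio hM
  have hMk : M ≤ k - 1 := by
    have : ((M + 2 : ℕ) : ℝ) < k := by push_cast; linarith
    have := Nat.cast_lt.1 this
    omega
  obtain ⟨Λ, hΛ⟩ := S.exists_iteratedDeriv_u_le hMk h0 hs hε (M + 1) le_rfl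
  have key : ∀ r ≤ M, ∃ w : ℕ → ℝ, Summable w ∧ ∀ n x,
      |iteratedDeriv r (S.average (n + 1)) x - iteratedDeriv r (S.average n) x| ≤ w n := by
    intro r hr
    obtain ⟨B, hB, hstep⟩ := S.exists_iteratedDeriv_u_add_sub_le hMk hr hε
      fun j hj => hΛ j (by omega)
    obtain ⟨w, hw, hmax⟩ := exists_summable_of_contraction (fun n => mul_nonneg hB (h0 n))
      (hs.mul_left B)
    refine ⟨w, hw, fun n x => hmax
      (fun n => |iteratedDeriv r (S.average (n + 1)) x - iteratedDeriv r (S.average n) x|)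
      ?_ (fun n => ?_) n⟩
    · have e0 := S.c.q_zero
      have e1 := S.c.q_one
      simp [iteratedDeriv_average S (hr.trans hMk), e0, e1, u_zero']
    · simp only [iteratedDeriv_average S (hr.trans hMk)]
      exact S.c.abs_average_sub_le (v := fun j => iteratedDeriv r (S.u j) x)
        (ε := fun n => B * ε n) (fun n j => hstep n j x) n
  choose! w hw hwle using key
  have hdiff : ∀ n, ContDiff ℝ M fun x => S.average (n + 1) x - S.average n x := fun n =>
    ((S.contDiff_average _).sub (S.contDiff_average _)).of_le (by exact_mod_cast hMk)
  have hsum : ∀ x, Summable fun n => S.average (n + 1) x - S.average n x := fun x =>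
    .of_norm_bounded (hw 0 (Nat.zero_le _)) fun n => by
      simpa using hwle 0 (Nat.zero_le _) n x
  set g : ℝ → ℝ := fun x => ∑' n, (S.average (n + 1) x - S.average n x) with hg
  have hlim : ∀ x, Filter.Tendsto (fun n => S.average n x) Filter.atTop (nhds (g x)) := by
    intro x
    refine (hsum x).hasSum.tendsto_sum_nat.congr fun n => ?_
    rw [sum_range_sub fun n => S.average n x]
    simp [average, S.c.q_zero]
  refine ⟨g, ?_, fun x p => ?_, fun x => ?_⟩
  · refine contDiff_tsum (N := M) (v := w) hdiff (fun r hr => hw r (by exact_mod_cast hr))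
      fun r n x hr => ?_
    have hr : r ≤ M := by exact_mod_cast hr
    have c : ∀ n, ContDiffAt ℝ r (S.average n) x := fun n =>
      ((S.contDiff_average n).of_le (by exact_mod_cast hr.trans hMk)).contDiffAt
    rw [norm_iteratedFDeriv_eq_norm_iteratedDeriv, Real.norm_eq_abs,
      iteratedDeriv_fun_sub (c _) (c _)]
    exact hwle r hr n x
  · simp only [hg, average, u_add_int]
  · refine tendsto_nhds_unique (hlim (S.f x)) ?_
    have hq : Filter.Tendsto (fun n => (S.c.q n : ℝ)) Filter.atTop Filter.atTop := by
      refine tendsto_natCast_atTop_atTop.comp (Filter.tendsto_atTop_atTop.2 fun b =>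
        ⟨2 * b, fun n hn => ?_⟩)
      have := S.c.le_q n
      omega
    have hψ : Filter.Tendsto (fun n => S.ψ n x / S.c.q n) Filter.atTop (nhds 0) := by
      refine squeeze_zero_norm (fun n => ?_) (hq.const_div_atTop Λ)
      have := hΛ 0 (Nat.succ_pos _) (S.c.q n) x
      rw [iteratedDeriv_zero] at this
      rw [Real.norm_eq_abs, abs_div, Nat.abs_cast]
      exact div_le_div_of_nonneg_right this (Nat.cast_nonneg _)
    have := (hlim x).add (hψ.sub_const (S.φ x))
    rw [zero_sub, ← sub_eq_add_neg] at this
    refine this.congr' ?_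
    filter_upwards [Filter.eventually_ne_atTop 0] with n hn
    rw [← S.average_comp_sub hn]
    ring

end SmoothLift

namespace SmoothLift

variable {k : ℕ} {α : ℝ} (S : SmoothLift k α)

theorem eq_of_semiconj_add {h : ℝ → ℝ} (hc : Continuous h) (h1 : ∀ x, h (x + 1) = h x + 1) {c : ℝ}
    (hf : ∀ x, h (S.f x) = h x + c) : c = α := by
  have hint : ∀ (x : ℝ) (p : ℤ), h (x + p) = h x + p := by
    intro x p
    induction p using Int.induction_on with
    | zero => simp
    | succ n ih =>
      have := h1 (x + n)
      push_cast at *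
      rw [← add_assoc, this, ih]; ring
    | pred n ih =>
      have := h1 (x + (-n - 1))
      push_cast at *
      rw [show x + (-(n : ℝ) - 1) + 1 = x + -n by ring, ih] at this
      linarith
  obtain ⟨B, -, hB⟩ := exists_abs_le_of_periodic (g := fun x => h x - x) (hc.sub continuous_id)
    fun x p => by rw [hint]; ring
  have hn : ∀ n : ℕ, h (S.f^[n] 0) = h 0 + n * c := fun n => by
    induction n with
    | zero => simp
    | succ n ih => rw [Function.iterate_succ_apply', hf, ih]; push_cast; ring
  refine tendsto_nhds_unique ?_ (S.tendsto 0)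
  have hz : Filter.Tendsto (fun n : ℕ => (S.f^[n] 0 - 0) / n - c) Filter.atTop (nhds 0) := by
    refine squeeze_zero_norm' ?_ (tendsto_natCast_atTop_atTop.const_div_atTop (2 * B))
    filter_upwards [Filter.eventually_gt_atTop 0] with n hn0
    have hn' : (0 : ℝ) < n := by exact_mod_cast hn0
    have e : (S.f^[n] 0 - 0) / n - c = (h 0 - 0 - (h (S.f^[n] 0) - S.f^[n] 0)) / n := by
      rw [hn]; field_simp; ring
    rw [e, Real.norm_eq_abs, abs_div, Nat.abs_cast]
    refine div_le_div_of_nonneg_right ((abs_sub _ _).trans ?_) hn'.le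
    linarith [hB 0, hB (S.f^[n] 0)]
  have := hz.add_const c
  simpa using this

theorem exists_conjugacy {g : ℝ → ℝ} {M : ℕ} (hg : ContDiff ℝ M g)
    (hp : ∀ (x : ℝ) (p : ℤ), g (x + p) = g x) (hf : ∀ x, g (S.f x) = g x - S.φ x) :
    ∃ h : ℝ → ℝ, StrictMono h ∧ (∀ x, h (x + 1) = h x + 1) ∧ (∀ x, h (S.f x) = h x + α) ∧
      ContDiff ℝ (M + 1 : ℕ) h := by
  have hc : Continuous fun x => Real.exp (g x) := Real.continuous_exp.comp hg.continuous
  have hp' : Function.Periodic (fun x => Real.exp (g x)) 1 := fun x => by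
    have := hp x 1
    rw [Int.cast_one] at this
    simp only [this]
  set I := ∫ t in (0 : ℝ)..1, Real.exp (g t) with hI
  have hI0 : 0 < I := intervalIntegral.intervalIntegral_pos_of_pos (hc.intervalIntegrable _ _)
    (fun x => Real.exp_pos _) one_pos
  set h : ℝ → ℝ := fun x => (∫ t in (0 : ℝ)..x, Real.exp (g t)) / I with hh
  have hd : ∀ x, HasDerivAt h (Real.exp (g x) / I) x := fun x =>
    (hc.integral_hasStrictDerivAt 0 x).hasDerivAt.div_const I
  have hderiv : deriv h = fun x => Real.exp (g x) / I := funext fun x => (hd x).deriv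
  have hcd : ContDiff ℝ (M + 1 : ℕ) h := by
    push_cast
    rw [contDiff_succ_iff_deriv]
    refine ⟨fun x => (hd x).differentiableAt, fun h => by simp at h, ?_⟩
    rw [hderiv]
    exact (Real.contDiff_exp.comp hg).div_const _
  have h1 : ∀ x, h (x + 1) = h x + 1 := fun x => by
    have e := intervalIntegral.integral_add_adjacent_intervals
      (hc.intervalIntegrable 0 x) (hc.intervalIntegrable (μ := MeasureTheory.volume) x (x + 1))
    rw [hp'.intervalIntegral_add_eq x 0, zero_add, ← hI] at e
    simp only [hh]
    rw [← e]
    field_simp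
  have hcomp : ∀ x, HasDerivAt (fun x => h (S.f x) - h x) 0 x := fun x => by
    have hfd : HasDerivAt S.f (deriv S.f x) x := (S.differentiable x).hasDerivAt
    have := ((hd (S.f x)).comp x hfd).sub (hd x)
    rw [← S.exp_φ, hf, div_mul_eq_mul_div, ← Real.exp_add, sub_add_cancel, sub_self] at this
    exact this
  have hconst : ∀ x, h (S.f x) = h x + (h (S.f 0) - h 0) := fun x => by
    have := is_const_of_deriv_eq_zero (fun x => (hcomp x).differentiableAt)
      (fun x => (hcomp x).deriv) x 0
    linarith
  have hα := S.eq_of_semiconj_add hcd.continuous h1 hconst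
  refine ⟨h, strictMono_of_deriv_pos fun x => ?_, h1, fun x => by rw [hconst, hα], hcd⟩
  rw [hderiv]
  positivity

end SmoothLift

/-- Herman–Yoccoz–Teplinsky: a `C^k` circle diffeomorphism (given by its
lift `f`) with `(C, τ)`-Diophantine rotation number `α`, `1 < τ < k − 1`, is linearizable
by a conjugacy `h` which is `C^m` for every integer `m < k − τ`. -/
theorem stmt12 (k : ℕ) (hk : 3 ≤ k)
    (f : ℝ → ℝ) (hf : ContDiff ℝ k f)
    (hlift : ∀ x : ℝ, f (x + 1) = f x + 1)
    (hpos : ∀ x : ℝ, 0 < deriv f x)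
    (α : ℝ)
    (hrot : ∀ x : ℝ, Filter.Tendsto (fun n : ℕ => (f^[n] x - x) / n)
      Filter.atTop (nhds α))
    (C τ : ℝ) (hC : 0 < C) (hτ1 : 1 < τ) (hτk : τ < k - 1)
    (hdio : ∀ q : ℤ, q ≠ 0 → ∀ p : ℤ, |(q : ℝ) * α - p| > C * (|(q : ℝ)|) ^ (-τ)) :
    ∃ h : ℝ → ℝ, StrictMono h ∧ (∀ x : ℝ, h (x + 1) = h x + 1) ∧
      (∀ x : ℝ, h (f x) = h x + α) ∧
      ∀ m : ℕ, (m : ℝ) < k - τ → ContDiff ℝ m h := by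
  have hM : ∃ M : ℕ, (M : ℝ) + 1 < k - τ ∧ ∀ m : ℕ, (m : ℝ) < k - τ → m ≤ M + 1 := by
    have h1 : 1 < ⌈(k : ℝ) - τ⌉₊ := Nat.lt_ceil.2 (by push_cast; linarith)
    refine ⟨⌈(k : ℝ) - τ⌉₊ - 2, ?_, fun m hm => ?_⟩
    · have h2 : ⌈(k : ℝ) - τ⌉₊ - 2 + 1 < ⌈(k : ℝ) - τ⌉₊ := by omega
      exact_mod_cast Nat.lt_ceil.1 h2
    · have := Nat.lt_ceil.2 hm
      omega
  obtain ⟨M, hM, hmax⟩ := hM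
  have hirr := irrational_of_diophantine hC hdio
  obtain ⟨c⟩ := hirr.nonempty_convergents
  let S : SmoothLift k α := ⟨f, by omega, hf, hlift, hpos, hrot, hirr, c⟩
  obtain ⟨g, hg, hgp, hgf⟩ := S.exists_cohomological_solution hk hC hτ1
    (c.diophantine hC (by linarith) hdio) hM
  obtain ⟨h, hmono, h1, hα, hcd⟩ := S.exists_conjugacy hg hgp hgf
  exact ⟨h, hmono, h1, hα, fun m hm => hcd.of_le (by exact_mod_cast hmax m hm)⟩
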